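/- arXiv:2108.07475 — 2 statements merged into one kernel-verified Lean document; each statement's English description precedes it below -/
import Mathlib

section
/- Let c > 0 and let f be an automorphism of the punctured Short ℂ², Ω'_c = {0 < G⁺_H < c}. Then G⁺_H ∘ f = G⁺_H on Ω'_c; consequently, for every 0 < b < c, f(Ω'_b) = Ω'_b, i.e. f restricts to an automorphism of Ω'_b. -/
open Filter Topology Set

noncomputable section

/-- `f : U → V` and `g : V → U` are mutually inverse holomorphic maps, i.e.
`f` is a biholomorphism from `U` onto `V` with inverse `g`. -/
def IsBiholoOn (f g : ℂ × ℂ → ℂ × ℂ) (U V : Set (ℂ × ℂ)) : Prop :=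
  DifferentiableOn ℂ f U ∧ DifferentiableOn ℂ g V ∧
    Set.MapsTo f U V ∧ Set.MapsTo g V U ∧
    (∀ z ∈ U, g (f z) = z) ∧ (∀ w ∈ V, f (g w) = w)

/-! ### Polynomial estimates -/

lemma poly_bound (q : Polynomial ℂ) (m : ℕ) (hq : q.natDegree ≤ m) :
    ∃ C : ℝ, 0 ≤ C ∧ ∀ y : ℂ, 1 ≤ ‖y‖ → ‖q.eval y‖ ≤ C * ‖y‖ ^ m := by
  refine ⟨∑ i ∈ Finset.range (m + 1), ‖q.coeff i‖, by positivity, fun y hy => ?_⟩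
  rw [Polynomial.eval_eq_sum_range' (Nat.lt_succ_of_le hq), Finset.sum_mul]
  refine (norm_sum_le _ _).trans (Finset.sum_le_sum fun i hi => ?_)
  rw [norm_mul, norm_pow]
  have : i ≤ m := Nat.lt_succ_iff.mp (Finset.mem_range.mp hi)
  gcongr

/-- The part of `p` of degree at most `d - 2`. -/
lemma poly_split (d : ℕ) (hd : 2 ≤ d) (p : Polynomial ℂ) (hpm : p.Monic) (hpd : p.natDegree = d)
    (hpc : p.coeff (d - 1) = 0) :
    ∃ q : Polynomial ℂ, q.natDegree ≤ d - 2 ∧ p = Polynomial.X ^ d + q := by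
  refine ⟨p - Polynomial.X ^ d, ?_, by ring⟩
  rw [Polynomial.natDegree_le_iff_coeff_eq_zero]
  intro N hN
  rw [Polynomial.coeff_sub, Polynomial.coeff_X_pow]
  rcases lt_trichotomy N d with h | h | h
  · have : N = d - 1 := by omega
    subst this
    rw [hpc, if_neg (by omega)]; simp
  · subst h
    have : p.coeff N = 1 := by rw [← hpd]; exact hpm
    simp [this]
  · rw [if_neg (by omega), Polynomial.coeff_eq_zero_of_natDegree_lt (by omega)]; simp

lemma exists_consts (d : ℕ) (hd : 2 ≤ d) (a : ℂ)
    (p : Polynomial ℂ) (hpm : p.Monic) (hpd : p.natDegree = d)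
    (hpc : p.coeff (d - 1) = 0) :
    ∃ C : ℝ, 1 ≤ C ∧ ‖a‖ ≤ C ∧
      (∀ x y : ℂ, 2 ≤ ‖y‖ → ‖x‖ ^ 2 < 2 * ‖y‖ →
        ‖(p.eval y - a * x) / y ^ d - 1‖ ≤ C / (‖y‖ * √‖y‖)) ∧
      (∀ x y : ℂ, 2 ≤ ‖y‖ → ‖x‖ ≤ ‖y‖ →
        ‖(p.eval y - a * x) / y ^ d - 1‖ ≤ C / ‖y‖) ∧
      (∀ y u v : ℂ, 2 ≤ ‖y‖ → ‖u - y‖ ≤ 1 → ‖v - y‖ ≤ 1 →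
        ‖p.eval v - p.eval u - (d * y ^ (d - 1)) * (v - u)‖ ≤ C * ‖v - u‖ * ‖y‖ ^ (d - 2)) := by
  obtain ⟨q, hq, rfl⟩ := poly_split d hd p hpm hpd hpc
  obtain ⟨C0, hC0, hC0'⟩ := poly_bound q _ hq
  obtain ⟨C1, hC1, hC1'⟩ := poly_bound (Polynomial.derivative q) (d - 2)
    ((Polynomial.natDegree_derivative_le q).trans (by omega))
  obtain ⟨e, rfl⟩ : ∃ e, d = e + 2 := ⟨d - 2, by omega⟩
  simp only [Nat.add_sub_cancel] at *
  -- basic estimate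
  have key : ∀ x y : ℂ, 2 ≤ ‖y‖ →
      ‖((Polynomial.X ^ (e + 2) + q).eval y - a * x) / y ^ (e + 2) - 1‖ ≤
        C0 / ‖y‖ ^ 2 + ‖a‖ * ‖x‖ / ‖y‖ ^ 2 := by
    intro x y hy
    have hy0 : y ≠ 0 := by intro h; simp [h] at hy; linarith
    have h1 : ((Polynomial.X ^ (e + 2) + q).eval y - a * x) / y ^ (e + 2) - 1 =
        q.eval y / y ^ (e + 2) - a * x / y ^ (e + 2) := by
      simp only [Polynomial.eval_add, Polynomial.eval_pow, Polynomial.eval_X]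
      field_simp
      ring
    rw [h1]
    refine (norm_sub_le _ _).trans ?_
    have hp : 0 < ‖y‖ := by linarith
    have h2 : ‖q.eval y / y ^ (e + 2)‖ ≤ C0 / ‖y‖ ^ 2 := by
      rw [norm_div, norm_pow, div_le_div_iff₀ (by positivity) (by positivity)]
      calc _ ≤ C0 * ‖y‖ ^ e * ‖y‖ ^ 2 := by gcongr; exact hC0' y (by linarith)
        _ = _ := by ring
    have h3 : ‖a * x / y ^ (e + 2)‖ ≤ ‖a‖ * ‖x‖ / ‖y‖ ^ 2 := by
      rw [norm_div, norm_pow, norm_mul]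
      gcongr
      · linarith
    linarith
  set K : ℝ := (e + 2) * (e + 1) * 2 ^ e + C1 * 2 ^ e with hK
  have hKnn : 0 ≤ K := by positivity
  refine ⟨1 + C0 + 2 * ‖a‖ + K, by linarith [norm_nonneg a], by linarith [norm_nonneg a], ?_, ?_, ?_⟩
  · intro x y hy hx
    refine (key x y hy).trans ?_
    have hp : 0 < ‖y‖ := by linarith
    set r := √‖y‖ with hr
    have hr2 : r ^ 2 = ‖y‖ := Real.sq_sqrt hp.le
    have hr1 : 1 ≤ r := by rw [hr]; exact Real.one_le_sqrt.mpr (by linarith)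
    have hx' : ‖x‖ ≤ 2 * r := by
      apply le_of_sq_le_sq _ (by linarith) |> fun h => h
      nlinarith
    rw [← hr2, ← add_div, div_le_div_iff₀ (by positivity) (by positivity)]
    have h4 : C0 + ‖a‖ * ‖x‖ ≤ (1 + C0 + 2 * ‖a‖ + K) * r := by
      have : ‖a‖ * ‖x‖ ≤ ‖a‖ * (2 * r) := by gcongr
      nlinarith [norm_nonneg a]
    calc _ ≤ (1 + C0 + 2 * ‖a‖ + K) * r * (r ^ 2 * r) := by gcongr
      _ = _ := by ring
  · intro x y hy hx
    refine (key x y hy).trans ?_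
    have hp : 0 < ‖y‖ := by linarith
    rw [← add_div, div_le_div_iff₀ (by positivity) (by positivity)]
    have h4 : C0 + ‖a‖ * ‖x‖ ≤ (1 + C0 + 2 * ‖a‖ + K) * ‖y‖ := by
      have : ‖a‖ * ‖x‖ ≤ ‖a‖ * ‖y‖ := by gcongr
      nlinarith [norm_nonneg a]
    calc _ ≤ (1 + C0 + 2 * ‖a‖ + K) * ‖y‖ * ‖y‖ := by gcongr
      _ = _ := by ring
  · intro y u v hy hu hv
    have hp : 0 < ‖y‖ := by linarith
    set A : ℂ := ((e + 2 : ℕ) : ℂ) * y ^ (e + 1) with hA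
    have hder : ∀ ξ ∈ Metric.closedBall y 1, HasDerivWithinAt
        (fun w => (Polynomial.X ^ (e + 2) + q).eval w - A * w)
        (((e + 2 : ℕ) : ℂ) * ξ ^ (e + 1) + (Polynomial.derivative q).eval ξ - A)
        (Metric.closedBall y 1) ξ := by
      intro ξ _
      apply HasDerivAt.hasDerivWithinAt
      have h1 := (Polynomial.X ^ (e + 2) + q).hasDerivAt ξ
      have h2 : HasDerivAt (fun w => A * w) A ξ := by
        simpa using (hasDerivAt_id ξ).const_mul A
      have h3 := h1.sub h2
      have h4 : (Polynomial.derivative (Polynomial.X ^ (e + 2) + q)).eval ξ =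
          ((e + 2 : ℕ) : ℂ) * ξ ^ (e + 1) + (Polynomial.derivative q).eval ξ := by
        simp
        left; ring
      rw [h4] at h3
      exact h3
    have hb : ∀ ξ ∈ Metric.closedBall y 1,
        ‖((e + 2 : ℕ) : ℂ) * ξ ^ (e + 1) + (Polynomial.derivative q).eval ξ - A‖ ≤ K * ‖y‖ ^ e := by
      intro ξ hξ
      rw [mem_closedBall_iff_norm] at hξ
      have hξ1 : ‖ξ‖ ≤ 2 * ‖y‖ := by
        have := norm_sub_norm_le ξ y; linarith
      have hξ2 : 1 ≤ ‖ξ‖ := by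
        have := norm_sub_norm_le y ξ; rw [norm_sub_rev] at this; linarith
      have h1 : ‖(Polynomial.derivative q).eval ξ‖ ≤ C1 * 2 ^ e * ‖y‖ ^ e := by
        refine (hC1' ξ hξ2).trans ?_
        rw [mul_assoc, ← mul_pow]
        gcongr
      have h2 : ‖ξ ^ (e + 1) - y ^ (e + 1)‖ ≤ (e + 1) * (2 * ‖y‖) ^ e := by
        rw [← (Commute.all ξ y).geom_sum₂_mul, norm_mul]
        calc _ ≤ ((e + 1) * (2 * ‖y‖) ^ e) * 1 := by
              gcongr
              refine (norm_sum_le _ _).trans ?_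
              calc _ ≤ ∑ i ∈ Finset.range (e + 1), (2 * ‖y‖) ^ e := by
                    refine Finset.sum_le_sum fun i hi => ?_
                    have hi' := Finset.mem_range.mp hi
                    rw [norm_mul, norm_pow, norm_pow]
                    calc _ ≤ (2 * ‖y‖) ^ i * (2 * ‖y‖) ^ (e + 1 - 1 - i) := by
                          gcongr; linarith
                      _ = _ := by rw [← pow_add]; congr 1; omega
                _ = _ := by simp
          _ = _ := by ring
      have h3 : ((e + 2 : ℕ) : ℂ) * ξ ^ (e + 1) + (Polynomial.derivative q).eval ξ - A =
          ((e + 2 : ℕ) : ℂ) * (ξ ^ (e + 1) - y ^ (e + 1)) + (Polynomial.derivative q).eval ξ := by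
        rw [hA]; ring
      rw [h3]
      refine (norm_add_le _ _).trans ?_
      rw [norm_mul, Complex.norm_natCast]
      have h4 : ((e + 2 : ℕ) : ℝ) * ‖ξ ^ (e + 1) - y ^ (e + 1)‖ ≤
          ((e + 2 : ℕ) : ℝ) * ((e + 1) * (2 * ‖y‖) ^ e) := by gcongr
      have h5 : ((e + 2 : ℕ) : ℝ) * ((e + 1) * (2 * ‖y‖) ^ e) =
          (e + 2) * (e + 1) * 2 ^ e * ‖y‖ ^ e := by rw [mul_pow]; push_cast; ring
      rw [hK, add_mul]
      linarith
    have := (convex_closedBall y 1).norm_image_sub_le_of_norm_hasDerivWithin_le hder hb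
      (mem_closedBall_iff_norm.mpr hu) (mem_closedBall_iff_norm.mpr hv)
    have h6 : (Polynomial.X ^ (e + 2) + q).eval v - A * v -
        ((Polynomial.X ^ (e + 2) + q).eval u - A * u) =
        (Polynomial.X ^ (e + 2) + q).eval v - (Polynomial.X ^ (e + 2) + q).eval u - A * (v - u) := by
      ring
    rw [h6] at this
    have h7 : e + 2 - 1 = e + 1 := rfl
    rw [h7]
    refine this.trans ?_
    have : 0 ≤ (1 + C0 + 2 * ‖a‖) * (‖v - u‖ * ‖y‖ ^ e) := by positivity
    nlinarith

/-! ### The setting -/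

/-- A Hénon map with its Green function and the constants used in the estimates. -/
structure HS where
  d : ℕ
  hd : 2 ≤ d
  a : ℂ
  ha : a ≠ 0
  p : Polynomial ℂ
  R : ℝ
  C : ℝ
  hC : 1 ≤ C
  haC : ‖a‖ ≤ C
  hRC : 1000 * C ≤ R
  E1 : ∀ x y : ℂ, R < ‖y‖ → ‖x‖ ^ 2 < 2 * ‖y‖ →
        ‖(p.eval y - a * x) / y ^ d - 1‖ ≤ C / (‖y‖ * √‖y‖)
  E1' : ∀ x y : ℂ, R < ‖y‖ → ‖x‖ ≤ ‖y‖ →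
        ‖(p.eval y - a * x) / y ^ d - 1‖ ≤ C / ‖y‖
  E2 : ∀ y u v : ℂ, R < ‖y‖ → ‖u - y‖ ≤ 1 → ‖v - y‖ ≤ 1 →
        ‖p.eval v - p.eval u - (d * y ^ (d - 1)) * (v - u)‖ ≤ C * ‖v - u‖ * ‖y‖ ^ (d - 2)
  G : ℂ × ℂ → ℝ
  Gcont : Continuous G
  Gnn : ∀ z, 0 ≤ G z
  Glim : ∀ z : ℂ × ℂ, Tendsto (fun n : ℕ =>
    Real.log (max ‖(fun z : ℂ × ℂ => (z.2, p.eval z.2 - a * z.1))^[n] z‖ 1) / (d : ℝ) ^ n)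
      atTop (𝓝 (G z))

namespace HS

variable (S : HS)

/-- The Hénon map. -/
def H (z : ℂ × ℂ) : ℂ × ℂ := (z.2, S.p.eval z.2 - S.a * z.1)

/-- The inverse of the Hénon map. -/
def Hi (z : ℂ × ℂ) : ℂ × ℂ := ((S.p.eval z.1 - z.2) / S.a, z.1)

lemma Glim' (z : ℂ × ℂ) : Tendsto (fun n : ℕ =>
    Real.log (max ‖S.H^[n] z‖ 1) / (S.d : ℝ) ^ n) atTop (𝓝 (S.G z)) := S.Glim z

lemma Hi_H (z : ℂ × ℂ) : S.Hi (S.H z) = z := by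
  have := S.ha
  ext <;> simp [H, Hi]
  field_simp

lemma H_Hi (z : ℂ × ℂ) : S.H (S.Hi z) = z := by
  have := S.ha
  ext <;> simp [H, Hi]
  field_simp
  ring

lemma Hin_Hn (n : ℕ) (z : ℂ × ℂ) : S.Hi^[n] (S.H^[n] z) = z :=
  (Function.LeftInverse.iterate (fun z => S.Hi_H z) n) z

lemma Hn_Hin (n : ℕ) (z : ℂ × ℂ) : S.H^[n] (S.Hi^[n] z) = z :=
  (Function.LeftInverse.iterate (fun z => S.H_Hi z) n) z

lemma H_diff : Differentiable ℂ S.H := by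
  have h : Differentiable ℂ fun z : ℂ × ℂ => S.p.eval z.2 :=
    S.p.differentiable.comp differentiable_snd
  unfold H
  exact differentiable_snd.prodMk (h.sub (differentiable_fst.const_mul _))

lemma Hi_diff : Differentiable ℂ S.Hi := by
  have h : Differentiable ℂ fun z : ℂ × ℂ => S.p.eval z.1 :=
    S.p.differentiable.comp differentiable_fst
  unfold Hi
  simp only [div_eq_mul_inv]
  exact ((h.sub differentiable_snd).mul_const _).prodMk differentiable_fst

lemma Hn_diff (n : ℕ) : Differentiable ℂ (S.H^[n]) := S.H_diff.iterate n
lemma Hin_diff (n : ℕ) : Differentiable ℂ (S.Hi^[n]) := S.Hi_diff.iterate n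

lemma hd0 : (0 : ℝ) < S.d := by have := S.hd; positivity
lemma hd2 : (2 : ℝ) ≤ S.d := by exact_mod_cast S.hd
lemma hR : 1000 ≤ S.R := by linarith [S.hC, S.hRC]

/-- The x-coordinates of the forward orbit. -/
def o (z : ℂ × ℂ) (n : ℕ) : ℂ := (S.H^[n] z).1

lemma o_succ (z : ℂ × ℂ) (n : ℕ) : S.o z (n + 1) = (S.H^[n] z).2 := by
  simp [o, Function.iterate_succ_apply', H]

lemma o_eq (z : ℂ × ℂ) (n : ℕ) : S.H^[n] z = (S.o z n, S.o z (n + 1)) := by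
  rw [o_succ]; rfl

lemma o_rec (z : ℂ × ℂ) (n : ℕ) :
    S.o z (n + 2) = S.p.eval (S.o z (n + 1)) - S.a * S.o z n := by
  rw [o_succ, o_succ, Function.iterate_succ_apply']; rfl

lemma o_add (z : ℂ × ℂ) (m n : ℕ) : S.o (S.H^[m] z) n = S.o z (n + m) := by
  simp [o, Function.iterate_add_apply]

lemma ext_o {z z' : ℂ × ℂ} (n : ℕ) (h1 : S.o z n = S.o z' n) (h2 : S.o z (n + 1) = S.o z' (n + 1)) :
    z = z' := by
  have : S.H^[n] z = S.H^[n] z' := by rw [o_eq, o_eq, h1, h2]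
  rw [← S.Hin_Hn n z, this, S.Hin_Hn]

lemma o_diff (n : ℕ) : Differentiable ℂ (fun z => S.o z n) :=
  differentiable_fst.comp (S.Hn_diff n)

/-- The small absorbing region. -/
def V : Set (ℂ × ℂ) := {z | S.R < ‖z.2‖ ∧ ‖z.1‖ ^ 2 < 2 * ‖z.2‖}

/-- The large absorbing region. -/
def W : Set (ℂ × ℂ) := {z | S.R < ‖z.2‖ ∧ ‖z.1‖ ≤ ‖z.2‖}

lemma V_open : IsOpen S.V := by
  apply IsOpen.inter
  · exact isOpen_lt continuous_const continuous_snd.norm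
  · exact isOpen_lt (continuous_fst.norm.pow 2) (continuous_const.mul continuous_snd.norm)

lemma V_sub_W : S.V ⊆ S.W := by
  rintro z ⟨h1, h2⟩
  refine ⟨h1, ?_⟩
  by_contra h
  push Not at h
  have := S.hR
  nlinarith

lemma pow_ge (y : ℂ) (hy : S.R < ‖y‖) : ‖y‖ ^ 2 ≤ ‖y‖ ^ S.d := by
  gcongr
  · linarith [S.hR]
  · exact S.hd

/-- main growth estimate in `W` -/
lemma W_step {z : ℂ × ℂ} (hz : z ∈ S.W) :
    S.H z ∈ S.V ∧ 2 * ‖z.2‖ ≤ ‖(S.H z).2‖ ∧ ‖(S.H z).2 / z.2 ^ S.d - 1‖ ≤ S.C / ‖z.2‖ ∧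
      99 / 100 * ‖z.2‖ ^ S.d ≤ ‖(S.H z).2‖ ∧ ‖(S.H z).2‖ ≤ 101 / 100 * ‖z.2‖ ^ S.d := by
  obtain ⟨x, y⟩ := z
  obtain ⟨h1, h2⟩ := hz
  simp only at h1 h2
  have hR := S.hR
  have hy0 : 0 < ‖y‖ := by linarith
  have hyd : 0 < ‖y‖ ^ S.d := by positivity
  have hy1 : y ^ S.d ≠ 0 := by
    intro h; rw [← norm_pow, h] at hyd; simp at hyd
  have h3 := S.E1' x y h1 h2
  simp only [H]
  set Q := S.p.eval y - S.a * x with hQ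
  have hC : S.C / ‖y‖ ≤ 1 / 100 := by
    rw [div_le_div_iff₀ hy0 (by norm_num)]; linarith [S.hRC, S.hC]
  have h4 : ‖Q - y ^ S.d‖ ≤ 1 / 100 * ‖y‖ ^ S.d := by
    have : Q - y ^ S.d = (Q / y ^ S.d - 1) * y ^ S.d := by field_simp
    rw [this, norm_mul, norm_pow]
    gcongr
    linarith
  have h5 := norm_sub_norm_le Q (y ^ S.d)
  have h6 := norm_sub_norm_le (y ^ S.d) Q
  rw [norm_sub_rev (y ^ S.d) Q] at h6
  rw [norm_pow] at h5 h6
  have h7 := S.pow_ge y h1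
  have h8 : 2 * ‖y‖ ≤ ‖Q‖ := by nlinarith
  refine ⟨⟨?_, ?_⟩, h8, h3, by linarith, by linarith⟩
  · simp only; linarith
  · simp only; nlinarith

lemma W_step' {z : ℂ × ℂ} (hz : z ∈ S.W) : S.H z ∈ S.W := S.V_sub_W (S.W_step hz).1

lemma V_step {z : ℂ × ℂ} (hz : z ∈ S.V) : S.H z ∈ S.V := (S.W_step (S.V_sub_W hz)).1

lemma V_iter {z : ℂ × ℂ} {n m : ℕ} (h : n ≤ m) (hz : S.H^[n] z ∈ S.V) : S.H^[m] z ∈ S.V := by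
  induction m, h using Nat.le_induction with
  | base => exact hz
  | succ k _ ih => rw [Function.iterate_succ_apply']; exact S.V_step ih

lemma W_iter {z : ℂ × ℂ} (m : ℕ) (hz : z ∈ S.W) : S.H^[m] z ∈ S.W := by
  induction m with
  | zero => exact hz
  | succ k ih => rw [Function.iterate_succ_apply']; exact S.W_step' ih

lemma W_norm {z : ℂ × ℂ} (hz : z ∈ S.W) : ‖z‖ = ‖z.2‖ := by
  rw [Prod.norm_def]; exact max_eq_right hz.2

lemma W_pos {z : ℂ × ℂ} (hz : z ∈ S.W) : 1000 ≤ ‖z.2‖ := by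
  have := hz.1; linarith [S.hR]

lemma G_H (z : ℂ × ℂ) : S.G (S.H z) = S.d * S.G z := by
  have h1 := S.Glim' (S.H z)
  have h2 := ((S.Glim' z).comp (tendsto_add_atTop_nat 1)).const_mul (S.d : ℝ)
  refine tendsto_nhds_unique h1 (h2.congr fun n => ?_)
  simp only [Function.comp_apply, Function.iterate_succ_apply]
  have := S.hd0
  field_simp
  ring

lemma G_Hn (n : ℕ) (z : ℂ × ℂ) : S.G (S.H^[n] z) = S.d ^ n * S.G z := by
  induction n with
  | zero => simp
  | succ k ih => rw [Function.iterate_succ_apply', G_H, ih]; ring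

lemma G_Hin (n : ℕ) (z : ℂ × ℂ) : S.G (S.Hi^[n] z) = S.G z / S.d ^ n := by
  have h := S.G_Hn n (S.Hi^[n] z)
  rw [S.Hn_Hin] at h
  have := S.hd0
  rw [h]; field_simp

/-- In `W`, the Green function is the limit of `log |y_n| / d ^ n`. -/
lemma G_W_lim {z : ℂ × ℂ} (M : ℕ) (hz : S.H^[M] z ∈ S.W) :
    Tendsto (fun n => Real.log ‖S.o z (n + 1)‖ / (S.d : ℝ) ^ n) atTop (𝓝 (S.G z)) := by
  refine (S.Glim' z).congr' ?_
  filter_upwards [eventually_ge_atTop M] with n hn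
  have : S.H^[n] z ∈ S.W := by
    obtain ⟨k, rfl⟩ := Nat.exists_eq_add_of_le' hn
    rw [Function.iterate_add_apply]; exact S.W_iter k hz
  rw [S.W_norm this, max_eq_left (by linarith [S.W_pos this]), S.o_succ]

lemma G_W {z : ℂ × ℂ} (hz : z ∈ S.W) : |S.G z - Real.log ‖z.2‖| ≤ 1 := by
  have hlim := S.G_W_lim 0 hz
  have hd := S.hd2
  have hd0 := S.hd0
  set u : ℕ → ℝ := fun n => Real.log ‖S.o z (n + 1)‖ / (S.d : ℝ) ^ n with hu
  have hstep : ∀ n, |u (n + 1) - u n| ≤ (1 / 2) * (1 / 2) ^ n := by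
    intro n
    have hW := S.W_iter n hz
    obtain ⟨-, -, -, h1, h2⟩ := S.W_step hW
    have h0 := S.W_pos hW
    rw [← Function.iterate_succ_apply' S.H, ← S.o_succ] at h1 h2
    rw [← S.o_succ] at h0 h1 h2
    set A := ‖S.o z (n + 1)‖
    have hA : 0 < A ^ S.d := by positivity
    have h3 : |Real.log ‖S.o z (n + 1 + 1)‖ - S.d * Real.log A| ≤ 1 := by
      rw [← Real.log_pow, ← Real.log_div (by nlinarith) hA.ne', abs_le]
      constructor
      · rw [Real.le_log_iff_exp_le (by apply div_pos <;> nlinarith)]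
        rw [le_div_iff₀ hA]
        have : Real.exp (-1) ≤ 99 / 100 := by
          have := Real.exp_neg_one_lt_half; linarith
        nlinarith
      · rw [Real.log_le_iff_le_exp (by apply div_pos <;> nlinarith)]
        rw [div_le_iff₀ hA]
        have : 2 ≤ Real.exp 1 := by have := Real.add_one_le_exp (1 : ℝ); linarith
        nlinarith
    have h4 : u (n + 1) - u n = (Real.log ‖S.o z (n + 1 + 1)‖ - S.d * Real.log A) / S.d ^ (n + 1) := by
      simp only [hu]; field_simp; ring
    rw [h4, abs_div, abs_of_pos (by positivity : (0 : ℝ) < S.d ^ (n + 1))]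
    calc _ ≤ 1 / (S.d : ℝ) ^ (n + 1) := by gcongr
      _ ≤ 1 / 2 ^ (n + 1) := by gcongr
      _ = _ := by rw [pow_succ, one_div_pow]; ring
  have hd' : ∀ n, dist (u n) (u (n + 1)) ≤ (1 / 2) * (1 / 2) ^ n := by
    intro n; rw [dist_comm, Real.dist_eq]; exact hstep n
  have := dist_le_of_le_geometric_of_tendsto₀ (1 / 2) (1 / 2) (by norm_num) hd' hlim
  rw [dist_comm, Real.dist_eq] at this
  have h0 : u 0 = Real.log ‖z.2‖ := by simp [hu, S.o_succ]
  rw [h0] at this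
  refine this.trans (by norm_num)

lemma G_W_pos {z : ℂ × ℂ} (hz : z ∈ S.W) : 0 < S.G z := by
  have h := abs_le.mp (S.G_W hz)
  have h1 := S.W_pos hz
  have : 1 < Real.log ‖z.2‖ := by
    rw [Real.lt_log_iff_exp_lt (by linarith)]
    have := Real.exp_one_lt_d9
    linarith
  linarith

lemma G_V_pos {z : ℂ × ℂ} {n : ℕ} (hz : S.H^[n] z ∈ S.V) : 0 < S.G z := by
  have h := S.G_W_pos (S.V_sub_W hz)
  rw [G_Hn] at h
  have := S.hd0
  exact (pos_iff_pos_of_mul_pos h).mp (by positivity)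

/-- Every escaping point enters `V`. -/
lemma exists_V {z : ℂ × ℂ} (hz : 0 < S.G z) : ∃ M, S.H^[M] z ∈ S.V := by
  -- norms tend to infinity
  have hd := S.hd2
  have hd0 := S.hd0
  have h1 : Tendsto (fun n : ℕ => (S.d : ℝ) ^ n) atTop atTop :=
    tendsto_pow_atTop_atTop_of_one_lt (by linarith)
  have h2 : Tendsto (fun n => Real.log (max ‖S.H^[n] z‖ 1)) atTop atTop := by
    refine ((S.Glim' z).pos_mul_atTop hz h1).congr fun n => ?_
    field_simp
  have h3 : Tendsto (fun n => max ‖S.H^[n] z‖ 1) atTop atTop := by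
    refine (Real.tendsto_exp_atTop.comp h2).congr fun n => ?_
    simp only [Function.comp_apply]
    rw [Real.exp_log (by positivity)]
  obtain ⟨N, hN⟩ := eventually_atTop.mp (h3.eventually_gt_atTop (S.R + 1))
  have hN' : ∀ n ≥ N, S.R < ‖S.H^[n] z‖ := by
    intro n hn
    have := hN n hn
    have hR := S.hR
    rcases lt_max_iff.mp this with h | h <;> linarith
  by_contra hcon
  push Not at hcon
  have hnW : ∀ n ≥ N, ‖(S.H^[n] z).2‖ < ‖(S.H^[n] z).1‖ := by
    intro n hn
    by_contra h
    push Not at h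
    have hW : S.H^[n] z ∈ S.W := by
      refine ⟨?_, h⟩
      have := hN' n hn
      rwa [Prod.norm_def, max_eq_right h] at this
    apply hcon (n + 1)
    rw [Function.iterate_succ_apply']
    exact (S.W_step hW).1
  have hdec : ∀ n ≥ N, ‖S.o z n‖ ≤ ‖S.o z N‖ := by
    intro n hn
    induction n, hn using Nat.le_induction with
    | base => exact le_rfl
    | succ k hk ih =>
      have := hnW k hk
      rw [← S.o_succ] at this
      exact this.le.trans ih
  obtain ⟨n, hn1, hn2⟩ := ((h3.eventually_gt_atTop (max ‖S.o z N‖ 1)).and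
    (eventually_ge_atTop N)).exists
  have h5 : ‖S.H^[n] z‖ = ‖S.o z n‖ := by
    rw [Prod.norm_def]; exact max_eq_left (hnW n hn2).le
  rw [h5] at hn1
  have := hdec n hn2
  have : max ‖S.o z n‖ 1 ≤ max ‖S.o z N‖ 1 := max_le_max_right _ this
  linarith

/-- Geometric growth along tails in `V`. -/
lemma tail_growth {z : ℂ × ℂ} {M : ℕ} (hz : S.H^[M] z ∈ S.V) (j : ℕ) :
    2 ^ j * S.R ≤ ‖S.o z (M + j + 1)‖ := by
  induction j with
  | zero => rw [S.o_succ]; simpa using hz.1.le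
  | succ k ih =>
    have h := S.V_iter (by omega : M ≤ M + k) hz
    have := (S.W_step (S.V_sub_W h)).2.1
    rw [← Function.iterate_succ_apply' S.H, ← S.o_succ, ← S.o_succ] at this
    rw [pow_succ]
    have h2 : M + (k + 1) + 1 = (M + k).succ + 1 := by omega
    rw [h2]
    linarith

lemma tail_atTop {z : ℂ × ℂ} {M : ℕ} (hz : S.H^[M] z ∈ S.V) :
    Tendsto (fun n => ‖S.o z (n + 1)‖) atTop atTop := by
  rw [← tendsto_add_atTop_iff_nat M]
  refine tendsto_atTop_mono (fun j => ?_) (tendsto_pow_atTop_atTop_of_one_lt (one_lt_two : (1 : ℝ) < 2))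
  have := S.tail_growth hz j
  have hR := S.hR
  have h2 : (0 : ℝ) < 2 ^ j := by positivity
  rw [show j + M + 1 = M + j + 1 by ring]
  nlinarith

end HS

namespace HS

variable (S : HS)

/-- size function `C / |y|^{3/2}` -/
def eps (y : ℂ) : ℝ := S.C / (‖y‖ * √‖y‖)

lemma eps_nonneg (y : ℂ) : 0 ≤ S.eps y := by
  have := S.hC
  unfold eps; positivity

lemma eps_anti {y y' : ℂ} (hy : 0 < ‖y‖) (h : ‖y‖ ≤ ‖y'‖) : S.eps y' ≤ S.eps y := by
  have := S.hC
  unfold eps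
  gcongr

lemma eps_small {z : ℂ × ℂ} (hz : z ∈ S.V) : S.eps z.2 ≤ 1 / 10 := by
  have h1 := hz.1
  have h2 := S.hRC
  have h3 := S.hC
  have h4 := S.hR
  have h5 : 1 ≤ √‖z.2‖ := Real.one_le_sqrt.mpr (by linarith)
  unfold eps
  rw [div_le_div_iff₀ (by nlinarith) (by norm_num)]
  nlinarith

lemma V_mono {z : ℂ × ℂ} {n m : ℕ} (h : n ≤ m) (hz : S.H^[n] z ∈ S.V) :
    ‖S.o z (n + 1)‖ ≤ ‖S.o z (m + 1)‖ := by
  induction m, h using Nat.le_induction with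
  | base => exact le_rfl
  | succ k hk ih =>
    have h2 := (S.W_step (S.V_sub_W (S.V_iter hk hz))).2.1
    rw [← Function.iterate_succ_apply' S.H, ← S.o_succ, ← S.o_succ] at h2
    have := norm_nonneg (S.o z (k+1))
    linarith

lemma rho_bound {z : ℂ × ℂ} {n : ℕ} (hz : S.H^[n] z ∈ S.V) :
    ‖S.o z (n + 2) / S.o z (n + 1) ^ S.d - 1‖ ≤ S.eps (S.o z (n + 1)) := by
  have h := S.E1 _ _ hz.1 hz.2
  rw [← S.o_succ] at h
  rw [S.o_rec]
  exact h

lemma LK {c : ℂ → ℂ × ℂ} {D : Set ℂ} (hD : IsOpen D) (hc : DifferentiableOn ℂ c D)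
    (hpos : ∀ t ∈ D, 0 < S.G (c t)) {t0 : ℂ} (ht0 : t0 ∈ D) :
    ∃ r > 0, ∃ M : ℕ, ∃ g : ℂ → ℂ, Metric.ball t0 r ⊆ D ∧
      DifferentiableOn ℂ g (Metric.ball t0 r) ∧ ∀ t ∈ Metric.ball t0 r,
        (g t).re = S.G (c t) ∧ S.H^[M] (c t) ∈ S.V ∧
        ∀ m ≥ M, ∃ E : ℂ, S.o (c t) (m + 1) = Complex.exp (S.d ^ m * g t + E) ∧
          ‖E‖ ≤ 3 / 2 * S.eps (S.o (c t) (m + 1)) := by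
  obtain ⟨M, hM⟩ := S.exists_V (hpos t0 ht0)
  have hcc : ContinuousAt c t0 := (hc.differentiableAt (hD.mem_nhds ht0)).continuousAt
  have hY0 : S.o (c t0) (M + 1) ≠ 0 := by
    have := S.W_pos (S.V_sub_W hM)
    rw [← S.o_succ] at this
    intro h; rw [h] at this; norm_num at this
  have e1 : ∀ᶠ t in 𝓝 t0, S.H^[M] (c t) ∈ S.V :=
    ((S.Hn_diff M).continuous.continuousAt.comp hcc).eventually (S.V_open.mem_nhds hM)
  have e2 : ∀ᶠ t in 𝓝 t0, S.o (c t) (M + 1) / S.o (c t0) (M + 1) ∈ Complex.slitPlane := by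
    have : ContinuousAt (fun t => S.o (c t) (M + 1) / S.o (c t0) (M + 1)) t0 :=
      ((S.o_diff (M + 1)).continuous.continuousAt.comp hcc).div_const _
    refine this.eventually (Complex.isOpen_slitPlane.mem_nhds ?_)
    simp only [div_self hY0]; exact Complex.one_mem_slitPlane
  obtain ⟨r, hr, hball⟩ := Metric.eventually_nhds_iff_ball.mp
    (e1.and (e2.and (hD.mem_nhds ht0)))
  set B := Metric.ball t0 r with hB
  have hBD : B ⊆ D := fun t ht => (hball t ht).2.2
  have hV : ∀ k ≥ M, ∀ t ∈ B, S.H^[k] (c t) ∈ S.V := fun k hk t ht => S.V_iter hk (hball t ht).1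
  have hYd : ∀ k, DifferentiableOn ℂ (fun t => S.o (c t) k) B := fun k =>
    (S.o_diff k).comp_differentiableOn (hc.mono hBD)
  have hYn : ∀ k ≥ M, ∀ t ∈ B, S.o (c t) (k + 1) ≠ 0 := by
    intro k hk t ht h
    have := S.W_pos (S.V_sub_W (hV k hk t ht))
    rw [← S.o_succ, h] at this; norm_num at this
  have hd := S.hd2
  have hd0 := S.hd0
  have hdc : (S.d : ℂ) ≠ 0 := by exact_mod_cast hd0.ne'
  let ρ : ℕ → ℂ → ℂ := fun j t => S.o (c t) (M + j + 2) / S.o (c t) (M + j + 1) ^ S.d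
  have hρ : ∀ j, ∀ t ∈ B, ‖ρ j t - 1‖ ≤ S.eps (S.o (c t) (M + j + 1)) := fun j t ht =>
    S.rho_bound (hV (M + j) (by omega) t ht)
  have heps : ∀ j, ∀ t ∈ B, S.eps (S.o (c t) (M + j + 1)) ≤ 1 / 10 := by
    intro j t ht
    rw [S.o_succ]; exact S.eps_small (hV (M + j) (by omega) t ht)
  have hρs : ∀ j, ∀ t ∈ B, ρ j t ∈ Complex.slitPlane := by
    intro j t ht
    have h1 := hρ j t ht
    have h2 := heps j t ht
    left
    have h3 := Complex.abs_re_le_norm (ρ j t - 1)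
    have h4 := (abs_le.mp (h3.trans (h1.trans h2))).1
    simp at h4
    linarith
  have hρd : ∀ j, DifferentiableOn ℂ (ρ j) B := by
    intro j
    exact (hYd _).div ((hYd _).pow _) fun t ht => pow_ne_zero _ (hYn _ (by omega) t ht)
  have hlog : ∀ j, ∀ t ∈ B, ‖Complex.log (ρ j t)‖ ≤ 3 / 2 * S.eps (S.o (c t) (M + j + 1)) := by
    intro j t ht
    have h1 := hρ j t ht
    have h2 := heps j t ht
    have := Complex.norm_log_one_add_half_le_self (z := ρ j t - 1) (by linarith)
    rw [add_sub_cancel] at this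
    linarith
  let Lg : ℕ → ℂ → ℂ := fun j => Nat.rec
    (fun t => Complex.log (S.o (c t) (M + 1) / S.o (c t0) (M + 1)) + Complex.log (S.o (c t0) (M + 1)))
    (fun j f t => S.d * f t + Complex.log (ρ j t)) j
  have hL0 : ∀ t, Lg 0 t = Complex.log (S.o (c t) (M + 1) / S.o (c t0) (M + 1)) +
    Complex.log (S.o (c t0) (M + 1)) := fun t => rfl
  have hL1 : ∀ j t, Lg (j + 1) t = S.d * Lg j t + Complex.log (ρ j t) := fun j t => rfl
  have hLd : ∀ j, DifferentiableOn ℂ (Lg j) B := by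
    intro j
    induction j with
    | zero =>
      refine DifferentiableOn.congr ?_ (fun t _ => hL0 t)
      refine (DifferentiableOn.clog ?_ fun t ht => (hball t ht).2.1).add_const _
      exact (hYd _).div_const _
    | succ j ih =>
      refine DifferentiableOn.congr ?_ (fun t _ => hL1 j t)
      exact (ih.const_mul _).add ((hρd j).clog (hρs j))
  have hLe : ∀ j, ∀ t ∈ B, Complex.exp (Lg j t) = S.o (c t) (M + j + 1) := by
    intro j t ht
    induction j with
    | zero =>
      rw [hL0, Complex.exp_add, Complex.exp_log, Complex.exp_log hY0, div_mul_cancel₀ _ hY0]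
      exact div_ne_zero (hYn M le_rfl t ht) hY0
    | succ j ih =>
      rw [hL1, Complex.exp_add, Complex.exp_nat_mul, ih,
        Complex.exp_log (Complex.slitPlane_ne_zero (hρs j t ht))]
      have := hYn (M + j) (by omega) t ht
      simp only [ρ]
      field_simp
      rfl
  let l : ℕ → ℂ → ℂ := fun j t => Lg j t / S.d ^ (M + j)
  have hstep : ∀ n i, ∀ t ∈ B, dist (l (n + i) t) (l (n + i + 1) t) ≤
      (3 / 2 * S.eps (S.o (c t) (M + n + 1)) / S.d ^ (M + n) / 2) * (1 / 2) ^ i := by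
    intro n i t ht
    have h1 : l (n + i + 1) t - l (n + i) t = Complex.log (ρ (n + i) t) / S.d ^ (M + n + i + 1) := by
      simp only [l, hL1]
      field_simp
      ring
    rw [dist_comm, dist_eq_norm, h1, norm_div, norm_pow, Complex.norm_natCast]
    have h2 := hlog (n + i) t ht
    have h3 : S.eps (S.o (c t) (M + (n + i) + 1)) ≤ S.eps (S.o (c t) (M + n + 1)) := by
      apply S.eps_anti
      · exact norm_pos_iff.mpr (hYn _ (by omega) t ht)
      · exact S.V_mono (by omega) (hV _ (by omega) t ht)
    have h4 := S.eps_nonneg (S.o (c t) (M + n + 1))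
    calc _ ≤ 3 / 2 * S.eps (S.o (c t) (M + n + 1)) / S.d ^ (M + n + i + 1) := by
          gcongr; linarith
      _ = 3 / 2 * S.eps (S.o (c t) (M + n + 1)) / S.d ^ (M + n) * (1 / S.d) * (1 / S.d) ^ i := by
          rw [one_div_pow]; field_simp; ring
      _ ≤ 3 / 2 * S.eps (S.o (c t) (M + n + 1)) / S.d ^ (M + n) * (1 / 2) * (1 / 2) ^ i := by
          gcongr
      _ = _ := by ring
  have hcau : ∀ t ∈ B, ∃ w, Tendsto (fun j => l j t) atTop (𝓝 w) := by
    intro t ht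
    apply cauchySeq_tendsto_of_complete
    refine cauchySeq_of_le_geometric (1 / 2)
      (3 / 2 * S.eps (S.o (c t) (M + 0 + 1)) / S.d ^ (M + 0) / 2) (by norm_num) fun i => ?_
    have := hstep 0 i t ht
    simp only [zero_add] at this
    exact this
  choose! g hg using hcau
  have hdist : ∀ n, ∀ t ∈ B, dist (l n t) (g t) ≤
      3 / 2 * S.eps (S.o (c t) (M + n + 1)) / S.d ^ (M + n) := by
    intro n t ht
    have h1 : Tendsto (fun i => l (n + i) t) atTop (𝓝 (g t)) := by
      have := (tendsto_add_atTop_iff_nat n).mpr (hg t ht)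
      simpa only [add_comm] using this
    have := dist_le_of_le_geometric_of_tendsto₀ (1 / 2) _ (by norm_num)
      (fun i => hstep n i t ht) h1
    refine this.trans (le_of_eq ?_)
    ring
  refine ⟨r, hr, M, g, hBD, ?_, fun t ht => ⟨?_, (hball t ht).1, ?_⟩⟩
  · have hunif : TendstoUniformlyOn l g atTop B := by
      rw [Metric.tendstoUniformlyOn_iff]
      intro e he
      have h1 : Tendsto (fun n : ℕ => (1 / 2 : ℝ) ^ n) atTop (𝓝 0) :=
        tendsto_pow_atTop_nhds_zero_of_lt_one (by norm_num) (by norm_num)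
      filter_upwards [h1.eventually_lt_const he] with n hn t ht
      rw [dist_comm]
      refine (hdist n t ht).trans_lt (lt_of_le_of_lt ?_ hn)
      have h2 := heps n t ht
      have h3 := S.eps_nonneg (S.o (c t) (M + n + 1))
      calc _ ≤ 1 / (S.d : ℝ) ^ (M + n) := by gcongr; linarith
        _ ≤ 1 / (S.d : ℝ) ^ n := by
            apply one_div_le_one_div_of_le (by positivity)
            apply pow_le_pow_right₀ (by linarith); omega
        _ ≤ 1 / 2 ^ n := by gcongr
        _ = _ := by rw [one_div_pow]
    refine hunif.tendstoLocallyUniformlyOn.differentiableOn (Eventually.of_forall fun n => ?_)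
      Metric.isOpen_ball
    exact (hLd n).div_const _
  · have h1 : Tendsto (fun j => (l j t).re) atTop (𝓝 (g t).re) :=
      (Complex.continuous_re.tendsto _).comp (hg t ht)
    have h2 := (tendsto_add_atTop_iff_nat M).mpr
      (S.G_W_lim M (S.V_sub_W (hball t ht).1))
    refine tendsto_nhds_unique h1 (h2.congr fun j => ?_)
    have h3 : ((S.d : ℂ) ^ (M + j)) = ((S.d ^ (M + j) : ℝ) : ℂ) := by push_cast; rfl
    simp only [l]
    rw [h3, Complex.div_ofReal_re, add_comm j M, ← hLe j t ht, Complex.norm_exp, Real.log_exp]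
  · intro m hm
    obtain ⟨n, rfl⟩ := Nat.exists_eq_add_of_le hm
    refine ⟨Lg n t - S.d ^ (M + n) * g t, ?_, ?_⟩
    · rw [add_sub_cancel, hLe n t ht]
    · have h1 := hdist n t ht
      have h2 : Lg n t - S.d ^ (M + n) * g t = S.d ^ (M + n) * (l n t - g t) := by
        simp only [l]; field_simp
      rw [h2, norm_mul, norm_pow, Complex.norm_natCast, ← dist_eq_norm]
      rw [le_div_iff₀ (by positivity)] at h1
      linarith

open InnerProductSpace in
lemma Lharm {c : ℂ → ℂ × ℂ} {D : Set ℂ} (hD : IsOpen D) (hc : DifferentiableOn ℂ c D)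
    (hpos : ∀ t ∈ D, 0 < S.G (c t)) : HarmonicOnNhd (fun t => S.G (c t)) D := by
  intro t0 ht0
  obtain ⟨r, hr, M, g, -, hg, h⟩ := S.LK hD hc hpos ht0
  have hmem := Metric.ball_mem_nhds t0 hr
  have h1 : HarmonicAt (fun z => (g z).re) t0 :=
    (hg.analyticAt hmem).harmonicAt_re
  refine (harmonicAt_congr_nhds ?_).mp h1
  filter_upwards [hmem] with t ht
  exact (h t ht).1

end HS

/-- Cauchy estimate on nested balls -/
lemma cauchy_nested {h : ℂ → ℂ} {x0 : ℂ} {r s B : ℝ} (hh : DifferentiableOn ℂ h (Metric.ball x0 r))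
    (hs : s < r) (hB : ∀ w ∈ Metric.ball x0 r, ‖h w‖ ≤ B) :
    ∀ w ∈ Metric.ball x0 s, ‖deriv h w‖ ≤ B / ((r - s) / 2) := by
  intro w hw
  rw [Metric.mem_ball] at hw
  have hsub : Metric.closedBall w ((r - s) / 2) ⊆ Metric.ball x0 r := by
    intro v hv
    rw [Metric.mem_closedBall] at hv
    rw [Metric.mem_ball]
    have := dist_triangle v w x0
    linarith
  apply Complex.norm_deriv_le_of_forall_mem_sphere_norm_le (by linarith)
  · refine DifferentiableOn.diffContOnCl ?_
    exact hh.mono ((closure_mono Metric.ball_subset_closedBall).trans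
      (by rw [Metric.isClosed_closedBall.closure_eq]; exact hsub))
  · intro v hv
    exact hB v (hsub (Metric.sphere_subset_closedBall hv))

open InnerProductSpace in
/-- bounded harmonic functions on discs -/
lemma harm_bdd {f : ℂ → ℝ} {x0 : ℂ} {r c : ℝ} (hf : HarmonicOnNhd f (Metric.ball x0 r))
    (h0 : ∀ w ∈ Metric.ball x0 r, 0 < f w ∧ f w < c) :
    ∃ g : ℂ → ℂ, DifferentiableOn ℂ g (Metric.ball x0 r) ∧
      (∀ w ∈ Metric.ball x0 r, (g w).re = f w) ∧
      ∀ s < r, ∀ w ∈ Metric.ball x0 s, ‖deriv g w‖ ≤ Real.exp c / ((r - s) / 2) := by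
  obtain ⟨g, hg, hre⟩ := hf.exists_analyticOnNhd_ball_re_eq
  refine ⟨g, hg.differentiableOn, hre, fun s hs w hw => ?_⟩
  have hw' : w ∈ Metric.ball x0 r := Metric.ball_subset_ball hs.le hw
  have h1 := cauchy_nested (h := fun w => Complex.exp (g w)) (B := Real.exp c)
    hg.differentiableOn.cexp hs (fun v hv => by
      rw [Complex.norm_exp, Real.exp_le_exp]
      exact (hre hv).le.trans (h0 v hv).2.le) w hw
  have h2 : deriv (fun w => Complex.exp (g w)) w = Complex.exp (g w) * deriv g w :=
    (hg w hw').differentiableAt.hasDerivAt.cexp.deriv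
  rw [h2, norm_mul, Complex.norm_exp] at h1
  have h3 : 1 ≤ Real.exp (g w).re := Real.one_le_exp ((h0 w hw').1.le.trans (hre hw').symm.le)
  nlinarith [norm_nonneg (deriv g w)]

open InnerProductSpace in
/-- almost affine behaviour of periodic bounded harmonic functions -/
lemma harm_periodic {r s c : ℝ} (hs : 0 < s) (hsr : s < r) : ∃ K > 0, ∃ t0 > 0,
    ∀ (f : ℂ → ℝ) (x0 : ℂ) (τ : ℝ), 0 < τ → τ < t0 → HarmonicOnNhd f (Metric.ball x0 r) →
    (∀ w ∈ Metric.ball x0 r, 0 < f w ∧ f w < c) →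
    (∀ w, f (w + τ * Complex.I) = f w) →
    ∃ α : ℝ, ∀ w ∈ Metric.ball x0 s, ∀ w' ∈ Metric.ball x0 s,
      |f w - f w' - α * (w.re - w'.re)| ≤ K * (τ + |w.im| + |w'.im|) := by
  set δ := (r - s) / 4 with hδ
  have hδ0 : 0 < δ := by rw [hδ]; linarith
  set B := Real.exp c / (δ / 2) with hB
  set B2 := B / (δ / 2) with hB2
  set B3 := B2 / (δ / 2) with hB3
  have hBp : 0 < B := by positivity
  have hB2p : 0 < B2 := by positivity
  have hB3p : 0 < B3 := by positivity
  refine ⟨B + B3 * s * (2 * s), by positivity, δ, hδ0, ?_⟩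
  intro f x0 τ hτ hτδ hf h0 hper
  obtain ⟨g, hg, hre, hgd⟩ := harm_bdd hf h0
  have b1 : ∀ w ∈ Metric.ball x0 (s + 3 * δ), ‖deriv g w‖ ≤ B := by
    intro w hw
    have := hgd (s + 3 * δ) (by linarith) w hw
    rwa [show r - (s + 3 * δ) = δ by rw [hδ]; ring] at this
  have hsub : ∀ {x y : ℝ}, x ≤ y → Metric.ball x0 x ⊆ Metric.ball x0 y :=
    fun h => Metric.ball_subset_ball h
  have d1 : DifferentiableOn ℂ (deriv g) (Metric.ball x0 r) := hg.deriv Metric.isOpen_ball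
  have d2 : DifferentiableOn ℂ (deriv (deriv g)) (Metric.ball x0 r) := d1.deriv Metric.isOpen_ball
  have b2 : ∀ w ∈ Metric.ball x0 (s + 2 * δ), ‖deriv (deriv g) w‖ ≤ B2 := by
    intro w hw
    have := cauchy_nested (d1.mono (hsub (by linarith))) (by linarith) b1 w hw
    rwa [show (s + 3 * δ) - (s + 2 * δ) = δ by ring] at this
  have b3 : ∀ w ∈ Metric.ball x0 (s + δ), ‖deriv (deriv (deriv g)) w‖ ≤ B3 := by
    intro w hw
    have := cauchy_nested (d2.mono (hsub (by linarith))) (by linarith) b2 w hw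
    rwa [show (s + 2 * δ) - (s + δ) = δ by ring] at this
  have dAt : ∀ {h : ℂ → ℂ}, DifferentiableOn ℂ h (Metric.ball x0 r) → ∀ w ∈ Metric.ball x0 r,
      DifferentiableAt ℂ h w := fun hh w hw => hh.differentiableAt (Metric.isOpen_ball.mem_nhds hw)
  have hτn : ‖(τ * Complex.I : ℂ)‖ = τ := by simp [abs_of_pos hτ]
  have hshift : ∀ w ∈ Metric.ball x0 s, w + τ * Complex.I ∈ Metric.ball x0 (s + δ) := by
    intro w hw
    rw [Metric.mem_ball, dist_eq_norm] at *
    have := norm_add_le (w - x0) (τ * Complex.I)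
    rw [hτn] at this
    rw [show w + τ * Complex.I - x0 = w - x0 + τ * Complex.I by ring]
    linarith
  -- periodicity of the derivative
  have hp : ∀ w ∈ Metric.ball x0 s, deriv g (w + τ * Complex.I) = deriv g w := by
    intro w hw
    have hcont : ∀ v ∈ Metric.ball x0 s, DifferentiableAt ℂ (fun v => g (v + τ * Complex.I)) v := by
      intro v hv
      have h1 := dAt hg _ (hsub (by linarith) (hshift v hv))
      have : DifferentiableAt ℂ (fun v : ℂ => v + τ * Complex.I) v := by fun_prop
      exact DifferentiableAt.comp v h1 this
    have hk : AnalyticOnNhd ℂ (fun v => g (v + τ * Complex.I) - g v) (Metric.ball x0 s) := by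
      apply DifferentiableOn.analyticOnNhd _ Metric.isOpen_ball
      intro v hv
      exact ((hcont v hv).sub (dAt hg v (hsub hsr.le hv))).differentiableWithinAt
    rcases hk.is_constant_or_isOpen (convex_ball x0 s).isPreconnected with ⟨e, he⟩ | ho
    · have h1 : deriv (fun v => g (v + τ * Complex.I) - g v) w = 0 := by
        have : (fun v => g (v + τ * Complex.I) - g v) =ᶠ[𝓝 w] fun _ => e := by
          filter_upwards [Metric.isOpen_ball.mem_nhds hw] with v hv using he v hv
        rw [this.deriv_eq]; simp
      have h2 : deriv (fun v => g (v + τ * Complex.I) - g v) w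
          = deriv (fun v => g (v + τ * Complex.I)) w - deriv g w :=
        deriv_sub (hcont w hw) (dAt hg w (hsub hsr.le hw))
      rw [h2, deriv_comp_add_const] at h1
      exact sub_eq_zero.mp h1
    · exfalso
      have hop := ho (Metric.ball x0 s) subset_rfl Metric.isOpen_ball
      have hmem : (fun v => g (v + τ * Complex.I) - g v) w ∈
          (fun v => g (v + τ * Complex.I) - g v) '' Metric.ball x0 s := ⟨w, hw, rfl⟩
      have hzero : ∀ q ∈ (fun v => g (v + τ * Complex.I) - g v) '' Metric.ball x0 s, q.re = 0 := by
        rintro _ ⟨v, hv, rfl⟩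
        simp only [Complex.sub_re]
        rw [hre _ (hsub (by linarith) (hshift v hv)), hre _ (hsub hsr.le hv), hper]; ring
      obtain ⟨e, he, hee⟩ := Metric.isOpen_iff.mp hop _ hmem
      have h1 := hzero _ hmem
      have h2 := hzero _ (hee (show (fun v => g (v + τ * Complex.I) - g v) w + ((e / 2 : ℝ) : ℂ) ∈ _ by
        rw [Metric.mem_ball, dist_eq_norm]
        simp [abs_of_pos he]
        linarith))
      rw [Complex.add_re, h1, Complex.ofReal_re] at h2
      linarith
  -- smallness of the second derivative
  have b4 : ∀ w ∈ Metric.ball x0 s, ‖deriv (deriv g) w‖ ≤ B3 * τ := by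
    intro w hw
    have hcv : Metric.closedBall w τ ⊆ Metric.ball x0 (s + δ) := by
      intro v hv
      rw [Metric.mem_closedBall] at hv
      rw [Metric.mem_ball] at *
      have := dist_triangle v w x0
      linarith
    have e1 : ∀ v ∈ Metric.closedBall w τ, ‖deriv (deriv g) v - deriv (deriv g) w‖ ≤ B3 * τ := by
      intro v hv
      have h := (convex_closedBall w τ).norm_image_sub_le_of_norm_deriv_le (f := deriv (deriv g))
        (fun u hu => dAt d2 u (hsub (by linarith) (hcv hu))) (fun u hu => b3 u (hcv hu))
        (Metric.mem_closedBall_self hτ.le) hv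
      rw [Metric.mem_closedBall, dist_eq_norm] at hv
      refine h.trans ?_
      gcongr
    have e2 := (convex_closedBall w τ).norm_image_sub_le_of_norm_deriv_le
      (f := fun v => deriv g v - deriv (deriv g) w * v) (C := B3 * τ)
      (fun u hu => (dAt d1 u (hsub (by linarith) (hcv hu))).sub
        ((differentiableAt_id).const_mul _))
      (fun u hu => by
        have : deriv (fun v => deriv g v - deriv (deriv g) w * v) u =
            deriv (deriv g) u - deriv (deriv g) w := by
          have h1 := (dAt d1 u (hsub (by linarith) (hcv hu))).hasDerivAt.sub
            ((hasDerivAt_id u).const_mul (deriv (deriv g) w))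
          have h2 := h1.deriv
          simp only [mul_one] at h2
          exact h2
        rw [this]; exact e1 u hu)
      (Metric.mem_closedBall_self hτ.le)
      (show w + τ * Complex.I ∈ Metric.closedBall w τ by
        rw [Metric.mem_closedBall, dist_eq_norm, add_sub_cancel_left, hτn])
    simp only [hp w hw] at e2
    rw [add_sub_cancel_left, hτn] at e2
    have e3 : deriv g w - deriv (deriv g) w * (w + τ * Complex.I) - (deriv g w - deriv (deriv g) w * w)
      = -(deriv (deriv g) w * (τ * Complex.I)) := by ring
    rw [e3, norm_neg, norm_mul, hτn] at e2
    exact le_of_mul_le_mul_right e2 hτ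
  have hx0 : x0 ∈ Metric.ball x0 s := Metric.mem_ball_self hs
  have b5 : ∀ w ∈ Metric.ball x0 s, ‖deriv g w - deriv g x0‖ ≤ B3 * τ * s := by
    intro w hw
    have h := (convex_ball x0 s).norm_image_sub_le_of_norm_deriv_le (f := deriv g)
        (fun u hu => dAt d1 u (hsub hsr.le hu)) b4 hx0 hw
    rw [Metric.mem_ball, dist_eq_norm] at hw
    refine h.trans ?_
    gcongr
  refine ⟨(deriv g x0).re, fun w hw w' hw' => ?_⟩
  have e2 := (convex_ball x0 s).norm_image_sub_le_of_norm_deriv_le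
      (f := fun v => g v - deriv g x0 * v) (C := B3 * τ * s)
      (fun u hu => (dAt hg u (hsub hsr.le hu)).sub
        ((differentiableAt_id).const_mul _))
      (fun u hu => by
        have : deriv (fun v => g v - deriv g x0 * v) u = deriv g u - deriv g x0 := by
          have h1 := (dAt hg u (hsub hsr.le hu)).hasDerivAt.sub
            ((hasDerivAt_id u).const_mul (deriv g x0))
          have h2 := h1.deriv
          simp only [mul_one] at h2
          exact h2
        rw [this]; exact b5 u hu) hw' hw
  have e3 : ‖w - w'‖ ≤ 2 * s := by
    rw [← dist_eq_norm]
    have := dist_triangle_right w w' x0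
    rw [Metric.mem_ball] at hw hw'
    linarith
  have e4 := (Complex.abs_re_le_norm _).trans e2
  have e5 : (g w - deriv g x0 * w - (g w' - deriv g x0 * w')).re =
      f w - f w' - (deriv g x0).re * (w.re - w'.re) + (deriv g x0).im * (w.im - w'.im) := by
    simp only [Complex.sub_re, Complex.mul_re, hre w (hsub hsr.le hw), hre w' (hsub hsr.le hw')]
    ring
  rw [e5] at e4
  have e6 : |(deriv g x0).im * (w.im - w'.im)| ≤ B * (|w.im| + |w'.im|) := by
    rw [abs_mul]
    gcongr
    · exact (Complex.abs_im_le_norm _).trans (b1 x0 (hsub (by linarith) hx0))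
    · exact abs_sub _ _
  have e7 : B3 * τ * s * ‖w - w'‖ ≤ B3 * s * (2 * s) * τ := by
    have : B3 * τ * s * ‖w - w'‖ ≤ B3 * τ * s * (2 * s) := by gcongr
    linarith
  have e8 : 0 ≤ B3 * s * (2 * s) * (|w.im| + |w'.im|) := by positivity
  have e9 : 0 < B * τ := by positivity
  have := abs_sub (f w - f w' - (deriv g x0).re * (w.re - w'.re) + (deriv g x0).im * (w.im - w'.im))
    ((deriv g x0).im * (w.im - w'.im))
  rw [add_sub_cancel_right] at this
  nlinarith

namespace HS

variable (S : HS)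

/-- the punctured short domain -/
def Om (c : ℝ) : Set (ℂ × ℂ) := {z | 0 < S.G z ∧ S.G z < c}

lemma dpow_atTop : Tendsto (fun n : ℕ => (S.d : ℝ) ^ n) atTop atTop :=
  tendsto_pow_atTop_atTop_of_one_lt (by linarith [S.hd2])

lemma const_div_dpow (K : ℝ) : Tendsto (fun n : ℕ => K / (S.d : ℝ) ^ n) atTop (𝓝 0) :=
  tendsto_const_nhds.div_atTop S.dpow_atTop

variable {F : ℂ × ℂ → ℂ × ℂ} {c : ℝ}

lemma ev_V {z : ℂ × ℂ} (hz : 0 < S.G z) : ∀ᶠ n in atTop, S.H^[n] z ∈ S.V := by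
  obtain ⟨M, hM⟩ := S.exists_V hz
  filter_upwards [eventually_ge_atTop M] with n hn using S.V_iter hn hM

lemma lim_log {z : ℂ × ℂ} (hz : 0 < S.G z) :
    Tendsto (fun n => Real.log ‖S.o z (n + 1)‖ / (S.d : ℝ) ^ n) atTop (𝓝 (S.G z)) := by
  obtain ⟨M, hM⟩ := S.exists_V hz
  exact S.G_W_lim M (S.V_sub_W hM)

lemma norm_y_atTop {z : ℂ × ℂ} (hz : 0 < S.G z) :
    Tendsto (fun n => ‖S.o z (n + 1)‖) atTop atTop := by
  obtain ⟨M, hM⟩ := S.exists_V hz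
  exact S.tail_atTop hM

/-- moving horizontally -/
lemma step1A (hF : DifferentiableOn ℂ F (S.Om c)) (hm : MapsTo F (S.Om c) (S.Om c))
    {z : ℂ × ℂ} (hz : z ∈ S.Om c) :
    Tendsto (fun n => S.G (F (S.Hi^[n] (0, S.o z (n + 1))))) atTop (𝓝 (S.G (F z))) := by
  have hy := S.norm_y_atTop hz.1
  have hlim : Tendsto (fun n => (Real.log ‖S.o z (n + 1)‖ + 1) / (S.d : ℝ) ^ n) atTop
      (𝓝 (S.G z)) := by
    have := (S.lim_log hz.1).add (S.const_div_dpow 1)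
    simpa only [add_zero, ← add_div] using this
  have hb : Tendsto (fun n => 8 * Real.exp c / √‖S.o z (n + 1)‖) atTop (𝓝 0) :=
    tendsto_const_nhds.div_atTop (Real.tendsto_sqrt_atTop.comp hy)
  rw [tendsto_iff_dist_tendsto_zero]
  refine squeeze_zero' (Eventually.of_forall fun n => dist_nonneg) ?_ hb
  filter_upwards [S.ev_V hz.1, hlim.eventually_lt_const hz.2] with n hV hlt
  set y := S.o z (n + 1) with hyy
  have hV' := hV
  rw [S.o_eq, ← hyy] at hV'
  obtain ⟨hV1, hV2⟩ := hV'
  simp only at hV1 hV2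
  set x := S.o z n with hxx
  have hR := S.hR
  have hy1 : 1000 < ‖y‖ := by linarith
  have hxs : ‖x‖ < ‖y‖ / 2 := by nlinarith [norm_nonneg x]
  have hcur : DifferentiableOn ℂ (fun x : ℂ => S.Hi^[n] (x, y)) (Metric.ball 0 ‖y‖) := by
    refine ((S.Hin_diff n).comp ?_).differentiableOn
    fun_prop
  have hmem : ∀ x ∈ Metric.ball (0 : ℂ) ‖y‖, S.Hi^[n] (x, y) ∈ S.Om c := by
    intro x hx
    rw [mem_ball_zero_iff] at hx
    have hW : (x, y) ∈ S.W := ⟨hV1, hx.le⟩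
    have h1 := S.G_W_pos hW
    have h2 := (abs_le.mp (S.G_W hW)).2
    have hd0 := S.hd0
    have h3 := S.G_Hin n (x, y)
    constructor
    · rw [h3]; positivity
    · rw [h3]
      refine lt_of_le_of_lt ?_ hlt
      simp only at h2
      gcongr; linarith
  have hFc : DifferentiableOn ℂ (fun x : ℂ => F (S.Hi^[n] (x, y))) (Metric.ball 0 ‖y‖) :=
    hF.comp hcur hmem
  have hh := S.Lharm Metric.isOpen_ball hFc (fun t ht => (hm (hmem t ht)).1)
  obtain ⟨g, hg, hre, hgd⟩ := harm_bdd hh (fun t ht => hm (hmem t ht))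
  have hsub : Metric.ball (0 : ℂ) (‖y‖ / 2) ⊆ Metric.ball 0 ‖y‖ :=
    Metric.ball_subset_ball (by linarith)
  have hx' : x ∈ Metric.ball (0 : ℂ) (‖y‖ / 2) := by rwa [mem_ball_zero_iff]
  have h0' : (0 : ℂ) ∈ Metric.ball (0 : ℂ) (‖y‖ / 2) := Metric.mem_ball_self (by linarith)
  have h1 := (convex_ball (0 : ℂ) (‖y‖ / 2)).norm_image_sub_le_of_norm_deriv_le (f := g)
    (fun u hu => hg.differentiableAt (Metric.isOpen_ball.mem_nhds (hsub hu)))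
    (hgd (‖y‖ / 2) (by linarith)) hx' h0'
  have h2 := (Complex.abs_re_le_norm _).trans h1
  rw [Complex.sub_re, hre 0 (hsub h0'), hre x (hsub hx')] at h2
  have h3 : S.Hi^[n] (x, y) = z := by
    rw [hxx, hyy, ← S.o_eq, S.Hin_Hn]
  rw [h3] at h2
  rw [Real.dist_eq]
  refine h2.trans ?_
  rw [zero_sub, norm_neg]
  have hs : √‖y‖ * √‖y‖ = ‖y‖ := Real.mul_self_sqrt (by linarith)
  have hs0 : 0 < √‖y‖ := Real.sqrt_pos.mpr (by linarith)
  have hxq : ‖x‖ ≤ 2 * √‖y‖ := by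
    by_contra hcon
    push Not at hcon
    nlinarith
  rw [le_div_iff₀ hs0]
  have : Real.exp c / ((‖y‖ - ‖y‖ / 2) / 2) = 4 * Real.exp c / ‖y‖ := by field_simp; norm_num
  rw [this]
  have h5 : 4 * Real.exp c / ‖y‖ * ‖x‖ * √‖y‖ ≤ 4 * Real.exp c / ‖y‖ * (2 * √‖y‖) * √‖y‖ := by
    gcongr
  refine h5.trans (le_of_eq ?_)
  have hyne : ‖y‖ ≠ 0 := by linarith
  calc _ = 8 * Real.exp c / ‖y‖ * (√‖y‖ * √‖y‖) := by ring
    _ = _ := by rw [hs]; field_simp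

lemma step1B {r : ℝ} (hr : r < c / 2) : ∀ᶠ n : ℕ in atTop,
    ∀ w ∈ Metric.ball ((c / 2 : ℝ) : ℂ) r,
      S.Hi^[n] (0, Complex.exp (S.d ^ n * w)) ∈ S.Om c := by
  have he : 0 < c / 2 - r := by linarith
  have h1 := S.dpow_atTop.atTop_mul_const he
  filter_upwards [h1.eventually_gt_atTop (Real.log S.R), h1.eventually_gt_atTop 1] with n hn1 hn2 w hw
  have hd0 := S.hd0
  have hdn : 0 < (S.d : ℝ) ^ n := by positivity
  have hR := S.hR
  rw [Metric.mem_ball, dist_eq_norm] at hw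
  have hw1 := (Complex.abs_re_le_norm _).trans_lt hw
  rw [Complex.sub_re, Complex.ofReal_re, abs_lt] at hw1
  have hnorm : ‖Complex.exp (S.d ^ n * w)‖ = Real.exp (S.d ^ n * w.re) := by
    rw [Complex.norm_exp]
    congr 1
    have : ((S.d : ℂ) ^ n) = ((S.d ^ n : ℝ) : ℂ) := by push_cast; rfl
    rw [this, Complex.re_ofReal_mul]
  have hlow : (S.d : ℝ) ^ n * (c / 2 - r) ≤ S.d ^ n * w.re := by gcongr; linarith
  have hhigh : (S.d : ℝ) ^ n * w.re ≤ S.d ^ n * c - S.d ^ n * (c / 2 - r) := by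
    rw [← mul_sub]; gcongr; linarith
  have hW : ((0 : ℂ), Complex.exp (S.d ^ n * w)) ∈ S.W := by
    refine ⟨?_, by simp⟩
    simp only [hnorm]
    rw [← Real.log_lt_iff_lt_exp (by linarith)]
    linarith
  have h2 := abs_le.mp (S.G_W hW)
  simp only [hnorm, Real.log_exp] at h2
  have h3 := S.G_Hin n ((0 : ℂ), Complex.exp (S.d ^ n * w))
  constructor
  · rw [h3]; exact div_pos (by linarith [h2.1]) hdn
  · rw [h3, div_lt_iff₀ hdn]; linarith [h2.2]

/-- logarithmic coordinate -/
def Wn (z : ℂ × ℂ) (n : ℕ) : ℂ := Complex.log (S.o z (n + 1)) / S.d ^ n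

lemma Wn_exp {z : ℂ × ℂ} {n : ℕ} (h : S.o z (n + 1) ≠ 0) :
    Complex.exp (S.d ^ n * S.Wn z n) = S.o z (n + 1) := by
  have hd0 := S.hd0
  have hdc : (S.d : ℂ) ≠ 0 := by exact_mod_cast hd0.ne'
  rw [Wn, mul_div_cancel₀ _ (pow_ne_zero _ hdc), Complex.exp_log h]

lemma Wn_eq (z : ℂ × ℂ) (n : ℕ) :
    S.Wn z n = Complex.log (S.o z (n + 1)) / ((S.d ^ n : ℝ) : ℂ) := by
  rw [Wn]; push_cast; rfl

lemma Wn_re (z : ℂ × ℂ) (n : ℕ) : (S.Wn z n).re = Real.log ‖S.o z (n + 1)‖ / (S.d : ℝ) ^ n := by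
  rw [Wn_eq, Complex.div_ofReal_re, Complex.log_re]

lemma Wn_re_lim {z : ℂ × ℂ} (hz : 0 < S.G z) :
    Tendsto (fun n => (S.Wn z n).re) atTop (𝓝 (S.G z)) := by
  simp only [Wn_re]; exact S.lim_log hz

lemma Wn_im_lim (z : ℂ × ℂ) : Tendsto (fun n => |(S.Wn z n).im|) atTop (𝓝 0) := by
  refine squeeze_zero (fun n => abs_nonneg _) (fun n => ?_) (S.const_div_dpow Real.pi)
  have hd0 := S.hd0
  rw [Wn_eq, Complex.div_ofReal_im, abs_div, abs_of_pos (by positivity : (0 : ℝ) < (S.d : ℝ) ^ n)]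
  gcongr
  rw [Complex.log_im]
  exact Complex.abs_arg_le_pi _

lemma Wn_lim {z : ℂ × ℂ} (hz : 0 < S.G z) :
    Tendsto (fun n => S.Wn z n) atTop (𝓝 ((S.G z : ℝ) : ℂ)) := by
  have h1 := (Complex.continuous_ofReal.tendsto _).comp (S.Wn_re_lim hz)
  have h2 : Tendsto (fun n => (S.Wn z n).im) atTop (𝓝 0) :=
    (tendsto_zero_iff_abs_tendsto_zero _).mpr (S.Wn_im_lim z)
  have h3 := (Complex.continuous_ofReal.tendsto _).comp h2
  have h4 := h1.add (h3.mul_const Complex.I)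
  simp only [Function.comp_def, Complex.re_add_im] at h4
  simpa using h4

lemma step1 (hF : DifferentiableOn ℂ F (S.Om c)) (hm : MapsTo F (S.Om c) (S.Om c))
    {z1 z2 z3 : ℂ × ℂ} (hz1 : z1 ∈ S.Om c) (hz2 : z2 ∈ S.Om c) (hz3 : z3 ∈ S.Om c) :
    (S.G (F z1) - S.G (F z2)) * (S.G z3 - S.G z2) =
      (S.G (F z3) - S.G (F z2)) * (S.G z1 - S.G z2) := by
  -- choice of radii
  have habs : ∀ z ∈ S.Om c, |S.G z - c / 2| < c / 2 := by
    intro z hz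
    rw [abs_lt]; constructor <;> linarith [hz.1, hz.2]
  obtain ⟨s, hs1, hs2⟩ := exists_between
    (max_lt (max_lt (habs z1 hz1) (habs z2 hz2)) (habs z3 hz3))
  have hs0 : 0 < s := lt_of_le_of_lt (abs_nonneg _) (lt_of_le_of_lt (le_max_right _ _) hs1)
  have hsz : ∀ z, z = z1 ∨ z = z2 ∨ z = z3 → |S.G z - c / 2| < s := by
    rintro z (rfl | rfl | rfl)
    · exact lt_of_le_of_lt ((le_max_left _ _).trans (le_max_left _ _)) hs1
    · exact lt_of_le_of_lt ((le_max_right _ _).trans (le_max_left _ _)) hs1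
    · exact lt_of_le_of_lt (le_max_right _ _) hs1
  obtain ⟨r, hr1, hr2⟩ := exists_between hs2
  obtain ⟨K, hK, t0, ht0, hper⟩ := harm_periodic (c := c) hs0 hr1
  have hwin : ∀ z, z = z1 ∨ z = z2 ∨ z = z3 → z ∈ S.Om c →
      ∀ᶠ n in atTop, S.Wn z n ∈ Metric.ball ((c / 2 : ℝ) : ℂ) s := by
    intro z hz hzO
    refine (S.Wn_lim hzO.1).eventually (Metric.isOpen_ball.mem_nhds ?_)
    rw [Metric.mem_ball, dist_eq_norm, ← Complex.ofReal_sub, Complex.norm_real]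
    exact hsz z hz
  let v : ℂ × ℂ → ℕ → ℝ := fun z n => S.G (F (S.Hi^[n] (0, S.o z (n + 1))))
  let η : ℕ → ℝ := fun n => K * (2 * Real.pi / S.d ^ n + |(S.Wn z1 n).im| + |(S.Wn z2 n).im| +
    |(S.Wn z3 n).im|) 
  have hη : Tendsto η atTop (𝓝 0) := by
    have := ((((S.const_div_dpow (2 * Real.pi)).add (S.Wn_im_lim z1)).add (S.Wn_im_lim z2)).add
      (S.Wn_im_lim z3)).const_mul K
    simpa using this
  have hd0 := S.hd0
  have hmain : ∀ᶠ n in atTop,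
      |(v z1 n - v z2 n) * ((S.Wn z3 n).re - (S.Wn z2 n).re) -
        (v z3 n - v z2 n) * ((S.Wn z1 n).re - (S.Wn z2 n).re)| ≤
      η n * |(S.Wn z3 n).re - (S.Wn z2 n).re| + η n * |(S.Wn z1 n).re - (S.Wn z2 n).re| := by
    filter_upwards [hwin z1 (Or.inl rfl) hz1, hwin z2 (Or.inr (Or.inl rfl)) hz2,
      hwin z3 (Or.inr (Or.inr rfl)) hz3, S.step1B hr2,
      (S.const_div_dpow (2 * Real.pi)).eventually_lt_const ht0,
      (S.norm_y_atTop hz1.1).eventually_gt_atTop 0, (S.norm_y_atTop hz2.1).eventually_gt_atTop 0,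
      (S.norm_y_atTop hz3.1).eventually_gt_atTop 0] with n w1 w2 w3 hO ht y1 y2 y3
    have hdn : 0 < (S.d : ℝ) ^ n := by positivity
    have hdc : (S.d : ℂ) ≠ 0 := by exact_mod_cast hd0.ne'
    have hcur : DifferentiableOn ℂ (fun w : ℂ => S.Hi^[n] (0, Complex.exp (S.d ^ n * w)))
        (Metric.ball ((c / 2 : ℝ) : ℂ) r) := by
      refine ((S.Hin_diff n).comp ?_).differentiableOn
      fun_prop
    have hFc : DifferentiableOn ℂ (fun w : ℂ => F (S.Hi^[n] (0, Complex.exp (S.d ^ n * w))))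
        (Metric.ball ((c / 2 : ℝ) : ℂ) r) := hF.comp hcur hO
    have hh := S.Lharm Metric.isOpen_ball hFc (fun t ht => (hm (hO t ht)).1)
    obtain ⟨α, hα⟩ := hper _ _ (2 * Real.pi / S.d ^ n) (by positivity) ht hh
      (fun t ht => hm (hO t ht)) (by
        intro w
        have : (S.d : ℂ) ^ n * (w + ((2 * Real.pi / S.d ^ n : ℝ) : ℂ) * Complex.I) =
          S.d ^ n * w + 2 * Real.pi * Complex.I := by
          push_cast
          field_simp
        simp only [this, Complex.exp_periodic (_)])
    have hv : ∀ z, 0 < ‖S.o z (n + 1)‖ →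
        S.G (F (S.Hi^[n] (0, Complex.exp (S.d ^ n * S.Wn z n)))) = v z n := by
      intro z hz
      rw [S.Wn_exp (norm_pos_iff.mp hz)]
    have a1 := hα _ w1 _ w2
    have a3 := hα _ w3 _ w2
    rw [hv _ y1, hv _ y2] at a1
    rw [hv _ y3, hv _ y2] at a3
    have b1 : |v z1 n - v z2 n - α * ((S.Wn z1 n).re - (S.Wn z2 n).re)| ≤ η n := by
      refine a1.trans ?_
      simp only [η]
      refine mul_le_mul_of_nonneg_left ?_ hK.le
      linarith [abs_nonneg (S.Wn z3 n).im]
    have b3 : |v z3 n - v z2 n - α * ((S.Wn z3 n).re - (S.Wn z2 n).re)| ≤ η n := by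
      refine a3.trans ?_
      simp only [η]
      refine mul_le_mul_of_nonneg_left ?_ hK.le
      linarith [abs_nonneg (S.Wn z1 n).im]
    have e : (v z1 n - v z2 n) * ((S.Wn z3 n).re - (S.Wn z2 n).re) -
        (v z3 n - v z2 n) * ((S.Wn z1 n).re - (S.Wn z2 n).re) =
        (v z1 n - v z2 n - α * ((S.Wn z1 n).re - (S.Wn z2 n).re)) *
          ((S.Wn z3 n).re - (S.Wn z2 n).re) -
        (v z3 n - v z2 n - α * ((S.Wn z3 n).re - (S.Wn z2 n).re)) *
          ((S.Wn z1 n).re - (S.Wn z2 n).re) := by ring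
    rw [e]
    refine (abs_sub _ _).trans ?_
    rw [abs_mul, abs_mul]
    gcongr
  have L1 := S.step1A hF hm hz1
  have L2 := S.step1A hF hm hz2
  have L3 := S.step1A hF hm hz3
  have R1 := S.Wn_re_lim hz1.1
  have R2 := S.Wn_re_lim hz2.1
  have R3 := S.Wn_re_lim hz3.1
  have lim1 := (((L1.sub L2).mul (R3.sub R2)).sub ((L3.sub L2).mul (R1.sub R2))).abs
  have lim2 := (hη.mul (R3.sub R2).abs).add (hη.mul (R1.sub R2).abs)
  have := le_of_tendsto_of_tendsto lim1 lim2 hmain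
  simp only [zero_mul, add_zero] at this
  exact sub_eq_zero.mp (abs_eq_zero.mp (le_antisymm this (abs_nonneg _)))

/-- `G` takes all values in `(0, ∞)`. -/
lemma G_surj {s : ℝ} (hs : 0 < s) : ∃ z, S.G z = s := by
  have hd0 := S.hd0
  have hR := S.hR
  have hR0 : 0 < S.R := by linarith
  -- a point with small value
  obtain ⟨n, hn⟩ := ((S.const_div_dpow (Real.log (S.R + 1) + 1)).eventually_lt_const hs).exists
  have hW1 : ((0 : ℂ), ((S.R + 1 : ℝ) : ℂ)) ∈ S.W := by
    refine ⟨?_, by simp⟩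
    simp only [Complex.norm_real, Real.norm_eq_abs]
    rw [abs_of_pos (by linarith)]; linarith
  have hv1 : S.G (S.Hi^[n] ((0 : ℂ), ((S.R + 1 : ℝ) : ℂ))) < s := by
    rw [G_Hin]
    refine lt_of_le_of_lt ?_ hn
    have h := (abs_le.mp (S.G_W hW1)).2
    simp only [Complex.norm_real, Real.norm_eq_abs] at h
    rw [abs_of_pos (by linarith : 0 < S.R + 1)] at h
    gcongr; linarith
  have hW2 : ((0 : ℂ), ((S.R + Real.exp (s + 1) : ℝ) : ℂ)) ∈ S.W := by
    have := Real.exp_pos (s + 1)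
    refine ⟨?_, by simp⟩
    simp only [Complex.norm_real, Real.norm_eq_abs]
    rw [abs_of_pos (by positivity)]; linarith
  have hv2 : s ≤ S.G ((0 : ℂ), ((S.R + Real.exp (s + 1) : ℝ) : ℂ)) := by
    have hp := Real.exp_pos (s + 1)
    have h := (abs_le.mp (S.G_W hW2)).1
    simp only [Complex.norm_real, Real.norm_eq_abs] at h
    rw [abs_of_pos (by positivity)] at h
    have : s + 1 ≤ Real.log (S.R + Real.exp (s + 1)) := by
      rw [Real.le_log_iff_exp_le (by positivity)]; linarith
    linarith
  have := isPreconnected_univ.intermediate_value (mem_univ (S.Hi^[n] ((0 : ℂ), ((S.R + 1 : ℝ) : ℂ))))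
    (mem_univ ((0 : ℂ), ((S.R + Real.exp (s + 1) : ℝ) : ℂ))) S.Gcont.continuousOn ⟨hv1.le, hv2⟩
  obtain ⟨z, -, hz⟩ := this
  exact ⟨z, hz⟩

lemma step1_dichotomy (hc : 0 < c) (hF : DifferentiableOn ℂ F (S.Om c))
    (hm : MapsTo F (S.Om c) (S.Om c)) (hsurj : SurjOn F (S.Om c) (S.Om c)) :
    (∀ z ∈ S.Om c, S.G (F z) = S.G z) ∨ (∀ z ∈ S.Om c, S.G (F z) = c - S.G z) := by
  obtain ⟨p, hp⟩ := S.G_surj (by linarith : 0 < c / 3)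
  obtain ⟨q, hq⟩ := S.G_surj (by linarith : 0 < c / 2)
  have hpO : p ∈ S.Om c := ⟨by rw [hp]; linarith, by rw [hp]; linarith⟩
  have hqO : q ∈ S.Om c := ⟨by rw [hq]; linarith, by rw [hq]; linarith⟩
  obtain ⟨α, β, hab⟩ : ∃ α β : ℝ, ∀ z ∈ S.Om c, S.G (F z) = α * S.G z + β := by
    refine ⟨(S.G (F q) - S.G (F p)) / (c / 6),
      S.G (F p) - (S.G (F q) - S.G (F p)) / (c / 6) * (c / 3), fun z hz => ?_⟩
    have := S.step1 hF hm hz hpO hqO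
    rw [hp, hq] at this
    have h6 : (S.G (F z) - S.G (F p)) = (S.G (F q) - S.G (F p)) / (c / 6) * (S.G z - c / 3) := by
      field_simp; linarith
    linarith
  -- values
  have hval : ∀ s, 0 < s → s < c → 0 < α * s + β ∧ α * s + β < c := by
    intro s h1 h2
    obtain ⟨z, hz⟩ := S.G_surj h1
    have hzO : z ∈ S.Om c := ⟨by rw [hz]; exact h1, by rw [hz]; exact h2⟩
    have := hm hzO
    rw [← hz, ← hab z hzO]
    exact this
  have hsur : ∀ s, 0 < s → s < c → ∃ t, 0 < t ∧ t < c ∧ α * t + β = s := by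
    intro s h1 h2
    obtain ⟨w, hw⟩ := S.G_surj h1
    obtain ⟨z, hz, hzw⟩ := hsurj (show w ∈ S.Om c from ⟨by rw [hw]; exact h1, by rw [hw]; exact h2⟩)
    exact ⟨S.G z, hz.1, hz.2, by rw [← hab z hz, hzw, hw]⟩
  -- boundary values
  have l0 : Tendsto (fun n : ℕ => c / (n + 2 : ℝ)) atTop (𝓝 0) := by
    refine tendsto_const_nhds.div_atTop ?_
    exact tendsto_atTop_add_const_right _ _ tendsto_natCast_atTop_atTop
  have hin : ∀ n : ℕ, 0 < c / (n + 2 : ℝ) ∧ c / (n + 2 : ℝ) < c := by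
    intro n
    have hn : (0 : ℝ) ≤ n := Nat.cast_nonneg n
    refine ⟨by positivity, ?_⟩
    rw [div_lt_iff₀ (by positivity)]
    nlinarith
  have B0 : 0 ≤ β ∧ β ≤ c := by
    have h := (l0.const_mul α).add_const β
    simp only [mul_zero, zero_add] at h
    exact ⟨ge_of_tendsto' h fun n => (hval _ (hin n).1 (hin n).2).1.le,
      le_of_tendsto' h fun n => (hval _ (hin n).1 (hin n).2).2.le⟩
  have B1 : 0 ≤ α * c + β ∧ α * c + β ≤ c := by
    have h := (((l0.const_sub c).const_mul α).add_const β)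
    simp only [sub_zero] at h
    exact ⟨ge_of_tendsto' h fun n => (hval (c - _) (by linarith [(hin n).2]) (by linarith [(hin n).1])).1.le,
      le_of_tendsto' h fun n => (hval (c - _) (by linarith [(hin n).2]) (by linarith [(hin n).1])).2.le⟩
  have B2 : min β (α * c + β) ≤ 0 := by
    refine ge_of_tendsto' l0 fun n => ?_
    obtain ⟨t, h1, h2, h3⟩ := hsur _ (hin n).1 (hin n).2
    rw [← h3, min_le_iff]
    by_cases hα : 0 ≤ α
    · left; nlinarith
    · right; push Not at hα; nlinarith
  have B3 : c ≤ max β (α * c + β) := by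
    have h := l0.const_sub c
    simp only [sub_zero] at h
    refine le_of_tendsto' h fun n => ?_
    obtain ⟨t, h1, h2, h3⟩ := hsur (c - c / (n + 2 : ℝ)) (by linarith [(hin n).2]) (by linarith [(hin n).1])
    rw [← h3, le_max_iff]
    by_cases hα : 0 ≤ α
    · right; nlinarith
    · left; push Not at hα; nlinarith
  rcases min_le_iff.mp B2 with hb | hb
  · have hβ : β = 0 := le_antisymm hb B0.1
    left
    have hα : α = 1 := by
      rcases le_max_iff.mp B3 with h | h
      · linarith
      · have : α * c = 1 * c := by linarith [B1.2]
        exact mul_right_cancel₀ hc.ne' this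
    intro z hz; rw [hab z hz, hα, hβ]; ring
  · right
    have hβ : β = c := by
      rcases le_max_iff.mp B3 with h | h
      · linarith [B0.2]
      · linarith
    have hα : α = -1 := by
      have : α * c = -1 * c := by linarith [B1.1]
      exact mul_right_cancel₀ hc.ne' this
    intro z hz; rw [hab z hz, hα, hβ]; ring

end HS

namespace HS

variable (S : HS)

/-- the contraction multiplier -/
def ka : ℂ := S.a / S.d

lemma hdc : (S.d : ℂ) ≠ 0 := by exact_mod_cast S.hd0.ne'

lemma ka_ne : S.ka ≠ 0 := div_ne_zero S.ha S.hdc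

lemma ka_pos : 0 < ‖S.ka‖ := norm_pos_iff.mpr S.ka_ne

lemma a_eq : S.a = S.d * S.ka := by
  have := S.hdc
  unfold ka; field_simp

lemma norm_a : ‖S.a‖ = S.d * ‖S.ka‖ := by
  rw [a_eq, norm_mul, Complex.norm_natCast]

/-- weighted difference of two orbits, with weights from a third one -/
def nu (z z1 z2 : ℂ × ℂ) (k : ℕ) : ℂ := (S.o z2 k - S.o z1 k) * S.o z (k + 1) / S.ka ^ k

lemma norm_nu (z z1 z2 : ℂ × ℂ) (k : ℕ) :
    ‖S.nu z z1 z2 k‖ = ‖S.o z2 k - S.o z1 k‖ * ‖S.o z (k + 1)‖ / ‖S.ka‖ ^ k := by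
  rw [nu, norm_div, norm_mul, norm_pow]

/-- weighted difference -/
def mu (z z' : ℂ × ℂ) (k : ℕ) : ℂ := S.nu z z z' k

lemma y_bounds {z : ℂ × ℂ} {k : ℕ} (hV : S.H^[k] z ∈ S.V) :
    1000 * S.C ≤ ‖S.o z (k + 1)‖ ∧ 1000 ≤ ‖S.o z (k + 1)‖ ∧
    99 / 100 * ‖S.o z (k + 1)‖ ^ S.d ≤ ‖S.o z (k + 2)‖ ∧
    ‖S.o z (k + 2) - S.o z (k + 1) ^ S.d‖ ≤ S.C / ‖S.o z (k + 1)‖ * ‖S.o z (k + 1)‖ ^ S.d := by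
  obtain ⟨-, -, h1, h2, -⟩ := S.W_step (S.V_sub_W hV)
  rw [← Function.iterate_succ_apply' S.H, ← S.o_succ, ← S.o_succ] at h1
  rw [← Function.iterate_succ_apply' S.H, ← S.o_succ, ← S.o_succ] at h2
  have h3 := hV.1
  rw [← S.o_succ] at h3
  have h4 := S.hR
  have h5 := S.hRC
  refine ⟨by linarith, by linarith, h2, ?_⟩
  have hy : S.o z (k + 1) ^ S.d ≠ 0 := by
    apply pow_ne_zero; rw [← norm_pos_iff]; linarith
  have : S.o z (k + 2) - S.o z (k + 1) ^ S.d =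
      (S.o z (k + 2) / S.o z (k + 1) ^ S.d - 1) * S.o z (k + 1) ^ S.d := by field_simp
  rw [this, norm_mul, norm_pow]
  gcongr

lemma step_nu {z z1 z2 : ℂ × ℂ} {k : ℕ} (hV : S.H^[k] z ∈ S.V)
    (h1 : ‖S.o z1 (k + 1) - S.o z (k + 1)‖ ≤ 1) (h2 : ‖S.o z2 (k + 1) - S.o z (k + 1)‖ ≤ 1) :
    ‖S.nu z z1 z2 k - S.nu z z1 z2 (k + 1)‖ ≤
      2 * (S.C / ‖S.o z (k + 1)‖) * ‖S.nu z z1 z2 (k + 1)‖ +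
        ‖S.o z2 (k + 2) - S.o z1 (k + 2)‖ * ‖S.o z (k + 1)‖ / (‖S.ka‖ ^ k * ‖S.a‖) := by
  obtain ⟨b1, b2, b3, b4⟩ := S.y_bounds hV
  have hR' : S.R < ‖S.o z (k + 1)‖ := by have := hV.1; rwa [← S.o_succ] at this
  have e2b := S.E2 _ _ _ hR' h1 h2
  have r1 := S.o_rec z1 k
  have r2 := S.o_rec z2 k
  rw [norm_nu, nu, nu]
  have hka := S.ka_ne
  have hd := S.hdc
  have hkp := S.ka_pos
  have ha := S.a_eq
  have hna := S.norm_a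
  have hdd := S.hd2
  have hC := S.hC
  obtain ⟨m, hm⟩ : ∃ m, S.d = m + 2 := Nat.exists_eq_add_of_le' S.hd
  set y := S.o z (k + 1)
  set Y := S.o z (k + 2)
  set D := S.p.eval (S.o z2 (k + 1)) - S.p.eval (S.o z1 (k + 1))
  set e0 := S.o z2 k - S.o z1 k with he0
  set e1 := S.o z2 (k + 1) - S.o z1 (k + 1) with he1
  set e2 := S.o z2 (k + 2) - S.o z1 (k + 2) with he2
  have hrec : e2 = D - S.a * e0 := by rw [he2, r1, r2, he0]; ring
  have hy0 : 0 < ‖y‖ := by linarith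
  have hid : e0 * y / S.ka ^ k - e1 * Y / S.ka ^ (k + 1) =
      (D - S.d * y ^ (S.d - 1) * e1) * y / (S.a * S.ka ^ k) + -(e1 * (Y - y ^ S.d) / S.ka ^ (k + 1)) +
      -(e2 * y / (S.a * S.ka ^ k)) := by
    rw [hrec, ha]
    have : y ^ S.d = y ^ (S.d - 1) * y := by rw [hm]; simp [pow_succ]
    rw [this, pow_succ]
    field_simp
    ring
  rw [hid]
  set X := ‖e1‖ * ‖Y‖ / ‖S.ka‖ ^ (k + 1) with hX
  have hX1 : ‖e1‖ * ‖y‖ ^ S.d / ‖S.ka‖ ^ (k + 1) ≤ 100 / 99 * X := by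
    rw [hX, ← mul_div_assoc]
    apply div_le_div_of_nonneg_right _ (by positivity)
    nlinarith [norm_nonneg e1]
  have hX0 : 0 ≤ X := by positivity
  have T1 : ‖(D - S.d * y ^ (S.d - 1) * e1) * y / (S.a * S.ka ^ k)‖ ≤
      S.C / ‖y‖ * (1 / 2 * (100 / 99 * X)) := by
    rw [norm_div, norm_mul, norm_mul, norm_pow, hna]
    calc _ ≤ S.C * ‖e1‖ * ‖y‖ ^ (S.d - 2) * ‖y‖ / (S.d * ‖S.ka‖ * ‖S.ka‖ ^ k) := by gcongr
      _ = S.C / ‖y‖ * (1 / S.d * (‖e1‖ * ‖y‖ ^ S.d / ‖S.ka‖ ^ (k + 1))) := by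
        have : ‖y‖ ^ S.d = ‖y‖ ^ (S.d - 2) * ‖y‖ * ‖y‖ := by rw [hm]; simp [pow_succ]
        rw [this, pow_succ]
        field_simp
      _ ≤ _ := by gcongr
  have T2 : ‖-(e1 * (Y - y ^ S.d) / S.ka ^ (k + 1))‖ ≤ S.C / ‖y‖ * (100 / 99 * X) := by
    rw [norm_neg, norm_div, norm_mul, norm_pow]
    calc _ ≤ ‖e1‖ * (S.C / ‖y‖ * ‖y‖ ^ S.d) / ‖S.ka‖ ^ (k + 1) := by gcongr
      _ = S.C / ‖y‖ * (‖e1‖ * ‖y‖ ^ S.d / ‖S.ka‖ ^ (k + 1)) := by ring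
      _ ≤ _ := by gcongr
  have T3 : ‖-(e2 * y / (S.a * S.ka ^ k))‖ = ‖e2‖ * ‖y‖ / (‖S.ka‖ ^ k * ‖S.a‖) := by
    rw [norm_neg, norm_div, norm_mul, norm_mul, norm_pow, mul_comm ‖S.a‖]
  refine (norm_add₃_le).trans ?_
  rw [T3]
  have hq : 0 ≤ S.C / ‖y‖ * X := by positivity
  nlinarith

/-- variant (i) -/
lemma step_nu_i {z z1 z2 : ℂ × ℂ} {k : ℕ} (hV : S.H^[k] z ∈ S.V)
    (h1 : ‖S.o z1 (k + 1) - S.o z (k + 1)‖ ≤ 1) (h2 : ‖S.o z2 (k + 1) - S.o z (k + 1)‖ ≤ 1)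
    (h3 : ‖S.o z2 (k + 2) - S.o z1 (k + 2)‖ ≤ ‖S.o z2 (k + 1) - S.o z1 (k + 1)‖) :
    ‖S.nu z z1 z2 k - S.nu z z1 z2 (k + 1)‖ ≤
      3 * (S.C / ‖S.o z (k + 1)‖) * ‖S.nu z z1 z2 (k + 1)‖ := by
  have h := S.step_nu hV h1 h2
  obtain ⟨b1, b2, b3, b4⟩ := S.y_bounds hV
  have hR' : S.R < ‖S.o z (k + 1)‖ := by have := hV.1; rwa [← S.o_succ] at this
  have hpow := S.pow_ge _ hR'
  have hkp := S.ka_pos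
  have hdd := S.hd2
  have hC := S.hC
  suffices hs : ‖S.o z2 (k + 2) - S.o z1 (k + 2)‖ * ‖S.o z (k + 1)‖ / (‖S.ka‖ ^ k * ‖S.a‖) ≤
    S.C / ‖S.o z (k + 1)‖ * ‖S.nu z z1 z2 (k + 1)‖ by linarith
  rw [norm_nu, norm_a]
  rw [show k + 1 + 1 = k + 2 from rfl]
  set y := ‖S.o z (k + 1)‖
  set Y := ‖S.o z (k + 2)‖
  set e1 := ‖S.o z2 (k + 1) - S.o z1 (k + 1)‖ with he1
  have he0 : 0 ≤ e1 := norm_nonneg _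
  have hy0 : 0 < y := by linarith
  calc _ ≤ e1 * y / (‖S.ka‖ ^ k * (S.d * ‖S.ka‖)) := by gcongr
    _ = (1 / S.d) * (e1 * (y ^ 2 / y) / ‖S.ka‖ ^ (k + 1)) := by
      field_simp; ring
    _ ≤ (1 / 2) * (e1 * ((100 / 99 * Y) / y) / ‖S.ka‖ ^ (k + 1)) := by
      gcongr; linarith
    _ = 50 / 99 / y * (e1 * Y / ‖S.ka‖ ^ (k + 1)) := by ring
    _ ≤ _ := by gcongr; linarith

/-- variant (ii) -/
lemma step_nu_ii {z z1 z2 : ℂ × ℂ} {k : ℕ} (hV : S.H^[k] z ∈ S.V)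
    (h1 : ‖S.o z1 (k + 1) - S.o z (k + 1)‖ ≤ 1) (h2 : ‖S.o z2 (k + 1) - S.o z (k + 1)‖ ≤ 1) :
    ‖S.nu z z1 z2 k - S.nu z z1 z2 (k + 1)‖ ≤
      (S.C / ‖S.o z (k + 1)‖) * (2 * ‖S.nu z z1 z2 (k + 1)‖ + ‖S.nu z z1 z2 (k + 2)‖) := by
  have h := S.step_nu hV h1 h2
  obtain ⟨b1, b2, b3, b4⟩ := S.y_bounds hV
  have hV' : S.H^[k + 1] z ∈ S.V := S.V_iter (by omega) hV
  obtain ⟨-, b2', b3', -⟩ := S.y_bounds hV'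
  have hR' : S.R < ‖S.o z (k + 1)‖ := by have := hV.1; rwa [← S.o_succ] at this
  have hR'' : S.R < ‖S.o z (k + 1 + 1)‖ := by have := hV'.1; rwa [← S.o_succ] at this
  have hpow := S.pow_ge _ hR'
  have hpow' := S.pow_ge _ hR''
  have hkp := S.ka_pos
  have hdd := S.hd2
  have hC := S.hC
  have haC := S.haC
  suffices hs : ‖S.o z2 (k + 2) - S.o z1 (k + 2)‖ * ‖S.o z (k + 1)‖ / (‖S.ka‖ ^ k * ‖S.a‖) ≤
    S.C / ‖S.o z (k + 1)‖ * ‖S.nu z z1 z2 (k + 2)‖ by linarith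
  rw [norm_nu]
  rw [norm_a] at haC ⊢
  rw [show k + 1 + 1 = k + 2 from rfl] at *
  rw [show k + 1 + 2 = k + 3 from rfl] at *
  rw [show k + 2 + 1 = k + 3 from rfl] at *
  set y := ‖S.o z (k + 1)‖
  set Y := ‖S.o z (k + 2)‖
  set Y2 := ‖S.o z (k + 3)‖
  set e2 := ‖S.o z2 (k + 2) - S.o z1 (k + 2)‖ with he1
  have he0 : 0 ≤ e2 := norm_nonneg _
  have hy0 : 0 < y := by linarith
  have hY : y ≤ Y := by nlinarith
  have hY2 : y ^ 2 ≤ Y2 := by nlinarith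
  have hka : ‖S.ka‖ ≤ S.C := by nlinarith
  calc _ = (1 / S.d) * (e2 * (y ^ 2 / y) * ‖S.ka‖ / ‖S.ka‖ ^ (k + 2)) := by
        rw [pow_add]; field_simp
    _ ≤ 1 * (e2 * (Y2 / y) * S.C / ‖S.ka‖ ^ (k + 2)) := by
      gcongr
      rw [div_le_one (by linarith)]; linarith
    _ = _ := by ring

end HS

namespace HS

variable (S : HS)

lemma theta_le {z : ℂ × ℂ} {K : ℕ} (hV : S.H^[K] z ∈ S.V) (j : ℕ) :
    S.C / ‖S.o z (K + j + 1)‖ ≤ (1 / 2) ^ j / 1000 := by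
  have h := S.tail_growth hV j
  have h1 := S.hRC
  have h2 := S.hC
  have h3 : (0 : ℝ) < 2 ^ j := by positivity
  have h4 : 2 ^ j * (1000 * S.C) ≤ ‖S.o z (K + j + 1)‖ := by nlinarith
  rw [div_le_iff₀ (by nlinarith), one_div_pow]
  calc S.C = 1 / 2 ^ j / 1000 * (2 ^ j * (1000 * S.C)) := by field_simp
    _ ≤ _ := by gcongr

lemma decr {z z' : ℂ × ℂ} {k0 : ℕ} (hV : S.H^[k0] z ∈ S.V)
    (h1 : ∀ j > k0, ‖S.o z' j - S.o z j‖ ≤ 1) (j : ℕ) (hj : k0 ≤ j) :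
    ‖S.o z' (j + 1) - S.o z (j + 1)‖ ≤ ‖S.o z' j - S.o z j‖ := by
  by_contra hcon
  push Not at hcon
  -- doubling step
  have dbl : ∀ i ≥ k0, ‖S.o z' i - S.o z i‖ < ‖S.o z' (i + 1) - S.o z (i + 1)‖ →
      2 * ‖S.o z' (i + 1) - S.o z (i + 1)‖ ≤ ‖S.o z' (i + 2) - S.o z (i + 2)‖ := by
    intro i hi hlt
    have hVi := S.V_iter hi hV
    obtain ⟨b1, b2, -, -⟩ := S.y_bounds hVi
    have hR' : S.R < ‖S.o z (i + 1)‖ := by have := hVi.1; rwa [← S.o_succ] at this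
    have e2 := S.E2 (S.o z (i + 1)) (S.o z (i + 1)) (S.o z' (i + 1)) hR' (by simp) (h1 _ (by omega))
    have r1 := S.o_rec z i
    have r2 := S.o_rec z' i
    obtain ⟨m, hm⟩ : ∃ m, S.d = m + 2 := Nat.exists_eq_add_of_le' S.hd
    have hd2 := S.hd2
    have haC := S.haC
    have hC := S.hC
    set y := S.o z (i + 1)
    set e0 := S.o z' i - S.o z i with he0
    set e1 := S.o z' (i + 1) - y with he1
    set e2' := S.o z' (i + 2) - S.o z (i + 2) with he2
    set D := S.p.eval (S.o z' (i + 1)) - S.p.eval y with hD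
    have hid : S.d * y ^ (S.d - 1) * e1 = e2' + S.a * e0 - (D - S.d * y ^ (S.d - 1) * e1) := by
      rw [he2, r1, r2, he0, hD]; ring
    have hn : S.d * ‖y‖ ^ (S.d - 1) * ‖e1‖ ≤ ‖e2'‖ + ‖S.a‖ * ‖e0‖ + S.C * ‖e1‖ * ‖y‖ ^ (S.d - 2) := by
      calc S.d * ‖y‖ ^ (S.d - 1) * ‖e1‖ = ‖S.d * y ^ (S.d - 1) * e1‖ := by
            rw [norm_mul, norm_mul, norm_pow, Complex.norm_natCast]
        _ ≤ ‖e2' + S.a * e0‖ + ‖D - S.d * y ^ (S.d - 1) * e1‖ := by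
            rw [hid]; exact norm_sub_le _ _ |>.trans (by rw [← hid])
        _ ≤ ‖e2'‖ + ‖S.a * e0‖ + ‖D - S.d * y ^ (S.d - 1) * e1‖ := by
            gcongr; exact norm_add_le _ _
        _ ≤ _ := by rw [norm_mul]; gcongr
    have hpw : ‖y‖ ^ (S.d - 1) = ‖y‖ ^ (S.d - 2) * ‖y‖ := by rw [hm]; simp [pow_succ]
    rw [hpw] at hn
    set Q := ‖y‖ ^ (S.d - 2) with hQ
    have hQ1 : 1 ≤ Q := one_le_pow₀ (by linarith)
    have he1p : 0 < ‖e1‖ := lt_of_le_of_lt (norm_nonneg _) hlt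
    have c1 : ‖S.a‖ * ‖e0‖ ≤ S.C * ‖e1‖ := by gcongr
    have c2 : 2 * (Q * ‖y‖) * ‖e1‖ ≤ S.d * (Q * ‖y‖) * ‖e1‖ := by gcongr
    have c3 : Q * (1000 * S.C) * ‖e1‖ ≤ Q * ‖y‖ * ‖e1‖ := by gcongr
    have c4 : S.C * ‖e1‖ ≤ Q * (S.C * ‖e1‖) := le_mul_of_one_le_left (by positivity) hQ1
    have c5 : ‖e1‖ ≤ S.C * ‖e1‖ := le_mul_of_one_le_left (by positivity) hC
    have c6 : Q * (1000 * S.C) * ‖e1‖ = 1000 * (Q * (S.C * ‖e1‖)) := by ring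
    have c7 : S.C * ‖e1‖ * Q = Q * (S.C * ‖e1‖) := by ring
    nlinarith
  have grow : ∀ i, ‖S.o z' (j + i) - S.o z (j + i)‖ < ‖S.o z' (j + i + 1) - S.o z (j + i + 1)‖ ∧
      2 ^ i * ‖S.o z' (j + 1) - S.o z (j + 1)‖ ≤ ‖S.o z' (j + i + 1) - S.o z (j + i + 1)‖ := by
    intro i
    induction i with
    | zero => exact ⟨hcon, by simp⟩
    | succ i ih =>
      have := dbl (j + i) (by omega) ih.1
      rw [show j + (i + 1) = j + i + 1 by ring, show j + i + 1 + 1 = j + i + 2 by ring]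
      have h0 := (norm_nonneg _).trans_lt ih.1
      refine ⟨by linarith, ?_⟩
      rw [pow_succ]; linarith [ih.2]
  have hpos : 0 < ‖S.o z' (j + 1) - S.o z (j + 1)‖ := (norm_nonneg _).trans_lt hcon
  obtain ⟨i, hi⟩ := pow_unbounded_of_one_lt (1 / ‖S.o z' (j + 1) - S.o z (j + 1)‖) (one_lt_two)
  have h3 := (grow i).2
  have h4 := h1 (j + i + 1) (by omega)
  rw [div_lt_iff₀ hpos] at hi
  linarith

lemma lemB {z z' : ℂ × ℂ} {k0 : ℕ} (hV : S.H^[k0] z ∈ S.V)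
    (h1 : ∀ j > k0, ‖S.o z' j - S.o z j‖ ≤ 1) :
    ∃ w, Tendsto (S.mu z z') atTop (𝓝 w) ∧
      ∀ j, ‖w - S.mu z z' (k0 + j)‖ ≤ 1 / 2 * (1 / 2) ^ j * ‖S.mu z z' k0‖ := by
  have hst : ∀ j, ‖S.mu z z' (k0 + j) - S.mu z z' (k0 + (j + 1))‖ ≤
      3 * ((1 / 2) ^ j / 1000) * ‖S.mu z z' (k0 + (j + 1))‖ := by
    intro j
    have := S.step_nu_i (z := z) (z1 := z) (z2 := z') (k := k0 + j) (S.V_iter (by omega) hV)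
      (by simp) (h1 _ (by omega)) (S.decr hV h1 (k0 + j + 1) (by omega))
    refine this.trans ?_
    have := S.theta_le hV j
    unfold mu
    gcongr
    exact le_rfl
  set N := ‖S.mu z z' k0‖ with hN
  have hN0 : 0 ≤ N := norm_nonneg _
  have hp : ∀ j : ℕ, (0 : ℝ) < (1 / 2) ^ j ∧ (1 / 2 : ℝ) ^ j ≤ 1 := fun j =>
    ⟨by positivity, pow_le_one₀ (by norm_num) (by norm_num)⟩
  have hst2 : ∀ j, ‖S.mu z z' (k0 + j) - S.mu z z' (k0 + (j + 1))‖ ≤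
      (1 / 2) ^ j / 100 * ‖S.mu z z' (k0 + j)‖ := by
    intro j
    have h := hst j
    obtain ⟨h2, h3⟩ := hp j
    have h4 := norm_sub_norm_le (S.mu z z' (k0 + (j + 1))) (S.mu z z' (k0 + j))
    rw [norm_sub_rev] at h4
    have h5 := norm_nonneg (S.mu z z' (k0 + (j + 1)))
    have h6 := norm_nonneg (S.mu z z' (k0 + j))
    have h7 : ‖S.mu z z' (k0 + (j + 1))‖ ≤ 2 * ‖S.mu z z' (k0 + j)‖ := by nlinarith
    nlinarith
  have hbd : ∀ j, ‖S.mu z z' (k0 + j)‖ ≤ (2 - (1 / 2) ^ j) * N := by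
    intro j
    induction j with
    | zero => simp only [add_zero, pow_zero]; rw [← hN]; linarith
    | succ j ih =>
      have h := hst2 j
      obtain ⟨h2, h3⟩ := hp j
      have h4 := norm_sub_norm_le (S.mu z z' (k0 + (j + 1))) (S.mu z z' (k0 + j))
      rw [norm_sub_rev] at h4
      have h6 := norm_nonneg (S.mu z z' (k0 + j))
      have h7 : ‖S.mu z z' (k0 + j)‖ ≤ 2 * N := by nlinarith
      have h8 : (1 / 2) ^ j / 100 * ‖S.mu z z' (k0 + j)‖ ≤ (1 / 2) ^ j / 100 * (2 * N) := by gcongr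
      rw [pow_succ]
      nlinarith [mul_nonneg h2.le hN0]
  have hgeo : ∀ j, dist (S.mu z z' (k0 + j)) (S.mu z z' (k0 + (j + 1))) ≤ N / 4 * (1 / 2) ^ j := by
    intro j
    rw [dist_eq_norm]
    obtain ⟨h2, h3⟩ := hp j
    have h7 : ‖S.mu z z' (k0 + j)‖ ≤ 2 * N := by nlinarith [hbd j]
    have h8 : (1 / 2) ^ j / 100 * ‖S.mu z z' (k0 + j)‖ ≤ (1 / 2) ^ j / 100 * (2 * N) := by gcongr
    have := hst2 j
    nlinarith [mul_nonneg h2.le hN0]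
  obtain ⟨w, hw⟩ := cauchySeq_tendsto_of_complete
    (cauchySeq_of_le_geometric (1 / 2) (N / 4) (by norm_num) hgeo)
  refine ⟨w, ?_, fun j => ?_⟩
  · rw [← tendsto_add_atTop_iff_nat k0]
    simpa only [add_comm] using hw
  · have := dist_le_of_le_geometric_of_tendsto (1 / 2) (N / 4) (by norm_num) hgeo hw j
    rw [dist_comm, dist_eq_norm] at this
    refine this.trans (le_of_eq ?_)
    ring

/-- the stable relation -/
def St (z z' : ℂ × ℂ) : Prop := Tendsto (fun k => S.o z' k - S.o z k) atTop (𝓝 0)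

lemma St.symm {z z' : ℂ × ℂ} (h : S.St z z') : S.St z' z := by
  have := h.neg
  simpa [St] using this

lemma St.trans {z z' z'' : ℂ × ℂ} (h : S.St z z') (h' : S.St z' z'') : S.St z z'' := by
  have := Tendsto.add h h'
  simpa [St] using this

lemma St.refl (z : ℂ × ℂ) : S.St z z := by simp [St]

variable {S}

lemma St.ev_le {z z' : ℂ × ℂ} (h : S.St z z') :
    ∀ᶠ k0 : ℕ in atTop, ∀ j > k0, ‖S.o z' j - S.o z j‖ ≤ 1 := by
  have h1 : Tendsto (fun k => ‖S.o z' k - S.o z k‖) atTop (𝓝 0) := by simpa using h.norm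
  obtain ⟨N, hN⟩ := eventually_atTop.mp (h1.eventually_le_const one_pos)
  filter_upwards [eventually_ge_atTop N] with k hk j hj using hN j (by omega)

lemma St.ratio {z z' : ℂ × ℂ} (hz : 0 < S.G z) (h : S.St z z') :
    Tendsto (fun k => S.o z' (k + 1) / S.o z (k + 1)) atTop (𝓝 1) := by
  have h1 : Tendsto (fun k => (S.o z' (k + 1) - S.o z (k + 1)) / S.o z (k + 1)) atTop (𝓝 0) := by
    rw [tendsto_zero_iff_norm_tendsto_zero]
    simp only [norm_div]
    have h2 : Tendsto (fun k => ‖S.o z' (k + 1) - S.o z (k + 1)‖) atTop (𝓝 0) := by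
      simpa using (h.comp (tendsto_add_atTop_nat 1)).norm
    exact h2.div_atTop (S.norm_y_atTop hz)
  have h3 := h1.add_const 1
  rw [zero_add] at h3
  refine h3.congr' ?_
  filter_upwards [(S.norm_y_atTop hz).eventually_gt_atTop 0] with k hk
  have := norm_pos_iff.mp hk
  field_simp
  ring

lemma St.ev_V' {z z' : ℂ × ℂ} (hz : 0 < S.G z) (h : S.St z z') :
    ∃ k, S.H^[k] z' ∈ S.V := by
  obtain ⟨k, h1, h2, h3, h4⟩ := ((h.ev_le).and ((S.ev_V hz).and
    (((S.norm_y_atTop hz).eventually_gt_atTop (S.R + 1)).and (tendsto_add_atTop_nat 1 |>.eventually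
      ((S.norm_y_atTop hz).eventually_gt_atTop (S.R + 1)))))).exists
  refine ⟨k + 1 + 1, ?_⟩
  rw [Function.iterate_succ_apply']
  refine (S.W_step ⟨?_, ?_⟩).1
  · rw [← S.o_succ]
    have := h1 (k + 1 + 1) (by omega)
    have h5 := norm_sub_norm_le (S.o z (k + 1 + 1)) (S.o z' (k + 1 + 1))
    rw [norm_sub_rev] at h5
    linarith
  · rw [← S.o_succ]
    change ‖S.o z' (k + 1)‖ ≤ _
    have e1 := h1 (k + 1 + 1) (by omega)
    have e2 := h1 (k + 1) (by omega)
    have h5 := norm_sub_norm_le (S.o z (k + 1 + 1)) (S.o z' (k + 1 + 1))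
    rw [norm_sub_rev] at h5
    have h6 := norm_sub_norm_le (S.o z' (k + 1)) (S.o z (k + 1))
    have h7 := (S.W_step (S.V_sub_W h2)).2.1
    rw [← Function.iterate_succ_apply' S.H, ← S.o_succ, ← S.o_succ] at h7
    have := S.hR
    have h8 : 2 * ‖S.o z (k + 1)‖ ≤ ‖S.o z (k + 1 + 1)‖ := h7
    linarith

lemma St.G_eq {z z' : ℂ × ℂ} (hz : 0 < S.G z) (h : S.St z z') : S.G z' = S.G z := by
  obtain ⟨k, hk⟩ := h.ev_V' hz
  have hz' := S.G_V_pos hk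
  have h1 := S.lim_log hz
  have h2 := S.lim_log hz'
  have h3 : Tendsto (fun k => Real.log ‖S.o z' (k + 1) / S.o z (k + 1)‖) atTop (𝓝 (Real.log 1)) := by
    have := (h.ratio hz).norm
    rw [norm_one] at this
    exact this.log one_ne_zero
  have h4 := h3.div_atTop S.dpow_atTop
  have h5 := h1.add h4
  rw [add_zero] at h5
  refine tendsto_nhds_unique h2 (h5.congr' ?_)
  filter_upwards [(S.norm_y_atTop hz).eventually_gt_atTop 0,
    (S.norm_y_atTop hz').eventually_gt_atTop 0] with k h6 h7
  rw [norm_div, Real.log_div h7.ne' h6.ne']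
  ring

lemma St.G_pos {z z' : ℂ × ℂ} (hz : 0 < S.G z) (h : S.St z z') : 0 < S.G z' := by
  rw [h.G_eq hz]; exact hz

lemma St.ex_lim {z z' : ℂ × ℂ} (hz : 0 < S.G z) (h : S.St z z') :
    ∃ w, Tendsto (S.mu z z') atTop (𝓝 w) := by
  obtain ⟨k, h1, h2⟩ := (h.ev_le.and (S.ev_V hz)).exists
  obtain ⟨w, hw, -⟩ := S.lemB h2 h1
  exact ⟨w, hw⟩

lemma mu_zero_eq {z z' : ℂ × ℂ} (hz : 0 < S.G z) (h : S.St z z')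
    (h0 : Tendsto (S.mu z z') atTop (𝓝 0)) : z = z' := by
  have key : ∀ᶠ k in atTop, S.o z k = S.o z' k := by
    filter_upwards [h.ev_le, S.ev_V hz] with k h1 h2
    obtain ⟨w, hw, hw'⟩ := S.lemB h2 h1
    have hw0 : w = 0 := tendsto_nhds_unique hw h0
    have := hw' 0
    rw [hw0] at this
    simp only [add_zero, zero_sub, norm_neg, pow_zero, mul_one] at this
    have h3 : ‖S.mu z z' k‖ = 0 := by linarith [norm_nonneg (S.mu z z' k)]
    rw [norm_eq_zero] at h3
    have hy := (S.y_bounds h2).2.1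
    have hy0 : S.o z (k + 1) ≠ 0 := by rw [← norm_pos_iff]; linarith
    simp only [mu, nu, div_eq_zero_iff, mul_eq_zero, hy0, or_false, pow_eq_zero_iff', S.ka_ne,
      false_and] at h3
    exact (sub_eq_zero.mp h3).symm
  obtain ⟨k, h1, h2⟩ := (key.and (tendsto_add_atTop_nat 1 |>.eventually key)).exists
  exact S.ext_o k h1 h2

lemma mu_add {z z' z'' : ℂ × ℂ} (hz : 0 < S.G z) (h : S.St z z') {w1 w2 : ℂ}
    (h1 : Tendsto (S.mu z z') atTop (𝓝 w1)) (h2 : Tendsto (S.mu z' z'') atTop (𝓝 w2)) :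
    Tendsto (S.mu z z'') atTop (𝓝 (w1 + w2)) := by
  have h3 := (h.symm.ratio (h.G_pos hz))
  have h4 := h1.add (h2.mul h3)
  rw [mul_one] at h4
  refine h4.congr' ?_
  filter_upwards [(S.norm_y_atTop (h.G_pos hz)).eventually_gt_atTop 0] with k hk
  have := norm_pos_iff.mp hk
  have hka := S.ka_ne
  simp only [mu, nu]
  field_simp
  ring

lemma mu_self (z : ℂ × ℂ) : Tendsto (S.mu z z) atTop (𝓝 0) := by
  have : S.mu z z = fun _ => 0 := by ext k; simp [mu, nu]
  rw [this]; exact tendsto_const_nhds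

/-- the limit -/
def w (S : HS) (z z' : ℂ × ℂ) : ℂ := limUnder atTop (S.mu z z')

lemma w_lim {z z' : ℂ × ℂ} (hz : 0 < S.G z) (h : S.St z z') :
    Tendsto (S.mu z z') atTop (𝓝 (S.w z z')) := tendsto_nhds_limUnder (h.ex_lim hz)

lemma w_eq {z z' : ℂ × ℂ} {w : ℂ} (h : Tendsto (S.mu z z') atTop (𝓝 w)) : S.w z z' = w :=
  h.limUnder_eq

lemma w_add {z z' z'' : ℂ × ℂ} (hz : 0 < S.G z) (h : S.St z z') (h' : S.St z' z'') :
    S.w z z'' = S.w z z' + S.w z' z'' :=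
  w_eq (mu_add hz h (w_lim hz h) (w_lim (h.G_pos hz) h'))

lemma w_inj {z z' z'' : ℂ × ℂ} (hz : 0 < S.G z) (h : S.St z z') (h' : S.St z z'')
    (he : S.w z z' = S.w z z'') : z' = z'' := by
  have h1 : S.St z' z'' := St.trans S (St.symm S h) h'
  have h2 := w_add hz h h1
  rw [he] at h2
  have h3 : S.w z' z'' = 0 := by
    have := h2.symm; rwa [add_eq_left] at this
  have h4 := w_lim (h.G_pos hz) h1
  rw [h3] at h4
  exact mu_zero_eq (h.G_pos hz) h1 h4

end HS

lemma backward_bound (N : ℕ → ℝ) (T : ℝ) (hT : 0 ≤ T) (m : ℕ) (h0 : N m ≤ T)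
    (h1 : N (m + 1) ≤ T)
    (hst : ∀ j < m, N (j + 1) ≤ 2 * T →
      N j ≤ N (j + 1) + (1 / 2) ^ j / 1000 * (2 * N (j + 1) + N (j + 2))) :
    ∀ j ≤ m + 1, N j ≤ 2 * T := by
  have hp : ∀ j : ℕ, (0 : ℝ) < (1 / 2) ^ j ∧ (1 / 2 : ℝ) ^ j ≤ 1 := fun j =>
    ⟨by positivity, pow_le_one₀ (by norm_num) (by norm_num)⟩
  have key : ∀ i j, j + i = m → N j ≤ T * (1 + (1 / 2) ^ j) ∧
      N (j + 1) ≤ T * (1 + (1 / 2) ^ (j + 1)) := by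
    intro i
    induction i with
    | zero =>
      intro j hj
      simp only [add_zero] at hj
      subst hj
      have a1 := mul_nonneg hT (hp j).1.le
      have a2 := mul_nonneg hT (hp (j + 1)).1.le
      constructor <;> linarith
    | succ i ih =>
      intro j hj
      obtain ⟨b1, b2⟩ := ih (j + 1) (by omega)
      refine ⟨?_, b1⟩
      have a1 := mul_nonneg hT (hp j).1.le
      have c1 : T * (1 + (1 / 2) ^ (j + 1)) ≤ 2 * T := by nlinarith [(hp (j + 1)).2]
      have c2 : T * (1 + (1 / 2) ^ (j + 1 + 1)) ≤ 2 * T := by nlinarith [(hp (j + 1 + 1)).2]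
      have h := hst j (by omega) (b1.trans c1)
      have c3 : (1 / 2) ^ j / 1000 * (2 * N (j + 1) + N (j + 2)) ≤
          (1 / 2) ^ j / 1000 * (2 * (2 * T) + 2 * T) := by
        have := (hp j).1
        have b2' : N (j + 2) ≤ 2 * T := b2.trans c2
        have b1' := b1.trans c1
        gcongr
      rw [pow_succ] at b1
      nlinarith
  intro j hj
  have hle : T * (1 + (1 / 2) ^ j) ≤ 2 * T := by nlinarith [(hp j).2]
  rcases Nat.lt_or_ge j (m + 1) with h | h
  · exact (key (m - j) j (by omega)).1.trans hle
  · have : j = m + 1 := by omega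
    subst this; linarith

lemma geo_limit (f : ℕ → ℂ → ℂ) (D : Set ℂ) (hD : IsOpen D) (hf : ∀ i, DifferentiableOn ℂ (f i) D)
    (A : ℝ) (h : ∀ i, ∀ t ∈ D, ‖f i t - f (i + 1) t‖ ≤ A * (1 / 2) ^ i) :
    ∃ g : ℂ → ℂ, DifferentiableOn ℂ g D ∧ ∀ t ∈ D, Tendsto (fun i => f i t) atTop (𝓝 (g t)) ∧
      ‖f 0 t - g t‖ ≤ 2 * A := by
  have hlim : ∀ t ∈ D, ∃ l, Tendsto (fun i => f i t) atTop (𝓝 l) := fun t ht =>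
    cauchySeq_tendsto_of_complete (cauchySeq_of_le_geometric (1 / 2) A (by norm_num)
      (fun i => by rw [dist_eq_norm]; exact h i t ht))
  choose! g hg using hlim
  have hb : ∀ t ∈ D, ∀ i, ‖f i t - g t‖ ≤ 2 * A * (1 / 2) ^ i := by
    intro t ht i
    have := dist_le_of_le_geometric_of_tendsto (1 / 2) A (by norm_num)
      (fun i => by rw [dist_eq_norm]; exact h i t ht) (hg t ht) i
    rw [dist_eq_norm] at this
    refine this.trans (le_of_eq ?_)
    ring
  refine ⟨g, ?_, fun t ht => ⟨hg t ht, by simpa using hb t ht 0⟩⟩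
  have hu : TendstoUniformlyOn f g atTop D := by
    rw [Metric.tendstoUniformlyOn_iff]
    intro ε hε
    have h0 : Tendsto (fun i : ℕ => 2 * A * (1 / 2 : ℝ) ^ i) atTop (𝓝 0) := by
      simpa using (tendsto_pow_atTop_nhds_zero_of_lt_one (r := (1 / 2 : ℝ)) (by norm_num)
        (by norm_num)).const_mul (2 * A)
    filter_upwards [h0.eventually_lt_const hε] with i hi t ht
    rw [dist_comm, dist_eq_norm]
    exact (hb t ht i).trans_lt hi
  exact hu.tendstoLocallyUniformlyOn.differentiableOn (Eventually.of_forall hf) hD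

namespace HS

variable (S : HS)

/-- weights -/
def wt (q : ℂ × ℂ) (k : ℕ) : ℝ := ‖S.ka‖ ^ k / ‖S.o q (k + 1)‖

lemma wt_nonneg (q : ℂ × ℂ) (k : ℕ) : 0 ≤ S.wt q k := by unfold wt; positivity

lemma wt_half {q : ℂ × ℂ} {k : ℕ} (hV : S.H^[k] q ∈ S.V) : S.wt q (k + 1) ≤ S.wt q k / 2 := by
  obtain ⟨b1, b2, b3, -⟩ := S.y_bounds hV
  have hR' : S.R < ‖S.o q (k + 1)‖ := by have := hV.1; rwa [← S.o_succ] at this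
  have hpow := S.pow_ge _ hR'
  have hka : ‖S.ka‖ ≤ S.C := by
    have h1 := S.norm_a
    have := S.hd2
    have := S.haC
    nlinarith [S.ka_pos]
  have hkp := S.ka_pos
  unfold wt
  have e1 : S.o q (k + 1 + 1) = S.o q (k + 2) := rfl
  rw [e1, pow_succ]
  set y := ‖S.o q (k + 1)‖
  have h2 : 2 * ‖S.ka‖ * y ≤ ‖S.o q (k + 2)‖ := by nlinarith [S.hC]
  rw [div_div, div_le_div_iff₀ (by nlinarith [S.ka_pos]) (by linarith)]
  have := pow_pos hkp k
  nlinarith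

lemma wt_tendsto {q : ℂ × ℂ} (hq : 0 < S.G q) : Tendsto (S.wt q) atTop (𝓝 0) := by
  obtain ⟨K, hK⟩ := (S.ev_V hq).exists
  have h : ∀ j, S.wt q (K + j) ≤ (1 / 2) ^ j * S.wt q K := by
    intro j
    induction j with
    | zero => simp
    | succ j ih =>
      have := S.wt_half (S.V_iter (show K ≤ K + j by omega) hK)
      rw [← add_assoc, pow_succ]
      linarith
  rw [← tendsto_add_atTop_iff_nat K]
  simp only [add_comm _ K]
  refine squeeze_zero (fun j => S.wt_nonneg _ _) h ?_
  simpa using (tendsto_pow_atTop_nhds_zero_of_lt_one (r := (1 / 2 : ℝ)) (by norm_num)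
        (by norm_num)).mul_const (S.wt q K)

lemma diff_eq_mu (q z : ℂ × ℂ) (k : ℕ) (h : S.o q (k + 1) ≠ 0) :
    S.o z k - S.o q k = S.mu q z k * (S.ka ^ k / S.o q (k + 1)) := by
  have := S.ka_ne
  simp only [mu, nu]; field_simp

lemma norm_diff_eq_mu (q z : ℂ × ℂ) (k : ℕ) (h : S.o q (k + 1) ≠ 0) :
    ‖S.o z k - S.o q k‖ = ‖S.mu q z k‖ * S.wt q k := by
  rw [S.diff_eq_mu q z k h, norm_mul, norm_div, norm_pow, wt]

lemma o_ne {q : ℂ × ℂ} {k : ℕ} (hV : S.H^[k] q ∈ S.V) : S.o q (k + 1) ≠ 0 := by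
  rw [← norm_pos_iff]; linarith [(S.y_bounds hV).2.1]

lemma nu_eq_sub (q z1 z2 : ℂ × ℂ) (k : ℕ) : S.nu q z1 z2 k = S.mu q z2 k - S.mu q z1 k := by
  simp only [mu, nu]; ring

lemma St_of_mu {q z : ℂ × ℂ} (hq : 0 < S.G q) {t : ℂ} (h : Tendsto (S.mu q z) atTop (𝓝 t)) :
    S.St q z := by
  have h1 := h.norm.mul (S.wt_tendsto hq)
  rw [mul_zero] at h1
  rw [St, tendsto_zero_iff_norm_tendsto_zero]
  refine h1.congr' ?_
  filter_upwards [S.ev_V hq] with k hk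
  rw [S.norm_diff_eq_mu q z k (S.o_ne hk)]

/-- approximations of the leaf parametrization -/
def psn (q : ℂ × ℂ) (n : ℕ) (t : ℂ) : ℂ × ℂ :=
  S.Hi^[n] (S.o q n + t * (S.ka ^ n / S.o q (n + 1)),
    S.o q (n + 1) + t * (S.ka ^ (n + 1) / S.o q (n + 2)))

lemma psn_diff (q : ℂ × ℂ) (n : ℕ) : Differentiable ℂ (S.psn q n) := by
  unfold psn
  refine (S.Hin_diff n).comp (Differentiable.prodMk ?_ ?_)
  · exact (differentiable_id.mul_const _).const_add _
  · exact (differentiable_id.mul_const _).const_add _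

lemma o_psn (q : ℂ × ℂ) (n : ℕ) (t : ℂ) :
    S.o (S.psn q n t) n = S.o q n + t * (S.ka ^ n / S.o q (n + 1)) := by
  rw [o, psn, Hn_Hin]

lemma o_psn' (q : ℂ × ℂ) (n : ℕ) (t : ℂ) :
    S.o (S.psn q n t) (n + 1) = S.o q (n + 1) + t * (S.ka ^ (n + 1) / S.o q (n + 2)) := by
  rw [o_succ, psn, Hn_Hin]

lemma mu_psn {q : ℂ × ℂ} {n : ℕ} (hV : S.H^[n] q ∈ S.V) (t : ℂ) :
    S.mu q (S.psn q n t) n = t := by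
  have h := S.o_ne hV
  have := S.ka_ne
  simp only [mu, nu, o_psn]; field_simp; ring

lemma mu_psn' {q : ℂ × ℂ} {n : ℕ} (hV : S.H^[n] q ∈ S.V) (t : ℂ) :
    S.mu q (S.psn q n t) (n + 1) = t := by
  have h := S.o_ne (S.V_iter (show n ≤ n + 1 by omega) hV)
  have := S.ka_ne
  simp only [mu, nu, o_psn']
  rw [show n + 1 + 1 = n + 2 from rfl] at *
  field_simp; ring

lemma psn_bd {q : ℂ × ℂ} {K : ℕ} (hV : S.H^[K] q ∈ S.V) {T : ℝ} (hT : 0 ≤ T)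
    (hw : ∀ k ≥ K, 2 * T * S.wt q k ≤ 1) (m : ℕ) {t : ℂ} (ht : ‖t‖ ≤ T) (j : ℕ) (hj : j ≤ m + 1) :
    ‖S.mu q (S.psn q (K + m) t) (K + j)‖ ≤ 2 * T := by
  refine backward_bound (fun j => ‖S.mu q (S.psn q (K + m) t) (K + j)‖) T hT m ?_ ?_ ?_ j hj
  · simpa only [S.mu_psn (S.V_iter (show K ≤ K + m by omega) hV)] using ht
  · simpa only [← add_assoc, S.mu_psn' (S.V_iter (show K ≤ K + m by omega) hV)] using ht
  · intro j hj hle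
    have hVj := S.V_iter (show K ≤ K + j by omega) hV
    have hVj' := S.V_iter (show K ≤ K + j + 1 by omega) hV
    have h2 : ‖S.o (S.psn q (K + m) t) (K + j + 1) - S.o q (K + j + 1)‖ ≤ 1 := by
      rw [S.norm_diff_eq_mu _ _ _ (S.o_ne hVj')]
      have h3 := hw (K + j + 1) (by omega)
      have := S.wt_nonneg q (K + j + 1)
      refine le_trans ?_ h3
      exact mul_le_mul_of_nonneg_right hle this
    have h := S.step_nu_ii (z1 := q) hVj (by simp) h2
    have h4 := S.theta_le hV j
    have h5 := norm_sub_norm_le (S.nu q q (S.psn q (K + m) t) (K + j))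
      (S.nu q q (S.psn q (K + m) t) (K + j + 1))
    have h6 : S.C / ‖S.o q (K + j + 1)‖ * (2 * ‖S.nu q q (S.psn q (K + m) t) (K + j + 1)‖ +
        ‖S.nu q q (S.psn q (K + m) t) (K + j + 2)‖) ≤ (1 / 2) ^ j / 1000 *
        (2 * ‖S.nu q q (S.psn q (K + m) t) (K + j + 1)‖ +
        ‖S.nu q q (S.psn q (K + m) t) (K + j + 2)‖) := by gcongr
    simp only [mu, ← add_assoc]
    linarith

lemma psn_le_one {q : ℂ × ℂ} {K : ℕ} (hV : S.H^[K] q ∈ S.V) {T : ℝ} (hT : 0 ≤ T)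
    (hw : ∀ k ≥ K, 2 * T * S.wt q k ≤ 1) (m : ℕ) {t : ℂ} (ht : ‖t‖ ≤ T) (j : ℕ) (hj : j ≤ m + 1) :
    ‖S.o (S.psn q (K + m) t) (K + j) - S.o q (K + j)‖ ≤ 1 := by
  have h := S.psn_bd hV hT hw m ht j hj
  have hVj := S.V_iter (show K ≤ K + j by omega) hV
  rw [S.norm_diff_eq_mu _ _ _ (S.o_ne hVj)]
  exact (mul_le_mul_of_nonneg_right h (S.wt_nonneg _ _)).trans (hw _ (by omega))

lemma psn_cauchy {q : ℂ × ℂ} {K : ℕ} (hV : S.H^[K] q ∈ S.V) {T : ℝ} (hT : 0 ≤ T)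
    (hw : ∀ k ≥ K, 2 * T * S.wt q k ≤ 1) (m : ℕ) {t : ℂ} (ht : ‖t‖ ≤ T) (j : ℕ) (hj : j ≤ m + 1) :
    ‖S.nu q (S.psn q (K + m) t) (S.psn q (K + (m + 1)) t) (K + j)‖ ≤
      2 * (3 * T * ((1 / 2) ^ m / 1000)) := by
  have hVm := S.V_iter (show K ≤ K + m by omega) hV
  have hVm' := S.V_iter (show K ≤ K + (m + 1) by omega) hV
  refine backward_bound (fun j => ‖S.nu q (S.psn q (K + m) t) (S.psn q (K + (m + 1)) t) (K + j)‖)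
    (3 * T * ((1 / 2) ^ m / 1000)) (by positivity) m ?_ ?_ ?_ j hj
  · simp only [nu_eq_sub, S.mu_psn hVm]
    have e1 := S.mu_psn hVm' t
    have e2 := S.mu_psn' hVm' t
    have h := S.step_nu_ii (z1 := q) hVm (by simp)
      (S.psn_le_one hV hT hw (m + 1) ht (m + 1) (by omega))
    change ‖S.mu q _ _ - S.mu q _ (K + (m + 1))‖ ≤ _ * (2 * ‖S.mu q _ (K + (m + 1))‖ +
      ‖S.mu q _ (K + (m + 1) + 1)‖) at h
    rw [e1, e2] at h
    refine h.trans ?_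
    have h4 := S.theta_le hV m
    calc _ ≤ (1 / 2) ^ m / 1000 * (2 * T + T) := by gcongr
      _ = _ := by ring
  · simp only [nu_eq_sub]
    rw [S.mu_psn hVm', show K + (m + 1) = K + m + 1 from rfl, S.mu_psn' hVm]
    simp; positivity
  · intro j hj hle
    have hVj := S.V_iter (show K ≤ K + j by omega) hV
    have h := S.step_nu_ii hVj (S.psn_le_one hV hT hw m ht (j + 1) (by omega))
      (S.psn_le_one hV hT hw (m + 1) ht (j + 1) (by omega))
    have h4 := S.theta_le hV j
    set ν := S.nu q (S.psn q (K + m) t) (S.psn q (K + (m + 1)) t)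
    have h5 := norm_sub_norm_le (ν (K + j)) (ν (K + j + 1))
    have h6 : S.C / ‖S.o q (K + j + 1)‖ * (2 * ‖ν (K + j + 1)‖ +
        ‖ν (K + j + 2)‖) ≤ (1 / 2) ^ j / 1000 *
        (2 * ‖ν (K + j + 1)‖ + ‖ν (K + j + 2)‖) := by gcongr
    simp only [← add_assoc]
    linarith

lemma mu_diff (q : ℂ × ℂ) (k : ℕ) : Differentiable ℂ (fun z => S.mu q z k) := by
  simp only [mu, nu, div_eq_mul_inv]
  exact (((S.o_diff k).sub_const _).mul_const _).mul_const _

lemma psi_loc {q : ℂ × ℂ} (hq : 0 < S.G q) {T : ℝ} (hT : 0 < T) :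
    ∃ P : ℂ → ℂ × ℂ, DifferentiableOn ℂ P (Metric.ball 0 T) ∧ ∀ t ∈ Metric.ball (0 : ℂ) T,
      Tendsto (fun n => S.psn q n t) atTop (𝓝 (P t)) ∧ Tendsto (S.mu q (P t)) atTop (𝓝 t) := by
  obtain ⟨K, hV, hw⟩ : ∃ K, S.H^[K] q ∈ S.V ∧ ∀ k ≥ K, 2 * T * S.wt q k ≤ 1 := by
    have h1 := (S.wt_tendsto hq).const_mul (2 * T)
    rw [mul_zero] at h1
    obtain ⟨K1, hK1⟩ := eventually_atTop.mp (h1.eventually_le_const one_pos)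
    obtain ⟨K2, hK2⟩ := eventually_atTop.mp (S.ev_V hq)
    exact ⟨max K1 K2, hK2 _ (le_max_right _ _), fun k hk => hK1 k ((le_max_left _ _).trans hk)⟩
  have hM : ∀ j, ∃ g : ℂ → ℂ, DifferentiableOn ℂ g (Metric.ball 0 T) ∧
      ∀ t ∈ Metric.ball (0 : ℂ) T,
        Tendsto (fun i => S.mu q (S.psn q (K + (j + i)) t) (K + j)) atTop (𝓝 (g t)) ∧
        ‖t - g t‖ ≤ 2 * (6 * T / 1000 * (1 / 2) ^ j) := by
    intro j
    obtain ⟨g, h1, h2⟩ := geo_limit (fun i t => S.mu q (S.psn q (K + (j + i)) t) (K + j))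
      (Metric.ball 0 T) Metric.isOpen_ball
      (fun i => ((S.mu_diff q _).comp (S.psn_diff q _)).differentiableOn)
      (6 * T / 1000 * (1 / 2) ^ j) (fun i t ht => by
        have ht' : ‖t‖ ≤ T := (mem_ball_zero_iff.mp ht).le
        have := S.psn_cauchy hV hT.le hw (j + i) ht' j (by omega)
        rw [nu_eq_sub, norm_sub_rev] at this
        refine this.trans (le_of_eq ?_)
        rw [pow_add]; ring)
    refine ⟨g, h1, fun t ht => ⟨(h2 t ht).1, ?_⟩⟩
    have := (h2 t ht).2
    simpa only [add_zero, S.mu_psn (S.V_iter (show K ≤ K + j by omega) hV)] using this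
  choose M hMd hMl using hM
  have hlim : ∀ j, ∀ t ∈ Metric.ball (0 : ℂ) T,
      Tendsto (fun n => S.mu q (S.psn q n t) (K + j)) atTop (𝓝 (M j t)) := by
    intro j t ht
    rw [← tendsto_add_atTop_iff_nat (K + j)]
    refine (hMl j t ht).1.congr fun i => ?_
    rw [show K + (j + i) = i + (K + j) by ring]
  set P : ℂ → ℂ × ℂ := fun t => S.Hi^[K] (S.o q K + M 0 t * (S.ka ^ K / S.o q (K + 1)),
    S.o q (K + 1) + M 1 t * (S.ka ^ (K + 1) / S.o q (K + 1 + 1))) with hP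
  have hPl : ∀ t ∈ Metric.ball (0 : ℂ) T, Tendsto (fun n => S.psn q n t) atTop (𝓝 (P t)) := by
    intro t ht
    have hV1 := S.V_iter (show K ≤ K + 1 by omega) hV
    have h1 := ((hlim 0 t ht).mul_const (S.ka ^ K / S.o q (K + 1))).const_add (S.o q K)
    have h2 := ((hlim 1 t ht).mul_const (S.ka ^ (K + 1) / S.o q (K + 1 + 1))).const_add
      (S.o q (K + 1))
    have h3 := ((S.Hin_diff K).continuous.tendsto _).comp (h1.prodMk_nhds h2)
    refine h3.congr fun n => ?_
    have e1 := S.diff_eq_mu q (S.psn q n t) K (S.o_ne hV)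
    have e2 := S.diff_eq_mu q (S.psn q n t) (K + 1) (S.o_ne hV1)
    simp only [Function.comp, add_zero]
    rw [← e1, ← e2, add_sub_cancel, add_sub_cancel, ← o_eq, Hin_Hn]
  refine ⟨P, ?_, fun t ht => ⟨hPl t ht, ?_⟩⟩
  · refine (S.Hin_diff K).comp_differentiableOn (DifferentiableOn.prodMk ?_ ?_)
    · exact ((hMd 0).mul_const _).const_add _
    · exact ((hMd 1).mul_const _).const_add _
  · have hMeq : ∀ j, S.mu q (P t) (K + j) = M j t := fun j =>
      tendsto_nhds_unique (((S.mu_diff q (K + j)).continuous.tendsto _).comp (hPl t ht))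
        (hlim j t ht)
    rw [← tendsto_add_atTop_iff_nat K]
    simp only [add_comm _ K, hMeq]
    rw [tendsto_iff_norm_sub_tendsto_zero]
    have h0 : Tendsto (fun j : ℕ => 2 * (6 * T / 1000 * (1 / 2 : ℝ) ^ j)) atTop (𝓝 0) := by
      simpa using ((tendsto_pow_atTop_nhds_zero_of_lt_one (r := (1 / 2 : ℝ)) (by norm_num)
        (by norm_num)).const_mul (6 * T / 1000)).const_mul 2
    refine squeeze_zero (fun _ => norm_nonneg _) (fun j => ?_) h0
    rw [norm_sub_rev]
    exact (hMl j t ht).2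

/-- **Lemma C**: entire parametrization of the leaf -/
lemma psi {q : ℂ × ℂ} (hq : 0 < S.G q) : ∃ P : ℂ → ℂ × ℂ, Differentiable ℂ P ∧
    ∀ t, S.St q (P t) ∧ S.w q (P t) = t := by
  set P : ℂ → ℂ × ℂ := fun t => limUnder atTop (fun n => S.psn q n t) with hP
  have hmu : ∀ t, Tendsto (S.mu q (P t)) atTop (𝓝 t) := by
    intro t
    obtain ⟨P', -, h2⟩ := S.psi_loc hq (T := ‖t‖ + 1) (by positivity)
    obtain ⟨h3, h4⟩ := h2 t (by simp)
    have : P t = P' t := h3.limUnder_eq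
    rwa [this]
  refine ⟨P, ?_, fun t => ⟨S.St_of_mu hq (hmu t), w_eq (hmu t)⟩⟩
  intro t
  obtain ⟨P', h1, h2⟩ := S.psi_loc hq (T := ‖t‖ + 1) (by positivity)
  have ht : t ∈ Metric.ball (0 : ℂ) (‖t‖ + 1) := by simp
  have hnb := Metric.isOpen_ball.mem_nhds ht
  refine ((h1 t ht).differentiableAt hnb).congr_of_eventuallyEq ?_
  filter_upwards [hnb] with u hu
  exact (h2 u hu).1.limUnder_eq

end HS

/-- An entire function with an entire left inverse is linear, if it fixes the origin. -/
lemma entire_linear {h k : ℂ → ℂ} (hh : Differentiable ℂ h) (hk : Differentiable ℂ k)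
    (hkh : ∀ t, k (h t) = t) (h0 : h 0 = 0) : ∃ A : ℂ, A ≠ 0 ∧ ∀ t, h t = A * t := by
  have hinj : Function.Injective h := fun x y hxy => by rw [← hkh x, hxy, hkh]
  have hd0 : deriv h 0 ≠ 0 := by
    intro hz
    have h1 : HasDerivAt h (deriv h 0) 0 := (hh 0).hasDerivAt
    have h2 : HasDerivAt k (deriv k (h 0)) (h 0) := (hk _).hasDerivAt
    have h3 := h2.comp 0 h1
    have h4 : k ∘ h = id := funext hkh
    rw [h4, hz, mul_zero] at h3
    exact one_ne_zero ((hasDerivAt_id (0 : ℂ)).unique h3)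
  set u := dslope h 0 with hu
  have hu0 : u 0 = deriv h 0 := dslope_same h 0
  have hux : ∀ x, x ≠ 0 → u x = h x / x := by
    intro x hx
    rw [hu, dslope_of_ne _ hx, slope_def_field, h0, sub_zero, sub_zero]
  have hune : ∀ x, u x ≠ 0 := by
    intro x
    by_cases hx : x = 0
    · rw [hx, hu0]; exact hd0
    · rw [hux x hx]
      refine div_ne_zero (fun hc => hx (hinj (by rw [hc, h0]))) hx
  have hud : Differentiable ℂ u := by
    have := (Complex.differentiableOn_dslope (f := h) (s := univ) (c := 0) univ_mem).mpr
      hh.differentiableOn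
    exact differentiableOn_univ.mp this
  set v : ℂ → ℂ := fun x => (u x)⁻¹ with hv
  have hvd : Differentiable ℂ v := fun x => (hud x).inv (hune x)
  have hvne : ∀ x, v x ≠ 0 := fun x => inv_ne_zero (hune x)
  -- lower bound
  obtain ⟨δ, hδ, hlow⟩ : ∃ δ > 0, ∀ x : ℂ, 1 ≤ ‖x‖ → δ ≤ ‖h x‖ := by
    have han : AnalyticOnNhd ℂ h univ := hh.differentiableOn.analyticOnNhd isOpen_univ
    rcases han.is_constant_or_isOpenMap with ⟨w, hw⟩ | ho
    · exact absurd (hinj ((hw 0).trans (hw 1).symm)) zero_ne_one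
    · have h1 := ho _ (Metric.isOpen_ball (x := (0 : ℂ)) (ε := 1))
      have h2 : (0 : ℂ) ∈ h '' Metric.ball 0 1 := ⟨0, by simp, h0⟩
      obtain ⟨δ, hδ, hb⟩ := Metric.isOpen_iff.mp h1 0 h2
      refine ⟨δ, hδ, fun x hx => ?_⟩
      by_contra hlt
      push Not at hlt
      obtain ⟨x', hx', he⟩ := hb (mem_ball_zero_iff.mpr hlt)
      have := hinj he
      rw [this] at hx'
      have := mem_ball_zero_iff.mp hx'
      linarith
  have hvgrow : ∀ x, 1 ≤ ‖x‖ → ‖v x‖ ≤ ‖x‖ / δ := by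
    intro x hx
    have hx0 : x ≠ 0 := norm_pos_iff.mp (by linarith)
    have := hlow x hx
    simp only [hv]
    rw [hux x hx0, inv_div, norm_div]
    gcongr
  set s := dslope v 0 with hs
  have hsd : Differentiable ℂ s := by
    have := (Complex.differentiableOn_dslope (f := v) (s := univ) (c := 0) univ_mem).mpr
      hvd.differentiableOn
    exact differentiableOn_univ.mp this
  have hsx : ∀ x, x ≠ 0 → s x = (v x - v 0) / x := by
    intro x hx
    rw [hs, dslope_of_ne _ hx, slope_def_field, sub_zero]
  have hsb : Bornology.IsBounded (range s) := by
    obtain ⟨B, hB⟩ := (isCompact_closedBall (0 : ℂ) 1).exists_bound_of_continuousOn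
      hsd.continuous.continuousOn
    refine (isBounded_iff_forall_norm_le).mpr ⟨max B (1 / δ + ‖v 0‖), ?_⟩
    rintro _ ⟨x, rfl⟩
    by_cases hx : ‖x‖ ≤ 1
    · exact (hB x (by simpa using hx)).trans (le_max_left _ _)
    · push Not at hx
      have hx0 : x ≠ 0 := norm_pos_iff.mp (by linarith)
      refine le_trans ?_ (le_max_right _ _)
      rw [hsx x hx0, norm_div, div_le_iff₀ (by linarith)]
      have h1 := hvgrow x hx.le
      have h2 := norm_sub_le (v x) (v 0)
      have h3 := norm_nonneg (v 0)
      have h4 : (1 / δ + ‖v 0‖) * ‖x‖ = ‖x‖ / δ + ‖v 0‖ * ‖x‖ := by ring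
      nlinarith
  obtain ⟨b, hb⟩ := hsd.exists_const_forall_eq_of_bounded hsb
  have hvb : ∀ x, v x = v 0 + b * x := by
    intro x
    by_cases hx : x = 0
    · simp [hx]
    · have := hsx x hx
      rw [hb x] at this
      rw [this]; field_simp; ring
  have hb0 : b = 0 := by
    by_contra hb0
    apply hvne (-(v 0) / b)
    rw [hvb]; field_simp; ring
  refine ⟨(v 0)⁻¹, inv_ne_zero (hvne 0), fun t => ?_⟩
  by_cases ht : t = 0
  · simp [ht, h0]
  · have h1 := hvb t
    rw [hb0, zero_mul, add_zero] at h1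
    rw [← h1]
    simp only [hv, inv_inv]
    rw [hux t ht]; field_simp

namespace HS

variable (S : HS)

lemma close_of_exp {y y' A E E' : ℂ} (h : y = Complex.exp (A + E)) (h' : y' = Complex.exp (A + E'))
    (hE : ‖E‖ ≤ 3 / 2 * S.eps y) (hE' : ‖E'‖ ≤ 3 / 2 * S.eps y') (he : S.eps y ≤ 1 / 10)
    (he' : S.eps y' ≤ 1 / 10) : ‖y' - y‖ ≤ 15 * (S.C / √‖y‖) := by
  have hC := S.hC
  have hy0 : 0 < ‖y‖ := by rw [h, norm_pos_iff]; exact Complex.exp_ne_zero _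
  have hD : ‖E' - E‖ ≤ 3 / 10 := by
    have := norm_sub_le E' E; linarith
  have hyy : y' - y = y * (Complex.exp (E' - E) - 1) := by
    rw [h, h', mul_sub, ← Complex.exp_add]; ring_nf
  have hx := Complex.norm_exp_sub_one_le (x := E' - E) (by linarith)
  have h1 : ‖y' - y‖ ≤ ‖y‖ * (2 * ‖E' - E‖) := by
    rw [hyy, norm_mul]; gcongr
  have h2 : 2 / 5 * ‖y‖ ≤ ‖y'‖ := by
    have h3 := norm_sub_norm_le y y'
    rw [norm_sub_rev] at h3
    nlinarith
  have h3 : S.eps y' ≤ 4 * S.eps y := by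
    have h4 : 5 / 8 * √‖y‖ ≤ √‖y'‖ := by
      apply Real.le_sqrt_of_sq_le
      rw [mul_pow, Real.sq_sqrt hy0.le]; linarith
    have hs : 0 < √‖y‖ := Real.sqrt_pos.mpr hy0
    have h5 : 1 / 4 * (‖y‖ * √‖y‖) ≤ ‖y'‖ * √‖y'‖ := by
      calc 1 / 4 * (‖y‖ * √‖y‖) = 2 / 5 * ‖y‖ * (5 / 8 * √‖y‖) := by ring
        _ ≤ _ := by gcongr
    unfold eps
    calc S.C / (‖y'‖ * √‖y'‖) ≤ S.C / (1 / 4 * (‖y‖ * √‖y‖)) := by gcongr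
      _ = _ := by field_simp
  have h4 : ‖E' - E‖ ≤ 15 / 2 * S.eps y := by
    have := norm_sub_le E' E; linarith
  calc ‖y' - y‖ ≤ ‖y‖ * (2 * ‖E' - E‖) := h1
    _ ≤ ‖y‖ * (2 * (15 / 2 * S.eps y)) := by gcongr
    _ = _ := by unfold eps; field_simp

lemma eps_o {z : ℂ × ℂ} {m : ℕ} (h : S.H^[m] z ∈ S.V) : S.eps (S.o z (m + 1)) ≤ 1 / 10 := by
  rw [o_succ]; exact S.eps_small h

lemma inv_sqrt_tendsto {z : ℂ × ℂ} (hz : 0 < S.G z) :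
    Tendsto (fun m => 15 * (S.C / √‖S.o z (m + 1)‖)) atTop (𝓝 0) := by
  have h1 : Tendsto (fun m => √‖S.o z (m + 1)‖) atTop atTop :=
    Real.tendsto_sqrt_atTop.comp (S.norm_y_atTop hz)
  have h2 := ((tendsto_const_nhds (x := S.C)).div_atTop h1).const_mul 15
  rwa [mul_zero] at h2

lemma St_of_close {z z' : ℂ × ℂ} (hz : 0 < S.G z) {M : ℕ}
    (h : ∀ m ≥ M, ‖S.o z' (m + 1) - S.o z (m + 1)‖ ≤ 15 * (S.C / √‖S.o z (m + 1)‖)) :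
    S.St z z' := by
  rw [St, ← tendsto_add_atTop_iff_nat 1, tendsto_zero_iff_norm_tendsto_zero]
  refine squeeze_zero' (Eventually.of_forall fun _ => norm_nonneg _) ?_ (S.inv_sqrt_tendsto hz)
  filter_upwards [eventually_ge_atTop M] with m hm using h m hm

/-- holomorphic curves in level sets of `G` lie in leaves, and `w` is holomorphic on them -/
lemma leaf_loc {c : ℂ → ℂ × ℂ} (hc : Differentiable ℂ c) {s : ℝ} (hs : 0 < s)
    (hG : ∀ t, S.G (c t) = s) (t1 : ℂ) :
    (∀ᶠ t in 𝓝 t1, S.St (c t1) (c t)) ∧ DifferentiableAt ℂ (fun t => S.w (c t1) (c t)) t1 := by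
  have hpos : ∀ t, 0 < S.G (c t) := fun t => by rw [hG]; exact hs
  obtain ⟨r, hr, M, g, -, hg, hgp⟩ := S.LK isOpen_univ hc.differentiableOn (fun t _ => hpos t)
    (mem_univ t1)
  obtain ⟨g0, hg0⟩ := (hg.analyticOnNhd Metric.isOpen_ball).eq_const_of_re_eq_const
    (c₀ := s) (fun x hx => by rw [(hgp x hx).1, hG]) Metric.isOpen_ball
    (Metric.isConnected_ball hr)
  have ht1 : t1 ∈ Metric.ball t1 r := Metric.mem_ball_self hr
  have hcl : ∀ t ∈ Metric.ball t1 r, ∀ m ≥ M,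
      ‖S.o (c t) (m + 1) - S.o (c t1) (m + 1)‖ ≤ 15 * (S.C / √‖S.o (c t1) (m + 1)‖) := by
    intro t ht m hm
    obtain ⟨-, hV, hE⟩ := hgp t ht
    obtain ⟨-, hV1, hE1⟩ := hgp t1 ht1
    obtain ⟨E, he, hb⟩ := hE m hm
    obtain ⟨E1, he1, hb1⟩ := hE1 m hm
    rw [hg0 t ht] at he
    rw [hg0 t1 ht1] at he1
    exact S.close_of_exp he1 he hb1 hb (S.eps_o (S.V_iter hm hV1)) (S.eps_o (S.V_iter hm hV))
  have hSt : ∀ t ∈ Metric.ball t1 r, S.St (c t1) (c t) := fun t ht =>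
    S.St_of_close (hpos t1) (hcl t ht)
  refine ⟨by filter_upwards [Metric.isOpen_ball.mem_nhds ht1] with t ht using hSt t ht, ?_⟩
  obtain ⟨m1, hm1⟩ := eventually_atTop.mp ((S.inv_sqrt_tendsto (hpos t1)).eventually_le_const
    one_pos)
  set m0 := max m1 M with hm0
  have hV : S.H^[m0] (c t1) ∈ S.V := S.V_iter (le_max_right _ _) (hgp t1 ht1).2.1
  have hle : ∀ t ∈ Metric.ball t1 r, ∀ j > m0, ‖S.o (c t) j - S.o (c t1) j‖ ≤ 1 := by
    intro t ht j hj
    obtain ⟨m, rfl⟩ : ∃ m, j = m + 1 := ⟨j - 1, by omega⟩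
    have : m1 ≤ m0 ∧ M ≤ m0 := ⟨le_max_left _ _, le_max_right _ _⟩
    exact (hcl t ht m (by omega)).trans (hm1 m (by omega))
  have hmud : ∀ k, Differentiable ℂ (fun t => S.mu (c t1) (c t) k) := fun k =>
    (S.mu_diff (c t1) k).comp hc
  have hmu1 : ∀ᶠ t in 𝓝 t1, ‖S.mu (c t1) (c t) m0‖ < 1 := by
    have h1 : Tendsto (fun t => ‖S.mu (c t1) (c t) m0‖) (𝓝 t1) (𝓝 ‖S.mu (c t1) (c t1) m0‖) :=
      ((hmud m0).continuous.tendsto t1).norm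
    refine h1.eventually_lt_const ?_
    simp [mu, nu]
  obtain ⟨r', hr', hsub⟩ := Metric.eventually_nhds_iff_ball.mp
    (hmu1.and (Metric.isOpen_ball.mem_nhds ht1))
  have hw : ∀ t ∈ Metric.ball t1 r', ∀ j,
      ‖S.w (c t1) (c t) - S.mu (c t1) (c t) (m0 + j)‖ ≤ 1 / 2 * (1 / 2) ^ j := by
    intro t ht j
    obtain ⟨h1, h2⟩ := hsub t ht
    obtain ⟨w, hw1, hw2⟩ := S.lemB hV (hle t h2)
    rw [w_eq hw1]
    refine (hw2 j).trans ?_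
    have : (0 : ℝ) < 1 / 2 * (1 / 2) ^ j := by positivity
    nlinarith
  obtain ⟨g', hg'd, hg'l⟩ := geo_limit (fun j t => S.mu (c t1) (c t) (m0 + j)) (Metric.ball t1 r')
    Metric.isOpen_ball (fun j => (hmud _).differentiableOn) 1 (by
      intro j t ht
      have h1 := hw t ht j
      have h2 := hw t ht (j + 1)
      have h3 := norm_sub_le (S.w (c t1) (c t) - S.mu (c t1) (c t) (m0 + (j + 1)))
        (S.w (c t1) (c t) - S.mu (c t1) (c t) (m0 + j))
      have h4 : (0 : ℝ) < (1 / 2) ^ j := by positivity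
      rw [sub_sub_sub_cancel_left] at h3
      rw [pow_succ] at h2
      linarith)
  have hr1 := Metric.isOpen_ball.mem_nhds (Metric.mem_ball_self (x := t1) hr')
  refine (hg'd.differentiableAt hr1).congr_of_eventuallyEq ?_
  filter_upwards [hr1] with t ht
  have h1 := w_lim (hpos t1) (hSt t (hsub t ht).2)
  rw [← tendsto_add_atTop_iff_nat m0] at h1
  simp only [add_comm _ m0] at h1
  exact tendsto_nhds_unique h1 (hg'l t ht).1

lemma leaf_hol {c : ℂ → ℂ × ℂ} (hc : Differentiable ℂ c) {s : ℝ} (hs : 0 < s)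
    (hG : ∀ t, S.G (c t) = s) (t0 : ℂ) :
    (∀ t, S.St (c t0) (c t)) ∧ Differentiable ℂ (fun t => S.w (c t0) (c t)) := by
  have hpos : ∀ t, 0 < S.G (c t) := fun t => by rw [hG]; exact hs
  have hSt : ∀ t t', S.St (c t) (c t') := by
    intro t t'
    refine PreconnectedSpace.induction₂' (fun t t' => S.St (c t) (c t')) (fun x => ?_)
      ⟨fun x y z h h' => St.trans S h h'⟩ t t'
    filter_upwards [(S.leaf_loc hc hs hG x).1] with y hy using ⟨hy, St.symm S hy⟩
  refine ⟨hSt t0, fun t1 => ?_⟩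
  have : (fun t => S.w (c t0) (c t)) = fun t => S.w (c t0) (c t1) + S.w (c t1) (c t) := by
    ext t
    exact w_add (hpos t0) (hSt t0 t1) (hSt t1 t)
  rw [this]
  exact (S.leaf_loc hc hs hG t1).2.const_add _

lemma Om_open (c : ℝ) : IsOpen (S.Om c) :=
  (isOpen_lt continuous_const S.Gcont).inter (isOpen_lt S.Gcont continuous_const)

/-- the map between leaves is linear -/
lemma leaf_linear {F F' : ℂ × ℂ → ℂ × ℂ} {c : ℝ} (hF : DifferentiableOn ℂ F (S.Om c))
    (hF' : DifferentiableOn ℂ F' (S.Om c)) (hm : MapsTo F (S.Om c) (S.Om c))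
    (hm' : MapsTo F' (S.Om c) (S.Om c)) (hinv : ∀ z ∈ S.Om c, F' (F z) = z)
    (hinv' : ∀ z ∈ S.Om c, F (F' z) = z)
    (hG : ∀ z ∈ S.Om c, S.G (F z) = c - S.G z) {q : ℂ × ℂ} (hq : q ∈ S.Om c) :
    ∃ A : ℂ, A ≠ 0 ∧ ∀ q', S.St q q' → S.w (F q) (F q') = A * S.w q q' := by
  have key : ∀ (F : ℂ × ℂ → ℂ × ℂ), DifferentiableOn ℂ F (S.Om c) → MapsTo F (S.Om c) (S.Om c) →
      (∀ z ∈ S.Om c, S.G (F z) = c - S.G z) → ∀ q ∈ S.Om c, ∀ P : ℂ → ℂ × ℂ, Differentiable ℂ P →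
      (∀ t, S.St q (P t)) → P 0 = q → (∀ t, S.St (F q) (F (P t))) ∧
        Differentiable ℂ (fun t => S.w (F q) (F (P t))) := by
    intro F hF hm hG q hq P hP hSt hP0
    have hPO : ∀ t, P t ∈ S.Om c := by
      intro t
      have := (hSt t).G_eq hq.1
      exact ⟨by rw [this]; exact hq.1, by rw [this]; exact hq.2⟩
    have hd : Differentiable ℂ (fun t => F (P t)) := fun t =>
      (hF.differentiableAt ((S.Om_open c).mem_nhds (hPO t))).comp t (hP t)
    have := S.leaf_hol hd (s := c - S.G q) (by linarith [hq.2]) (fun t => by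
      rw [hG _ (hPO t), (hSt t).G_eq hq.1]) 0
    simpa only [hP0] using this
  have hps : ∀ q, 0 < S.G q → ∃ P : ℂ → ℂ × ℂ, Differentiable ℂ P ∧
      (∀ t, S.St q (P t) ∧ S.w q (P t) = t) ∧ P 0 = q ∧ ∀ q', S.St q q' → P (S.w q q') = q' := by
    intro q hq
    obtain ⟨P, h1, h2⟩ := S.psi hq
    have h3 : ∀ q', S.St q q' → P (S.w q q') = q' := fun q' h =>
      w_inj hq (h2 _).1 h (h2 _).2
    refine ⟨P, h1, h2, ?_, h3⟩
    have := h3 q (St.refl S q)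
    rwa [w_eq (mu_self q)] at this
  have hG' : ∀ z ∈ S.Om c, S.G (F' z) = c - S.G z := by
    intro z hz
    have := hG _ (hm' hz)
    rw [hinv' z hz] at this
    linarith
  have hFq := hm hq
  obtain ⟨P, p1, p2, p3, p4⟩ := hps q hq.1
  obtain ⟨Q, q1, q2, q3, q4⟩ := hps (F q) hFq.1
  obtain ⟨k1, k2⟩ := key F hF hm hG q hq P p1 (fun t => (p2 t).1) p3
  obtain ⟨-, k3⟩ := key F' hF' hm' hG' (F q) hFq Q q1 (fun t => (q2 t).1) q3
  rw [hinv q hq] at k3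
  have hPO : ∀ t, P t ∈ S.Om c := by
    intro t
    have := (p2 t).1.G_eq hq.1
    exact ⟨by rw [this]; exact hq.1, by rw [this]; exact hq.2⟩
  obtain ⟨A, hA, hlin⟩ := entire_linear k2 k3 (fun t => by
    rw [q4 _ (k1 t), hinv _ (hPO t), (p2 t).2]) (by rw [p3, w_eq (mu_self _)])
  refine ⟨A, hA, fun q' hq' => ?_⟩
  have := hlin (S.w q q')
  rwa [p4 q' hq'] at this

end HS

namespace HS

variable (S : HS)

/-- logarithmic representation of an orbit -/
def Rep (z : ℂ × ℂ) (M : ℕ) (g : ℂ) : Prop :=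
  S.H^[M] z ∈ S.V ∧ ∀ m ≥ M, ∃ E : ℂ, S.o z (m + 1) = Complex.exp (S.d ^ m * g + E) ∧
    ‖E‖ ≤ 3 / 2 * S.eps (S.o z (m + 1))

variable {S}

lemma Rep.mono {z : ℂ × ℂ} {M M' : ℕ} {g : ℂ} (h : S.Rep z M g) (hM : M ≤ M') : S.Rep z M' g :=
  ⟨S.V_iter hM h.1, fun m hm => h.2 m (hM.trans hm)⟩

lemma Rep.pos {z : ℂ × ℂ} {M : ℕ} {g : ℂ} (h : S.Rep z M g) : 0 < S.G z := S.G_V_pos h.1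

lemma Rep.close {z z' : ℂ × ℂ} {M n : ℕ} {g θ : ℂ} (h : S.Rep z M g)
    (h' : S.Rep z' M (g + θ / S.d ^ n)) (hθ : Complex.exp θ = 1) (hn : M ≤ n) (m : ℕ) (hm : n ≤ m) :
    ‖S.o z' (m + 1) - S.o z (m + 1)‖ ≤ 15 * (S.C / √‖S.o z (m + 1)‖) := by
  obtain ⟨E, he, hb⟩ := h.2 m (by omega)
  obtain ⟨E', he', hb'⟩ := h'.2 m (by omega)
  refine S.close_of_exp he (y' := S.o z' (m + 1)) ?_ hb hb' (S.eps_o (S.V_iter (by omega) h.1))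
    (S.eps_o (S.V_iter (by omega) h'.1))
  rw [he']
  obtain ⟨k, rfl⟩ := Nat.exists_eq_add_of_le hm
  have hdc := S.hdc
  have : (S.d : ℂ) ^ (n + k) * (g + θ / S.d ^ n) + E' =
      ((S.d ^ k : ℕ) : ℂ) * θ + (S.d ^ (n + k) * g + E') := by
    push_cast
    rw [pow_add]; field_simp; ring
  rw [this, Complex.exp_add, Complex.exp_nat_mul, hθ, one_pow, one_mul]

lemma Rep.E_small {z : ℂ × ℂ} {M j : ℕ} (h : S.H^[M] z ∈ S.V) :
    S.eps (S.o z (M + j + 1)) ≤ (1 / 2) ^ j / 1000 := by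
  refine le_trans ?_ (S.theta_le h j)
  have h1 := (S.y_bounds (S.V_iter (show M ≤ M + j by omega) h)).2.1
  have hC := S.hC
  unfold eps
  have : 1 ≤ √‖S.o z (M + j + 1)‖ := Real.one_le_sqrt.mpr (by linarith)
  gcongr
  nlinarith

lemma Rep.rot {z z' : ℂ × ℂ} {M j : ℕ} {g θ : ℂ} (h : S.Rep z M g)
    (h' : S.Rep z' M (g + θ / S.d ^ (M + j + 1))) (hθ : θ.re = 0) :
    ‖S.o z' (M + j + 1) - S.o z (M + j + 1) * Complex.exp (θ / S.d)‖ ≤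
      ‖S.o z (M + j + 1)‖ * (6 * ((1 / 2) ^ j / 1000)) := by
  obtain ⟨E, he, hb⟩ := h.2 (M + j) (by omega)
  obtain ⟨E', he', hb'⟩ := h'.2 (M + j) (by omega)
  have s1 := Rep.E_small (j := j) h.1
  have s2 := Rep.E_small (j := j) h'.1
  have hj : (1 / 2 : ℝ) ^ j ≤ 1 := pow_le_one₀ (by norm_num) (by norm_num)
  have hdc := S.hdc
  have hD : ‖E' - E‖ ≤ 3 * ((1 / 2) ^ j / 1000) := by
    have := norm_sub_le E' E; linarith
  have e1 : S.o z' (M + j + 1) - S.o z (M + j + 1) * Complex.exp (θ / S.d) =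
      S.o z (M + j + 1) * (Complex.exp (θ / S.d) * (Complex.exp (E' - E) - 1)) := by
    have : S.o z' (M + j + 1) =
        S.o z (M + j + 1) * (Complex.exp (θ / S.d) * Complex.exp (E' - E)) := by
      rw [he', he, ← Complex.exp_add, ← Complex.exp_add]
      congr 1
      rw [pow_succ]; field_simp; ring
    rw [this]; ring
  have e2 : ‖Complex.exp (θ / S.d)‖ = 1 := by
    rw [Complex.norm_exp]
    have : (θ / S.d).re = 0 := by rw [Complex.div_natCast_re, hθ, zero_div]
    rw [this, Real.exp_zero]
  rw [e1, norm_mul, norm_mul, e2, one_mul]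
  have := Complex.norm_exp_sub_one_le (x := E' - E) (by linarith)
  gcongr
  linarith

lemma Rep.w_bd {z z' : ℂ × ℂ} {M n : ℕ} {g θ : ℂ} (h : S.Rep z M g)
    (h' : S.Rep z' M (g + θ / S.d ^ n)) (hθ : Complex.exp θ = 1) (hn : M ≤ n)
    (h1 : ∀ m ≥ n, 15 * (S.C / √‖S.o z (m + 1)‖) ≤ 1) :
    S.St z z' ∧ ‖S.mu z z' n‖ ≤ 2 * ‖S.w z z'‖ ∧ ‖S.w z z'‖ ≤ 2 * ‖S.mu z z' n‖ := by
  have hcl := h.close h' hθ hn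
  refine ⟨S.St_of_close h.pos hcl, ?_⟩
  obtain ⟨w, hw1, hw2⟩ := S.lemB (z' := z') (S.V_iter hn h.1) (by
    intro j hj
    obtain ⟨m, rfl⟩ : ∃ m, j = m + 1 := ⟨j - 1, by omega⟩
    exact (hcl m (by omega)).trans (h1 m (by omega)))
  rw [w_eq hw1]
  have := hw2 0
  simp only [pow_zero, add_zero, mul_one] at this
  have a1 := norm_sub_norm_le w (S.mu z z' n)
  have a2 := norm_sub_norm_le (S.mu z z' n) w
  rw [norm_sub_rev] at a2
  constructor <;> linarith [norm_nonneg (S.mu z z' n)]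

lemma ratio_zero {z z' : ℂ × ℂ} (hz' : 0 < S.G z') (hlt : S.G z' < S.G z) :
    Tendsto (fun n => ‖S.o z' (n + 1)‖ / ‖S.o z (n + 1)‖) atTop (𝓝 0) := by
  have hz := hz'.trans hlt
  have h1 := (S.lim_log hz').sub (S.lim_log hz)
  have h2 : Tendsto (fun n => Real.log (‖S.o z' (n + 1)‖ / ‖S.o z (n + 1)‖)) atTop atBot := by
    have h3 := S.dpow_atTop.atTop_mul_neg (by linarith : S.G z' - S.G z < 0) h1
    refine h3.congr' ?_
    filter_upwards [(S.norm_y_atTop hz).eventually_gt_atTop 0,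
      (S.norm_y_atTop hz').eventually_gt_atTop 0] with k h6 h7
    have := S.hd0
    rw [Real.log_div h7.ne' h6.ne']
    field_simp
  have h4 := Real.tendsto_exp_atBot.comp h2
  refine h4.congr' ?_
  filter_upwards [(S.norm_y_atTop hz).eventually_gt_atTop 0,
      (S.norm_y_atTop hz').eventually_gt_atTop 0] with k h6 h7
  simp only [Function.comp]
  rw [Real.exp_log (by positivity)]

lemma nonconst_curve {s : ℝ} (hs : 0 < s) : ∃ γ : ℂ → ℂ × ℂ, ∃ ζ : ℂ, Differentiable ℂ γ ∧
    S.G (γ ζ) = s ∧ ¬ ∀ᶠ x in 𝓝 ζ, S.G (γ x) = s := by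
  obtain ⟨q, hq⟩ := S.G_surj hs
  obtain ⟨q2, hq2⟩ := S.G_surj (by linarith : 0 < 2 * s)
  set γ : ℂ → ℂ × ℂ := fun ζ => q + ζ • (q2 - q) with hγ
  have hd : Differentiable ℂ γ := (differentiable_id.smul_const _).const_add _
  by_contra hcon
  push Not at hcon
  have hcl : IsClopen {ζ | S.G (γ ζ) = s} := by
    constructor
    · exact isClosed_eq (S.Gcont.comp hd.continuous) continuous_const
    · rw [isOpen_iff_mem_nhds]
      intro ζ hζ
      have := hcon γ ζ hd hζ
      exact this
  have h0 : (0 : ℂ) ∈ {ζ | S.G (γ ζ) = s} := by simp [hγ, hq]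
  have h1 : (1 : ℂ) ∈ {ζ | S.G (γ ζ) = s} := by
    rw [hcl.eq_univ ⟨0, h0⟩]; trivial
  simp only [hγ, mem_setOf_eq, one_smul, add_sub_cancel, hq2] at h1
  linarith

/-- **Exclusion of the second case.** -/
lemma exclude {F F' : ℂ × ℂ → ℂ × ℂ} {c : ℝ} (hc : 0 < c) (hF : DifferentiableOn ℂ F (S.Om c))
    (hF' : DifferentiableOn ℂ F' (S.Om c)) (hm : MapsTo F (S.Om c) (S.Om c))
    (hm' : MapsTo F' (S.Om c) (S.Om c)) (hinv : ∀ z ∈ S.Om c, F' (F z) = z)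
    (hinv' : ∀ z ∈ S.Om c, F (F' z) = z)
    (hG : ∀ z ∈ S.Om c, S.G (F z) = c - S.G z) : False := by
  obtain ⟨γ, ζ, hγ, hs, hnc⟩ := S.nonconst_curve (show 0 < 3 * c / 4 by linarith)
  set D := γ ⁻¹' S.Om c with hD
  have hDo : IsOpen D := (S.Om_open c).preimage hγ.continuous
  have hζ : ζ ∈ D := ⟨by rw [hs]; linarith, by rw [hs]; linarith⟩
  set q := γ ζ with hq
  have hqO : q ∈ S.Om c := hζ
  have hFγ : DifferentiableOn ℂ (fun x => F (γ x)) D :=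
    hF.comp hγ.differentiableOn (fun x hx => hx)
  obtain ⟨r1, hr1, M1, g, hb1, hg, hgp⟩ := S.LK hDo hγ.differentiableOn (fun t ht => ht.1) hζ
  obtain ⟨r2, hr2, M2, f, hb2, hf, hfp⟩ := S.LK hDo hFγ (fun t ht => (hm ht).1) hζ
  set r := min r1 r2 with hr
  have hr0 : 0 < r := lt_min hr1 hr2
  have s1 : Metric.ball ζ r ⊆ Metric.ball ζ r1 := Metric.ball_subset_ball (min_le_left _ _)
  have s2 : Metric.ball ζ r ⊆ Metric.ball ζ r2 := Metric.ball_subset_ball (min_le_right _ _)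
  have hζr : ζ ∈ Metric.ball ζ r := Metric.mem_ball_self hr0
  have hga := (hg.mono s1).analyticOnNhd Metric.isOpen_ball
  have hfa := (hf.mono s2).analyticOnNhd Metric.isOpen_ball
  set M := max M1 M2 with hM
  have hRep : ∀ x ∈ Metric.ball ζ r, S.Rep (γ x) M (g x) := fun x hx =>
    Rep.mono ⟨(hgp x (s1 hx)).2.1, (hgp x (s1 hx)).2.2⟩ (le_max_left _ _)
  have hRepF : ∀ x ∈ Metric.ball ζ r, S.Rep (F (γ x)) M (f x) := fun x hx =>
    Rep.mono ⟨(hfp x (s2 hx)).2.1, (hfp x (s2 hx)).2.2⟩ (le_max_right _ _)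
  obtain ⟨k, hk⟩ := (hga.add hfa).eq_const_of_re_eq_const (c₀ := c) (fun x hx => by
    simp only [Pi.add_apply, Complex.add_re]
    rw [(hgp x (s1 hx)).1, (hfp x (s2 hx)).1, hG _ (hb1 (s1 hx))]; ring)
    Metric.isOpen_ball (Metric.isConnected_ball hr0)
  -- g is open at ζ
  have hopen : g '' Metric.ball ζ r ∈ 𝓝 (g ζ) := by
    rcases hga.is_constant_or_isOpen (convex_ball ζ r).isPreconnected with ⟨e, he⟩ | ho
    · exfalso
      apply hnc
      filter_upwards [Metric.isOpen_ball.mem_nhds hζr] with x hx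
      rw [← (hgp x (s1 hx)).1, he x hx, ← he ζ hζr, (hgp ζ (s1 hζr)).1, hs]
    · exact (ho _ subset_rfl Metric.isOpen_ball).mem_nhds ⟨ζ, hζr, rfl⟩
  obtain ⟨A, hA, hlin⟩ := S.leaf_linear hF hF' hm hm' hinv hinv' hG hqO
  set θ : ℂ := 2 * Real.pi * Complex.I with hθ
  have hθ1 : Complex.exp θ = 1 := Complex.exp_two_pi_mul_I
  have hθ2 : Complex.exp (-θ) = 1 := by rw [Complex.exp_neg, hθ1, inv_one]
  have hθr : θ.re = 0 := by simp [hθ]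
  have hθr' : (-θ).re = 0 := by simp [hθ]
  set c0 := ‖Complex.exp (θ / S.d) - 1‖ with hc0
  have hc0p : 0 < c0 := by
    rw [hc0, norm_pos_iff, sub_ne_zero]
    have h1 := Complex.isPrimitiveRoot_exp S.d (by have := S.hd; omega)
    exact h1.ne_one (by have := S.hd; omega)
  have hFqG : S.G (F q) < S.G q := by rw [hG q hqO, hs]; linarith
  have hFqp : 0 < S.G (F q) := (hm hqO).1
  -- points
  have hpt : ∀ᶠ n : ℕ in atTop, g ζ + θ / S.d ^ n ∈ g '' Metric.ball ζ r := by
    have h1 : Tendsto (fun n : ℕ => g ζ + θ / (S.d : ℂ) ^ n) atTop (𝓝 (g ζ + 0)) := by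
      refine Tendsto.const_add _ ?_
      rw [tendsto_zero_iff_norm_tendsto_zero]
      simpa using S.const_div_dpow ‖θ‖
    rw [add_zero] at h1
    exact h1.eventually hopen
  have hR := ratio_zero hFqp hFqG
  have hRR := (hR.comp (tendsto_add_atTop_nat 1)).mul hR
  rw [mul_zero] at hRR
  have hAc : 0 < ‖A‖ * c0 / 24 := by have := norm_pos_iff.mpr hA; positivity
  have hone : ∀ z, 0 < S.G z → ∀ᶠ n : ℕ in atTop, ∀ m ≥ n, 15 * (S.C / √‖S.o z (m + 1)‖) ≤ 1 := by
    intro z hz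
    obtain ⟨N, hN⟩ := eventually_atTop.mp ((S.inv_sqrt_tendsto hz).eventually_le_const one_pos)
    filter_upwards [eventually_ge_atTop N] with n hn m hm using hN m (hn.trans hm)
  have hjs : ∀ᶠ n : ℕ in atTop, 6 * ((1 / 2 : ℝ) ^ (n - M) / 1000) ≤ c0 / 2 := by
    have h1 : Tendsto (fun n : ℕ => (1 / 2 : ℝ) ^ (n - M)) atTop (𝓝 0) :=
      (tendsto_pow_atTop_nhds_zero_of_lt_one (by norm_num) (by norm_num)).comp
        (tendsto_sub_atTop_nat M)
    have h2 := (h1.div_const 1000).const_mul 6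
    rw [zero_div, mul_zero] at h2
    exact h2.eventually_le_const (by positivity)
  obtain ⟨n, e1, e2, e3, e4, e5, e6⟩ := ((tendsto_add_atTop_nat 1 |>.eventually hpt).and
    ((hRR.eventually_lt_const hAc).and ((tendsto_add_atTop_nat 1 |>.eventually (hone q hqO.1)).and
    ((tendsto_add_atTop_nat 1 |>.eventually (hone (F q) hFqp)).and
      ((eventually_ge_atTop M).and hjs))))).exists
  obtain ⟨j, rfl⟩ := Nat.exists_eq_add_of_le e5
  rw [show M + j - M = j by omega] at e6
  obtain ⟨x, hx, hgx⟩ := e1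
  have hfx : f x = f ζ + (-θ) / S.d ^ (M + j + 1) := by
    have h1 := hk x hx
    have h2 := hk ζ hζr
    simp only [Pi.add_apply] at h1 h2
    rw [hgx] at h1
    rw [neg_div]
    linear_combination h1 - h2
  have R1 := hRep ζ hζr
  have R2 := hRep x hx
  have R3 := hRepF ζ hζr
  have R4 := hRepF x hx
  rw [hgx] at R2
  rw [hfx] at R4
  rw [← hq] at R1 R3
  set q' := γ x with hq'
  have rot1 := R1.rot R2 hθr
  have rot2 := R3.rot R4 hθr'
  obtain ⟨St1, b1, -⟩ := R1.w_bd R2 hθ1 (by omega) e3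
  obtain ⟨-, -, b2⟩ := R3.w_bd R4 hθ2 (by omega) e4
  rw [hlin q' St1, norm_mul] at b2
  simp only [mu, norm_nu] at b1 b2
  have hy0 : 0 < ‖S.o q (M + j + 1)‖ :=
    norm_pos_iff.mpr (S.o_ne (S.V_iter (by omega : M ≤ M + j) R1.1))
  have hy1 : 0 < ‖S.o q (M + j + 1 + 1)‖ :=
    norm_pos_iff.mpr (S.o_ne (S.V_iter (by omega : M ≤ M + j + 1) R1.1))
  -- lower bound for the difference of q, q'
  have low : c0 / 2 * ‖S.o q (M + j + 1)‖ ≤ ‖S.o q' (M + j + 1) - S.o q (M + j + 1)‖ := by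
    set y := S.o q (M + j + 1)
    set y' := S.o q' (M + j + 1)
    have h1 : ‖y * (Complex.exp (θ / S.d) - 1)‖ ≤
        ‖y' - y * Complex.exp (θ / S.d)‖ + ‖y' - y‖ := by
      have : y * (Complex.exp (θ / S.d) - 1) = (y' - y) - (y' - y * Complex.exp (θ / S.d)) := by ring
      rw [this, add_comm]
      exact norm_sub_le _ _
    rw [norm_mul, ← hc0] at h1
    have h2 : ‖y‖ * (6 * ((1 / 2) ^ j / 1000)) ≤ ‖y‖ * (c0 / 2) := by gcongr
    linarith
  have up : ‖S.o (F q') (M + j + 1) - S.o (F q) (M + j + 1)‖ ≤ 3 * ‖S.o (F q) (M + j + 1)‖ := by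
    set y := S.o (F q) (M + j + 1)
    set y' := S.o (F q') (M + j + 1)
    have e2' : ‖Complex.exp (-θ / S.d)‖ = 1 := by
      rw [Complex.norm_exp]
      have : (-θ / S.d).re = 0 := by rw [Complex.div_natCast_re, hθr', zero_div]
      rw [this, Real.exp_zero]
    have hj : (1 / 2 : ℝ) ^ j ≤ 1 := pow_le_one₀ (by norm_num) (by norm_num)
    have h1 : ‖y' - y‖ ≤ ‖y' - y * Complex.exp (-θ / S.d)‖ + ‖y * Complex.exp (-θ / S.d)‖ + ‖y‖ := by
      have : y' - y = (y' - y * Complex.exp (-θ / S.d)) + y * Complex.exp (-θ / S.d) - y := by ring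
      rw [this]
      refine (norm_sub_le _ _).trans ?_
      gcongr
      exact (norm_add_le _ _).trans (by simp)
    rw [norm_mul, e2', mul_one] at h1
    have h2 : ‖y‖ * (6 * ((1 / 2) ^ j / 1000)) ≤ ‖y‖ * 1 := by gcongr; linarith
    linarith
  have hkp : 0 < ‖S.ka‖ ^ (M + j + 1) := pow_pos S.ka_pos _
  simp only [Function.comp] at e2
  rw [div_mul_div_comm, div_lt_iff₀ (by positivity)] at e2
  set Kp := ‖S.ka‖ ^ (M + j + 1)
  set y0 := ‖S.o q (M + j + 1)‖
  set y1 := ‖S.o q (M + j + 1 + 1)‖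
  set Y0 := ‖S.o (F q) (M + j + 1)‖
  set Y1 := ‖S.o (F q) (M + j + 1 + 1)‖
  set w := ‖S.w q q'‖
  have hY1 : 0 ≤ Y1 := norm_nonneg _
  have hA0 := norm_pos_iff.mpr hA
  have f1 : c0 / 2 * y0 * y1 ≤ 2 * w * Kp := by
    rw [div_le_iff₀ hkp] at b1
    refine le_trans ?_ b1
    gcongr
  have f2 : ‖A‖ * w * Kp ≤ 2 * (3 * Y0 * Y1) := by
    have : ‖A‖ * w * Kp ≤ 2 * (‖S.o (F q') (M + j + 1) - S.o (F q) (M + j + 1)‖ * Y1) := by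
      have h := mul_le_mul_of_nonneg_right b2 hkp.le
      refine h.trans (le_of_eq ?_)
      field_simp
    refine this.trans ?_
    gcongr
  have f3 := mul_le_mul_of_nonneg_left f1 hA0.le
  nlinarith

end HS

/-- Let `c > 0` and let `f` be an automorphism of the punctured Short ℂ²,
`Ω'_c = {0 < G⁺_H < c}`. Then `G⁺_H ∘ f = G⁺_H` on `Ω'_c`; consequently, for every
`0 < b < c`, `f(Ω'_b) = Ω'_b`, i.e. `f` restricts to an automorphism of `Ω'_b`. -/
theorem stmt_5 (d : ℕ) (hd : 2 ≤ d) (a : ℂ) (ha : a ≠ 0)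
    (p : Polynomial ℂ) (hpm : p.Monic) (hpd : p.natDegree = d)
    (hpc : p.coeff (d - 1) = 0)
    (H : ℂ × ℂ → ℂ × ℂ) (hH : ∀ z : ℂ × ℂ, H z = (z.2, p.eval z.2 - a * z.1))
    (G : ℂ × ℂ → ℝ) (hGcont : Continuous G) (hGnonneg : ∀ z, 0 ≤ G z)
    (hGlim : ∀ z : ℂ × ℂ,
      Tendsto (fun n : ℕ => Real.log (max ‖H^[n] z‖ 1) / (d : ℝ) ^ n) atTop (𝓝 (G z)))
    (c : ℝ) (hc : 0 < c)
    (f g : ℂ × ℂ → ℂ × ℂ)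
    (hf : IsBiholoOn f g {z : ℂ × ℂ | 0 < G z ∧ G z < c}
      {z : ℂ × ℂ | 0 < G z ∧ G z < c}) :
    (∀ z ∈ {z : ℂ × ℂ | 0 < G z ∧ G z < c}, G (f z) = G z) ∧
    (∀ b : ℝ, 0 < b → b < c →
      f '' {z : ℂ × ℂ | 0 < G z ∧ G z < b} = {z : ℂ × ℂ | 0 < G z ∧ G z < b} ∧
      IsBiholoOn f g {z : ℂ × ℂ | 0 < G z ∧ G z < b}
        {z : ℂ × ℂ | 0 < G z ∧ G z < b}) := by
  obtain rfl : H = fun z : ℂ × ℂ => (z.2, p.eval z.2 - a * z.1) := funext hH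
  obtain ⟨C, hC, haC, h1, h2, h3⟩ := exists_consts d hd a p hpm hpd hpc
  have hR : ∀ y : ℂ, 1000 * C < ‖y‖ → 2 ≤ ‖y‖ := fun y hy => by linarith
  let S : HS :=
    { d := d, hd := hd, a := a, ha := ha, p := p, R := 1000 * C, C := C, hC := hC, haC := haC
      hRC := le_rfl
      E1 := fun x y hy hx => h1 x y (hR y hy) hx
      E1' := fun x y hy hx => h2 x y (hR y hy) hx
      E2 := fun y u v hy hu hv => h3 y u v (hR y hy) hu hv
      G := G, Gcont := hGcont, Gnn := hGnonneg, Glim := hGlim }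
  obtain ⟨hfd, hgd, hfm, hgm, hgf, hfg⟩ := hf
  have hGf : ∀ z ∈ {z : ℂ × ℂ | 0 < G z ∧ G z < c}, G (f z) = G z := by
    have hs : Set.SurjOn f (S.Om c) (S.Om c) := fun w hw => ⟨g w, hgm hw, hfg w hw⟩
    rcases S.step1_dichotomy hc hfd hfm hs with h | h
    · exact h
    · exact (HS.exclude (S := S) hc hfd hgd hfm hgm hgf hfg h).elim
  have hGg : ∀ z ∈ {z : ℂ × ℂ | 0 < G z ∧ G z < c}, G (g z) = G z := by
    intro z hz
    have := hGf (g z) (hgm hz)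
    rw [hfg z hz] at this
    exact this.symm
  refine ⟨hGf, fun b hb hbc => ?_⟩
  have hsub : {z : ℂ × ℂ | 0 < G z ∧ G z < b} ⊆ {z : ℂ × ℂ | 0 < G z ∧ G z < c} :=
    fun z hz => ⟨hz.1, hz.2.trans hbc⟩
  have hfm' : Set.MapsTo f {z : ℂ × ℂ | 0 < G z ∧ G z < b} {z : ℂ × ℂ | 0 < G z ∧ G z < b} := by
    intro z hz
    have h := hGf z (hsub hz)
    exact ⟨h.symm ▸ hz.1, h.symm ▸ hz.2⟩
  have hgm' : Set.MapsTo g {z : ℂ × ℂ | 0 < G z ∧ G z < b} {z : ℂ × ℂ | 0 < G z ∧ G z < b} := by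
    intro z hz
    have h := hGg z (hsub hz)
    exact ⟨h.symm ▸ hz.1, h.symm ▸ hz.2⟩
  exact ⟨Set.Subset.antisymm hfm'.image_subset
      (fun w hw => ⟨g w, hgm' hw, hfg w (hsub hw)⟩),
    hfd.mono hsub, hgd.mono hsub, hfm', hgm',
    fun z hz => hgf z (hsub hz), fun w hw => hfg w (hsub hw)⟩
end
end

section
/- Suppose L is an affine map of ℂ², i.e. L(x,y) = (a₁x + a₂y + a₃, b₁x + b₂y + b₃) with aᵢ, bᵢ ∈ ℂ, such that L(K⁺) = K⁺. Then L(K⁻) = K⁻, and there exist constants e, f ∈ ℂ with |e| = |f| = 1 such that L(x,y) = (e·x, f·y) for all (x,y). Moreover L ∘ H² = H² ∘ L on ℂ². -/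
open Filter Topology Set

noncomputable section

namespace HenonAux

open Polynomial

def hen (p : Polynomial ℂ) (a : ℂ) (z : ℂ × ℂ) : ℂ × ℂ := (z.2, p.eval z.2 - a * z.1)

def KP (p : Polynomial ℂ) (a : ℂ) : Set (ℂ × ℂ) :=
  {z : ℂ × ℂ | Bornology.IsBounded (Set.range fun n : ℕ => (hen p a)^[n] z)}

lemma superlinear (p : Polynomial ℂ) (h : 2 ≤ p.natDegree) (M : ℝ) :
    ∃ C : ℝ, 0 ≤ C ∧ ∀ w : ℂ, M * ‖w‖ ≤ ‖p.eval w‖ + C := by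
  have hdeg : 0 < p.divX.degree := by
    rw [← natDegree_pos_iff_degree_pos, natDegree_divX_eq_natDegree_tsub_one]; omega
  have ht := Polynomial.tendsto_norm_atTop p.divX hdeg
    (l := comap (fun w : ℂ => ‖w‖) atTop) (z := fun w => w) tendsto_comap
  have h1 := ht.eventually_ge_atTop M
  rw [eventually_comap] at h1
  obtain ⟨r, hr⟩ := eventually_atTop.1 h1
  refine ⟨‖p.coeff 0‖ + |M| * |r|, by positivity, fun w => ?_⟩
  by_cases hw : r ≤ ‖w‖
  · have h2 := hr _ hw w rfl
    have h3 : p.eval w = p.divX.eval w * w + p.coeff 0 := by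
      conv_lhs => rw [← divX_mul_X_add p]
      simp
    have h4 : ‖p.divX.eval w * w‖ ≤ ‖p.eval w‖ + ‖p.coeff 0‖ := by
      have : p.divX.eval w * w = p.eval w - p.coeff 0 := by rw [h3]; ring
      rw [this]; exact norm_sub_le _ _
    rw [norm_mul] at h4
    have h5 := mul_le_mul_of_nonneg_right h2 (norm_nonneg w)
    have : 0 ≤ |M| * |r| := by positivity
    linarith
  · have h1 : M * ‖w‖ ≤ |M| * |r| := by
      calc M * ‖w‖ ≤ |M| * ‖w‖ := by gcongr; exact le_abs_self M
        _ ≤ |M| * |r| := by gcongr; exact (not_le.1 hw).le.trans (le_abs_self r)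
    have := norm_nonneg (p.eval w)
    have := norm_nonneg (p.coeff 0)
    linarith

lemma sublinear_const (q : Polynomial ℂ)
    (h : ∀ ε > 0, ∃ C : ℝ, ∀ y : ℂ, ‖q.eval y‖ ≤ ε * ‖y‖ + C) : q = C (q.coeff 0) := by
  by_cases h2 : 2 ≤ q.natDegree
  · exfalso
    obtain ⟨c, hc⟩ := h 1 one_pos
    obtain ⟨c', -, hc'⟩ := superlinear q h2 2
    have h1 := hc ((|c| + |c'| + 1 : ℝ) : ℂ)
    have h3 := hc' ((|c| + |c'| + 1 : ℝ) : ℂ)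
    rw [Complex.norm_of_nonneg (by positivity)] at h1 h3
    have := le_abs_self c
    have := le_abs_self c'
    linarith
  · have hq : q = C (q.coeff 1) * X + C (q.coeff 0) :=
      Polynomial.eq_X_add_C_of_natDegree_le_one (by omega)
    suffices q.coeff 1 = 0 by
      conv_lhs => rw [hq, this]
      simp
    by_contra hne
    have hpos : 0 < ‖q.coeff 1‖ := norm_pos_iff.2 hne
    obtain ⟨c, hc⟩ := h (‖q.coeff 1‖ / 2) (by positivity)
    have key : ∀ y : ℂ, ‖q.coeff 1‖ / 2 * ‖y‖ ≤ c + ‖q.coeff 0‖ := by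
      intro y
      have h1 := hc y
      have h3 : q.eval y = q.coeff 1 * y + q.coeff 0 := by
        conv_lhs => rw [hq]
        simp
      have h4 : ‖q.coeff 1 * y‖ ≤ ‖q.eval y‖ + ‖q.coeff 0‖ := by
        have : q.coeff 1 * y = q.eval y - q.coeff 0 := by rw [h3]; ring
        rw [this]; exact norm_sub_le _ _
      rw [norm_mul] at h4
      linarith
    have h5 := key (((|c| + ‖q.coeff 0‖ + 1) / (‖q.coeff 1‖ / 2) : ℝ) : ℂ)
    rw [Complex.norm_of_nonneg (by positivity), mul_div_cancel₀ _ (by positivity)] at h5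
    have := le_abs_self c
    linarith

lemma exists_R (p : Polynomial ℂ) (h : 2 ≤ p.natDegree) (a : ℂ) :
    ∃ R : ℝ, 0 < R ∧ ∀ x y : ℂ, max R ‖x‖ ≤ ‖y‖ → 2 * ‖y‖ ≤ ‖p.eval y - a * x‖ := by
  obtain ⟨c, hc0, hc⟩ := superlinear p h (‖a‖ + 3)
  refine ⟨c + 1, by linarith, fun x y hxy => ?_⟩
  have h1 := hc y
  have h2 : c + 1 ≤ ‖y‖ := (le_max_left _ _).trans hxy
  have h3 : ‖x‖ ≤ ‖y‖ := (le_max_right _ _).trans hxy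
  have h4 : ‖p.eval y‖ - ‖a * x‖ ≤ ‖p.eval y - a * x‖ := norm_sub_norm_le _ _
  have h5 : ‖a * x‖ ≤ ‖a‖ * ‖y‖ := by rw [norm_mul]; gcongr
  linarith

lemma hen_grow {p : Polynomial ℂ} {a : ℂ} {R : ℝ}
    (hR : ∀ x y : ℂ, max R ‖x‖ ≤ ‖y‖ → 2 * ‖y‖ ≤ ‖p.eval y - a * x‖)
    (z : ℂ × ℂ) (hz : max R ‖z.1‖ ≤ ‖z.2‖) (n : ℕ) :
    max R ‖((hen p a)^[n] z).1‖ ≤ ‖((hen p a)^[n] z).2‖ ∧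
      2 ^ n * ‖z.2‖ ≤ ‖((hen p a)^[n] z).2‖ := by
  induction n with
  | zero => simpa using hz
  | succ n ih =>
    rw [Function.iterate_succ_apply']
    set w := (hen p a)^[n] z
    have h1 := hR w.1 w.2 ih.1
    simp only [hen]
    have h2 := norm_nonneg w.2
    refine ⟨max_le ?_ ?_, ?_⟩
    · have := (le_max_left _ _).trans ih.1
      linarith
    · linarith
    · rw [pow_succ]; linarith [ih.2]

lemma mem_KP_iff {p : Polynomial ℂ} {a : ℂ} {R : ℝ} (hR0 : 0 < R)
    (hR : ∀ x y : ℂ, max R ‖x‖ ≤ ‖y‖ → 2 * ‖y‖ ≤ ‖p.eval y - a * x‖) (z : ℂ × ℂ) :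
    z ∈ KP p a ↔ ∀ n, ‖((hen p a)^[n] z).2‖ ≤ max R ‖((hen p a)^[n] z).1‖ := by
  constructor
  · intro hz n
    by_contra! hn
    obtain ⟨B, hB⟩ := (isBounded_iff_forall_norm_le).1 (show Bornology.IsBounded (Set.range fun n : ℕ => (hen p a)^[n] z) from hz)
    set w := (hen p a)^[n] z with hw
    have hpos : 0 < ‖w.2‖ := lt_of_lt_of_le hR0 ((le_max_left _ _).trans hn.le)
    obtain ⟨k, hk⟩ := pow_unbounded_of_one_lt (B / ‖w.2‖) (one_lt_two)
    have h1 := (hen_grow hR w hn.le k).2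
    have h2 := hB ((hen p a)^[k] w) ⟨k + n, by simp [hw, Function.iterate_add_apply]⟩
    rw [div_lt_iff₀ hpos] at hk
    have h3 := norm_snd_le ((hen p a)^[k] w)
    linarith
  · intro h
    have key : ∀ n, ‖((hen p a)^[n] z).1‖ ≤ max R ‖z.1‖ ∧
        ‖((hen p a)^[n] z).2‖ ≤ max R ‖z.1‖ := by
      intro n
      induction n with
      | zero => exact ⟨le_max_right _ _, h 0⟩
      | succ n ih =>
        have h1 := h (n + 1)
        have h0 : ‖((hen p a)^[n+1] z).1‖ ≤ max R ‖z.1‖ := by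
          rw [Function.iterate_succ_apply']
          exact ih.2
        exact ⟨h0, h1.trans (max_le (le_max_left _ _) h0)⟩
    change Bornology.IsBounded (Set.range fun n : ℕ => (hen p a)^[n] z)
    refine (isBounded_iff_forall_norm_le).2 ⟨max R ‖z.1‖, ?_⟩
    rintro _ ⟨n, rfl⟩
    exact norm_prod_le_iff.2 (key n)

lemma hen_mem_KP {p : Polynomial ℂ} {a : ℂ} (z : ℂ × ℂ) : hen p a z ∈ KP p a ↔ z ∈ KP p a := by
  have : (Set.range fun n : ℕ => (hen p a)^[n] z) =
      insert z (Set.range fun n : ℕ => (hen p a)^[n] (hen p a z)) := by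
    ext w
    constructor
    · rintro ⟨n, rfl⟩
      cases n with
      | zero => left; rfl
      | succ n => right; exact ⟨n, rfl⟩
    · rintro (rfl | ⟨n, rfl⟩)
      · exact ⟨0, rfl⟩
      · exact ⟨n + 1, rfl⟩
  simp only [KP, mem_ofPred_eq, this, Bornology.isBounded_insert]

/-- polynomials giving the orbit on a vertical line -/
def orb (p : Polynomial ℂ) (a c : ℂ) : ℕ → Polynomial ℂ × Polynomial ℂ
  | 0 => (C c, X)
  | n + 1 => ((orb p a c n).2, p.comp (orb p a c n).2 - C a * (orb p a c n).1)

lemma orb_eval (p : Polynomial ℂ) (a c y : ℂ) (n : ℕ) :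
    (hen p a)^[n] (c, y) = ((orb p a c n).1.eval y, (orb p a c n).2.eval y) := by
  induction n with
  | zero => simp [orb]
  | succ n ih =>
    rw [Function.iterate_succ_apply', ih]
    simp [orb, hen, eval_comp]

lemma orb_deg (p : Polynomial ℂ) (h : 2 ≤ p.natDegree) (a c : ℂ) (n : ℕ) :
    (orb p a c n).1.natDegree < (orb p a c n).2.natDegree := by
  induction n with
  | zero => simp [orb]
  | succ n ih =>
    simp only [orb]
    have h1 : (p.comp (orb p a c n).2).natDegree = p.natDegree * (orb p a c n).2.natDegree :=
      natDegree_comp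
    have h2 : (C a * (orb p a c n).1).natDegree ≤ (orb p a c n).1.natDegree :=
      natDegree_C_mul_le _ _
    have h3 : 2 * (orb p a c n).2.natDegree ≤ p.natDegree * (orb p a c n).2.natDegree :=
      Nat.mul_le_mul_right _ h
    rw [natDegree_sub_eq_left_of_natDegree_lt (by omega)]
    omega

lemma slice (p : Polynomial ℂ) (h : 2 ≤ p.natDegree) (a c : ℂ) : ∃ y, (c, y) ∈ KP p a := by
  obtain ⟨R, hR0, hR⟩ := exists_R p h a
  let S : ℕ → Set ℂ := fun n => {y | ∀ k ≤ n,
    ‖(orb p a c k).2.eval y‖ ≤ max R ‖(orb p a c k).1.eval y‖}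
  have hclosed : ∀ n, IsClosed (S n) := by
    intro n
    simp only [S, ofPred_forall]
    refine isClosed_iInter fun k => isClosed_iInter fun _ => isClosed_le ?_ ?_
    · exact (Polynomial.continuous _).norm
    · exact continuous_const.max (Polynomial.continuous _).norm
  have hne : ∀ n, (S n).Nonempty := by
    intro n
    have hd := orb_deg p h a c n
    obtain ⟨y, hy⟩ := IsAlgClosed.exists_root (orb p a c n).2
      (natDegree_pos_iff_degree_pos.1 (by omega)).ne'
    refine ⟨y, fun k hk => ?_⟩
    by_contra! hlt
    have e := orb_eval p a c y k
    have g := (hen_grow hR ((hen p a)^[k] (c, y)) (by rw [e]; exact hlt.le) (n - k)).1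
    rw [← Function.iterate_add_apply, Nat.sub_add_cancel hk, orb_eval] at g
    have hy' : (orb p a c n).2.eval y = 0 := hy
    simp only [hy', norm_zero] at g
    have := (le_max_left _ _).trans g
    linarith
  have hcpt : IsCompact (S 0) := by
    refine Metric.isCompact_of_isClosed_isBounded (hclosed 0) ?_
    refine (isBounded_iff_forall_norm_le).2 ⟨max R ‖c‖, fun y hy => ?_⟩
    simpa [orb] using hy 0 le_rfl
  obtain ⟨y, hy⟩ := IsCompact.nonempty_iInter_of_sequence_nonempty_isCompact_isClosed S
    (fun n y hy k hk => hy k (by omega)) hne hcpt hclosed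
  refine ⟨y, (mem_KP_iff hR0 hR _).2 fun n => ?_⟩
  rw [orb_eval]
  exact (mem_iInter.1 hy n) n le_rfl

lemma KP_small (p : Polynomial ℂ) (h : 2 ≤ p.natDegree) (a : ℂ) (ε : ℝ) (hε : 0 < ε) :
    ∃ C : ℝ, 0 ≤ C ∧ ∀ x y : ℂ, (x, y) ∈ KP p a → ‖y‖ ≤ ε * ‖x‖ + C := by
  obtain ⟨R, hR0, hR⟩ := exists_R p h a
  set M : ℝ := ‖a‖ / ε + 2 with hM
  have hM0 : 0 ≤ ‖a‖ / ε := by positivity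
  obtain ⟨c, hc0, hc⟩ := superlinear p h M
  refine ⟨R + c, by linarith, fun x y hxy => ?_⟩
  have h1 := (mem_KP_iff hR0 hR _).1 hxy 1
  simp only [hen, Function.iterate_one] at h1
  have h2 := hc y
  have h3 : ‖p.eval y‖ - ‖a * x‖ ≤ ‖p.eval y - a * x‖ := norm_sub_norm_le _ _
  have h4 : max R ‖y‖ ≤ R + ‖y‖ := max_le (by linarith [norm_nonneg y]) (by linarith)
  rw [norm_mul] at h3
  have h5 : (M - 1) * ‖y‖ ≤ ‖a‖ * ‖x‖ + (R + c) := by linarith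
  have h6 : (M - 1) * (ε * ‖x‖ + (R + c)) = ‖a‖ * ‖x‖ + ε * ‖x‖ + ‖a‖ / ε * (R + c) + (R + c) := by
    rw [hM]; field_simp; ring
  have h7 : (M - 1) * ‖y‖ ≤ (M - 1) * (ε * ‖x‖ + (R + c)) := by
    rw [h6]
    have : 0 ≤ ε * ‖x‖ := by positivity
    have : 0 ≤ ‖a‖ / ε * (R + c) := by positivity
    linarith
  exact le_of_mul_le_mul_left h7 (by linarith)

lemma inv_mem_KP {p : Polynomial ℂ} {a : ℂ} (ha : a ≠ 0) (y w : ℂ) (h : (y, w) ∈ KP p a) :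
    ((p.eval y - w) / a, y) ∈ KP p a := by
  rw [← hen_mem_KP]
  have : hen p a ((p.eval y - w) / a, y) = (y, w) := by
    simp only [hen]; rw [mul_div_cancel₀ _ ha]; simp
  rwa [this]

lemma b1_zero (p : Polynomial ℂ) (h : 2 ≤ p.natDegree) (a : ℂ)
    (a1 a2 a3 b1 b2 b3 : ℂ)
    (hL : ∀ x y : ℂ, (x, y) ∈ KP p a →
      (a1 * x + a2 * y + a3, b1 * x + b2 * y + b3) ∈ KP p a) : b1 = 0 := by
  by_contra hb
  have hb' : 0 < ‖b1‖ := norm_pos_iff.2 hb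
  set s : ℝ := ‖b2‖ + ‖a1‖ + ‖a2‖ + 1 with hs
  have hs1 : 1 ≤ s := by
    have := norm_nonneg b2; have := norm_nonneg a1; have := norm_nonneg a2; linarith
  obtain ⟨ε, hε, hε1, hεs⟩ : ∃ ε : ℝ, 0 < ε ∧ ε ≤ 1 ∧ ε * s ≤ ‖b1‖ / 2 := by
    refine ⟨min 1 (‖b1‖ / 2 / s), by positivity, min_le_left _ _, ?_⟩
    calc _ ≤ ‖b1‖ / 2 / s * s := by gcongr; exact min_le_right _ _
      _ = _ := by field_simp
  obtain ⟨c, hc0, hc⟩ := KP_small p h a ε hε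
  have key : ∀ x : ℂ, ‖b1‖ / 2 * ‖x‖ ≤ ‖b2‖ * c + ‖b3‖ + ‖a2‖ * c + ‖a3‖ + c := by
    intro x
    obtain ⟨y, hy⟩ := slice p h a x
    have h1 := hc _ _ hy
    have h2 := hc _ _ (hL _ _ hy)
    have h3 : ‖b1 * x‖ ≤ ‖b1 * x + b2 * y + b3‖ + ‖b2 * y‖ + ‖b3‖ := by
      have : b1 * x = (b1 * x + b2 * y + b3) - b2 * y - b3 := by ring
      calc ‖b1 * x‖ = ‖(b1 * x + b2 * y + b3) - b2 * y - b3‖ := by rw [← this]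
        _ ≤ ‖(b1 * x + b2 * y + b3) - b2 * y‖ + ‖b3‖ := norm_sub_le _ _
        _ ≤ _ := by gcongr; exact norm_sub_le _ _
    have h4 : ‖a1 * x + a2 * y + a3‖ ≤ ‖a1 * x‖ + ‖a2 * y‖ + ‖a3‖ := norm_add₃_le
    rw [norm_mul, norm_mul] at h3 h4
    have h5 : ‖b2‖ * ‖y‖ ≤ ‖b2‖ * (ε * ‖x‖ + c) := by gcongr
    have h6 : ‖a2‖ * ‖y‖ ≤ ‖a2‖ * (‖x‖ + c) := by
      gcongr
      have : ε * ‖x‖ ≤ 1 * ‖x‖ := by gcongr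
      linarith
    have h7 : ε * ‖a1 * x + a2 * y + a3‖ ≤ ε * (‖a1‖ * ‖x‖ + ‖a2‖ * (‖x‖ + c) + ‖a3‖) := by
      gcongr; linarith
    have h8 : ε * (‖a2‖ * c + ‖a3‖) ≤ 1 * (‖a2‖ * c + ‖a3‖) := by gcongr
    have h9 : ε * s * ‖x‖ ≤ ‖b1‖ / 2 * ‖x‖ := by gcongr
    have h10 : ε * s * ‖x‖ = ε * ‖b2‖ * ‖x‖ + ε * ‖a1‖ * ‖x‖ + ε * ‖a2‖ * ‖x‖ + ε * ‖x‖ := by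
      rw [hs]; ring
    have h11 : 0 ≤ ε * ‖x‖ := by positivity
    linarith
  set B := ‖b2‖ * c + ‖b3‖ + ‖a2‖ * c + ‖a3‖ + c with hB
  have hB0 : 0 ≤ B := by positivity
  have h5 := key (((B + 1) / (‖b1‖ / 2) : ℝ) : ℂ)
  rw [Complex.norm_of_nonneg (by positivity), mul_div_cancel₀ _ (by positivity)] at h5
  linarith

lemma key_step (p : Polynomial ℂ) (h : 2 ≤ p.natDegree) (a : ℂ) (ha : a ≠ 0)
    (a1 a2 a3 b2 b3 : ℂ)
    (hL : ∀ x y : ℂ, (x, y) ∈ KP p a →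
      (a1 * x + a2 * y + a3, b2 * y + b3) ∈ KP p a) :
    ∃ k : ℂ, p.comp (C b2 * X + C b3) = C a1 * p + C (a * a2) * X + C (a * a3 + k) ∧
      ∀ x y : ℂ, (x, y) ∈ KP p a → (b2 * x + b3, a1 * y + k) ∈ KP p a := by
  set q : Polynomial ℂ := p.comp (C b2 * X + C b3) - C a1 * p - C (a * a2) * X - C (a * a3) with hq
  have hqe : ∀ y, q.eval y = p.eval (b2 * y + b3) - a1 * p.eval y - a * a2 * y - a * a3 := by
    intro y; simp [hq, eval_comp]
  have step : ∀ y w : ℂ, (y, w) ∈ KP p a → (b2 * y + b3, a1 * w + q.eval y) ∈ KP p a := by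
    intro y w hyw
    have h1 := (hen_mem_KP _).2 (hL _ _ (inv_mem_KP ha y w hyw))
    convert h1 using 1
    simp only [hen, hqe, Prod.mk.injEq, true_and]
    field_simp
    ring
  have hconst : q = C (q.coeff 0) := by
    apply sublinear_const
    intro ε hε
    set s : ℝ := ‖a1‖ + ‖b2‖ + 1 with hs
    have hs0 : 0 < s := by positivity
    obtain ⟨c, hc0, hc⟩ := KP_small p h a (ε / s) (by positivity)
    refine ⟨‖a1‖ * c + ε / s * ‖b3‖ + c, fun y => ?_⟩
    obtain ⟨w, hw⟩ := slice p h a y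
    have h1 := hc _ _ hw
    have h2 := hc _ _ (step _ _ hw)
    have h3 : ‖q.eval y‖ ≤ ‖a1 * w + q.eval y‖ + ‖a1 * w‖ := by
      calc ‖q.eval y‖ = ‖(a1 * w + q.eval y) - a1 * w‖ := by congr 1; ring
        _ ≤ _ := norm_sub_le _ _
    rw [norm_mul] at h3
    have h4 : ‖b2 * y + b3‖ ≤ ‖b2‖ * ‖y‖ + ‖b3‖ := by
      rw [← norm_mul]; exact norm_add_le _ _
    have h5 : ‖a1‖ * ‖w‖ ≤ ‖a1‖ * (ε / s * ‖y‖ + c) := by gcongr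
    have h6 : ε / s * ‖b2 * y + b3‖ ≤ ε / s * (‖b2‖ * ‖y‖ + ‖b3‖) := by gcongr
    have h7 : ε * ‖y‖ = ε / s * ‖y‖ * s := by field_simp
    have h8 : ε / s * ‖y‖ * s = ε / s * ‖y‖ * ‖a1‖ + ε / s * ‖y‖ * ‖b2‖ + ε / s * ‖y‖ := by
      rw [hs]; ring
    have h9 : 0 ≤ ε / s * ‖y‖ := by positivity
    linarith
  refine ⟨q.coeff 0, ?_, ?_⟩
  · rw [C_add, ← hconst, hq]; ring
  · intro x y hxy
    have h1 := step x y hxy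
    rw [hconst] at h1
    simpa using h1

lemma comp_coeff (p : Polynomial ℂ) (b c : ℂ) (n : ℕ) :
    (p.comp (C b * X + C c)).coeff n = (hasseDeriv n p).eval c * b ^ n := by
  have : p.comp (C b * X + C c) = (taylor c p).comp (C b * X) := by
    rw [taylor_apply, comp_assoc]; simp
  rw [this, comp_C_mul_X_coeff, taylor_coeff]

lemma comp_coeff_top (p : Polynomial ℂ) (hp : p.Monic) (b c : ℂ) :
    (p.comp (C b * X + C c)).coeff p.natDegree = b ^ p.natDegree := by
  rw [comp_coeff]
  have h1 : (hasseDeriv p.natDegree p).natDegree = 0 := by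
    have := natDegree_hasseDeriv_le p p.natDegree; omega
  rw [eq_C_of_natDegree_eq_zero h1]
  simp [hasseDeriv_coeff, hp.coeff_natDegree]

lemma comp_coeff_sub (p : Polynomial ℂ) (hp : p.Monic) (h : 2 ≤ p.natDegree)
    (hc : p.coeff (p.natDegree - 1) = 0) (b c : ℂ) :
    (p.comp (C b * X + C c)).coeff (p.natDegree - 1) =
      p.natDegree * c * b ^ (p.natDegree - 1) := by
  rw [comp_coeff]
  have h1 : (hasseDeriv (p.natDegree - 1) p).natDegree ≤ 1 := by
    have := natDegree_hasseDeriv_le p (p.natDegree - 1); omega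
  rw [eq_X_add_C_of_natDegree_le_one h1]
  have e : 1 + (p.natDegree - 1) = p.natDegree := by omega
  have e2 : p.natDegree.choose (p.natDegree - 1) = p.natDegree := by
    rw [Nat.choose_symm (by omega : 1 ≤ p.natDegree), Nat.choose_one_right]
  simp [hasseDeriv_coeff, hc, e, hp.coeff_natDegree, e2]

lemma ident_top (p : Polynomial ℂ) (hp : p.Monic) (h : 2 ≤ p.natDegree) (a1 b2 b3 s t : ℂ)
    (hid : p.comp (C b2 * X + C b3) = C a1 * p + C s * X + C t) : a1 = b2 ^ p.natDegree := by
  have h1 := congrArg (fun q => q.coeff p.natDegree) hid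
  simp only [comp_coeff_top p hp, coeff_add, coeff_C_mul, hp.coeff_natDegree, coeff_X, coeff_C] at h1
  rw [if_neg (by omega), if_neg (by omega)] at h1
  simpa using h1.symm

lemma ident_sub (p : Polynomial ℂ) (hp : p.Monic) (h : 2 ≤ p.natDegree)
    (hc : p.coeff (p.natDegree - 1) = 0) (a1 b2 b3 t : ℂ) (hb : b2 ≠ 0)
    (hid : p.comp (C b2 * X + C b3) = C a1 * p + C 0 * X + C t) : b3 = 0 := by
  have h1 := congrArg (fun q => q.coeff (p.natDegree - 1)) hid
  simp only [comp_coeff_sub p hp h hc, coeff_add, coeff_C_mul, hc, coeff_C] at h1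
  rw [if_neg (by omega)] at h1
  have h2 : (p.natDegree : ℂ) ≠ 0 := by
    have : p.natDegree ≠ 0 := by omega
    exact_mod_cast this
  have h3 : b2 ^ (p.natDegree - 1) ≠ 0 := pow_ne_zero _ hb
  simpa [h2, h3] using h1

end HenonAux

open HenonAux Polynomial in
theorem main_aux (a : ℂ) (ha : a ≠ 0) (p : Polynomial ℂ) (hp : p.Monic) (h : 2 ≤ p.natDegree)
    (hc : p.coeff (p.natDegree - 1) = 0) (a1 a2 a3 b1 b2 b3 : ℂ)
    (hL : ∀ x y : ℂ, (x, y) ∈ KP p a →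
      (a1 * x + a2 * y + a3, b1 * x + b2 * y + b3) ∈ KP p a)
    (hnc : ¬ (a1 = 0 ∧ a2 = 0 ∧ b1 = 0 ∧ b2 = 0)) :
    a2 = 0 ∧ a3 = 0 ∧ b1 = 0 ∧ b3 = 0 ∧ ‖a1‖ = 1 ∧ ‖b2‖ = 1 ∧
      (∀ y, p.eval (b2 * y) = a1 * p.eval y) ∧ (∀ y, p.eval (a1 * y) = b2 * p.eval y) := by
  have hb1 := b1_zero p h a a1 a2 a3 b1 b2 b3 hL
  subst hb1
  simp only [zero_mul, zero_add] at hL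
  obtain ⟨k0, id0, hL1⟩ := key_step p h a ha a1 a2 a3 b2 b3 hL
  have e0 := ident_top p hp h _ _ _ _ _ id0
  have hb2 : b2 ≠ 0 := by
    rintro rfl
    have ha1 : a1 = 0 := by rw [e0]; exact zero_pow (by omega)
    refine hnc ⟨ha1, ?_, rfl, rfl⟩
    have h1 := congrArg (fun q => q.coeff 1) id0
    simp [ha1, coeff_C] at h1
    exact (h1.resolve_left ha)
  have ha1 : a1 ≠ 0 := by rw [e0]; exact pow_ne_zero _ hb2
  obtain ⟨k1, id1, hL2⟩ := key_step p h a ha b2 0 b3 a1 k0 (by simpa using hL1)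
  have e1 := ident_top p hp h _ _ _ _ _ id1
  have hk0 : k0 = 0 := ident_sub p hp h hc _ _ _ _ ha1 (by rw [mul_zero] at id1; exact id1)
  subst hk0
  obtain ⟨k2, id2, hL3⟩ := key_step p h a ha a1 0 0 b2 k1 (by simpa using hL2)
  have hk1 : k1 = 0 := ident_sub p hp h hc _ _ _ _ hb2 (by rw [mul_zero] at id2; exact id2)
  subst hk1
  obtain ⟨k3, id3, hL4⟩ := key_step p h a ha b2 0 0 a1 k2 (by simpa using hL3)
  have hk2 : k2 = 0 := ident_sub p hp h hc _ _ _ _ ha1 (by rw [mul_zero] at id3; exact id3)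
  subst hk2
  have i0 : ∀ y, p.eval (b2 * y + b3) = a1 * p.eval y + a * a2 * y + a * a3 := by
    intro y; simpa [eval_comp] using congrArg (fun q => q.eval y) id0
  have i1 : ∀ y, p.eval (a1 * y) = b2 * p.eval y + a * b3 := by
    intro y; simpa [eval_comp] using congrArg (fun q => q.eval y) id1
  have i2 : ∀ y, p.eval (b2 * y) = a1 * p.eval y := by
    intro y; simpa [eval_comp] using congrArg (fun q => q.eval y) id2
  have hb3 : b3 = 0 := by
    have h1 := i1 0
    have h2 := i2 0
    rw [mul_zero] at h1 h2
    have h3 : (1 - a1) * p.eval 0 = 0 := by linear_combination h2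
    rcases mul_eq_zero.1 h3 with h4 | h4
    · have h5 : a1 = 1 := by linear_combination -h4
      rw [h5, one_pow] at e1
      rw [e1] at h1
      have : a * b3 = 0 := by linear_combination -h1
      exact (mul_eq_zero.1 this).resolve_left ha
    · rw [h4] at h1
      have : a * b3 = 0 := by linear_combination -h1
      exact (mul_eq_zero.1 this).resolve_left ha
  subst hb3
  have i3 : ∀ y, a * a2 * y + a * a3 = 0 := by
    intro y
    have h1 := i0 y
    rw [add_zero, i2 y] at h1
    linear_combination -h1
  have ha3 : a3 = 0 := by simpa [ha] using i3 0
  subst ha3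
  have ha2 : a2 = 0 := by simpa [ha] using i3 1
  have hn : ‖b2‖ = 1 := by
    have h1 : ‖b2‖ ^ (p.natDegree * p.natDegree - 1) = 1 := by
      have h2 : b2 ^ (p.natDegree * p.natDegree) = b2 := by
        rw [pow_mul, ← e0, ← e1]
      have h3 : p.natDegree * p.natDegree = (p.natDegree * p.natDegree - 1) + 1 := by
        have : 0 < p.natDegree * p.natDegree := by positivity
        omega
      rw [h3, pow_succ] at h2
      have h4 := mul_right_cancel₀ hb2 (h2.trans (one_mul b2).symm)
      rw [← norm_pow, h4, norm_one]
    refine (pow_eq_one_iff_of_nonneg (norm_nonneg _) ?_).1 h1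
    have : 2 * 2 ≤ p.natDegree * p.natDegree := Nat.mul_le_mul h h
    omega
  refine ⟨ha2, rfl, rfl, rfl, ?_, hn, i2, fun y => by simpa using i1 y⟩
  rw [e0, norm_pow, hn, one_pow]

/-- Suppose `L` is an affine map of `ℂ²` with `L(K⁺) = K⁺`. Then
`L(K⁻) = K⁻`, and there exist constants `e, f` with `|e| = |f| = 1` such that
`L(x,y) = (e·x, f·y)`. Moreover `L ∘ H² = H² ∘ L` on `ℂ²`. -/
theorem stmt_6 (d : ℕ) (hd : 2 ≤ d) (a : ℂ) (ha : a ≠ 0)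
    (p : Polynomial ℂ) (hpm : p.Monic) (hpd : p.natDegree = d)
    (hpc : p.coeff (d - 1) = 0)
    (H : ℂ × ℂ → ℂ × ℂ) (hH : ∀ z : ℂ × ℂ, H z = (z.2, p.eval z.2 - a * z.1))
    (Hinv : ℂ × ℂ → ℂ × ℂ)
    (hHinv : ∀ z : ℂ × ℂ, Hinv z = ((p.eval z.1 - z.2) / a, z.1))
    (Kp Km : Set (ℂ × ℂ))
    (hKp : Kp = {z : ℂ × ℂ | Bornology.IsBounded (Set.range fun n : ℕ => H^[n] z)})
    (hKm : Km = {z : ℂ × ℂ | Bornology.IsBounded (Set.range fun n : ℕ => Hinv^[n] z)})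
    (L : ℂ × ℂ → ℂ × ℂ)
    (hLaff : ∃ a₁ a₂ a₃ b₁ b₂ b₃ : ℂ, ∀ z : ℂ × ℂ,
      L z = (a₁ * z.1 + a₂ * z.2 + a₃, b₁ * z.1 + b₂ * z.2 + b₃))
    (hLK : L '' Kp = Kp) :
    L '' Km = Km ∧
    (∃ e f : ℂ, ‖e‖ = 1 ∧ ‖f‖ = 1 ∧ ∀ z : ℂ × ℂ, L z = (e * z.1, f * z.2)) ∧
    (∀ z : ℂ × ℂ, L (H (H z)) = H (H (L z))) := by
  obtain ⟨a1, a2, a3, b1, b2, b3, hLe⟩ := hLaff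
  have hHe : H = HenonAux.hen p a := funext fun z => hH z
  have hKe : Kp = HenonAux.KP p a := by rw [hKp, hHe]; rfl
  have h2 : 2 ≤ p.natDegree := by omega
  have hmaps : ∀ x y : ℂ, (x, y) ∈ HenonAux.KP p a →
      (a1 * x + a2 * y + a3, b1 * x + b2 * y + b3) ∈ HenonAux.KP p a := by
    intro x y hxy
    rw [← hKe] at hxy ⊢
    rw [← hLK]
    exact ⟨(x, y), hxy, hLe _⟩
  have hnc : ¬ (a1 = 0 ∧ a2 = 0 ∧ b1 = 0 ∧ b2 = 0) := by
    rintro ⟨rfl, rfl, rfl, rfl⟩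
    have hall : ∀ z ∈ Kp, z = (a3, b3) := by
      intro z hz
      rw [← hLK] at hz
      obtain ⟨w, -, rfl⟩ := hz
      simp [hLe]
    obtain ⟨y, hy⟩ := HenonAux.slice p h2 a (a3 + 1)
    rw [← hKe] at hy
    simpa using congrArg Prod.fst (hall _ hy)
  obtain ⟨rfl, rfl, rfl, rfl, hn1, hn2, i2, i1⟩ :=
    main_aux a ha p hpm h2 (by rw [hpd]; exact hpc) a1 a2 a3 b1 b2 b3 hmaps hnc
  have hLd : ∀ z : ℂ × ℂ, L z = (a1 * z.1, b2 * z.2) := by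
    intro z; rw [hLe]; simp
  have ha1 : a1 ≠ 0 := by rintro rfl; simp at hn1
  have hb2 : b2 ≠ 0 := by rintro rfl; simp at hn2
  have hinv2 : ∀ z : ℂ × ℂ, Hinv (a1 * z.1, b2 * z.2) = (b2 * (Hinv z).1, a1 * (Hinv z).2) := by
    intro z; simp only [hHinv, i1, Prod.mk.injEq, and_true]; ring
  have hinv2' : ∀ z : ℂ × ℂ, Hinv (b2 * z.1, a1 * z.2) = (a1 * (Hinv z).1, b2 * (Hinv z).2) := by
    intro z; simp only [hHinv, i2, Prod.mk.injEq, and_true]; ring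
  have hit : ∀ (n : ℕ) (z : ℂ × ℂ),
      Hinv^[n] (a1 * z.1, b2 * z.2) = (a1 * (Hinv^[n] z).1, b2 * (Hinv^[n] z).2) ∨
      Hinv^[n] (a1 * z.1, b2 * z.2) = (b2 * (Hinv^[n] z).1, a1 * (Hinv^[n] z).2) := by
    intro n z
    induction n with
    | zero => left; rfl
    | succ n ih =>
      rw [Function.iterate_succ_apply', Function.iterate_succ_apply']
      rcases ih with ih | ih
      · right; rw [ih, hinv2]
      · left; rw [ih, hinv2']
  have hnorm : ∀ (n : ℕ) (z : ℂ × ℂ), ‖Hinv^[n] (L z)‖ = ‖Hinv^[n] z‖ := by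
    intro n z
    rw [hLd]
    rcases hit n z with h | h <;> rw [h] <;> simp [Prod.norm_def, hn1, hn2]
  have hKmL : ∀ z, L z ∈ Km ↔ z ∈ Km := by
    intro z
    rw [hKm]
    change Bornology.IsBounded (Set.range fun n : ℕ => Hinv^[n] (L z)) ↔
      Bornology.IsBounded (Set.range fun n : ℕ => Hinv^[n] z)
    simp only [isBounded_iff_forall_norm_le, forall_mem_range, hnorm]
  refine ⟨?_, ⟨a1, b2, hn1, hn2, hLd⟩, ?_⟩
  · ext z
    constructor
    · rintro ⟨w, hw, rfl⟩
      exact (hKmL w).2 hw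
    · intro hz
      have hz' : L (z.1 / a1, z.2 / b2) = z := by
        rw [hLd]; ext <;> simp [mul_div_cancel₀, ha1, hb2]
      exact ⟨_, (hKmL _).1 (by rw [hz']; exact hz), hz'⟩
  · intro z
    simp only [hLd, hH, i2, Prod.mk.injEq]
    constructor
    · ring
    · have : a1 * p.eval z.2 - a * (a1 * z.1) = a1 * (p.eval z.2 - a * z.1) := by ring
      rw [this, i1]; ring
end
end
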